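/- arXiv:2111.04234 — 3 statements merged into one kernel-verified Lean document; each statement's English description precedes it below -/
import Mathlib

section
/- The mod (T) Galois representation of φ is surjective: the T-torsion φ[T] (the set of roots in F̄ of the separable polynomial φ_T(x) = Tx + x^{q^{r−1}} + T^{q−1}x^{q^r}) is an 𝔽_q-vector space of dimension r, and every 𝔽_q-linear automorphism of φ[T] is the restriction of some σ ∈ Gal(F̄/F); equivalently, the Galois group of the splitting field of φ_T(x) over F is isomorphic to GL_r(𝔽_q). -/
open Polynomial

noncomputable section

/-- `F̄`: a fixed algebraic closure of `F = 𝔽_q(T)`. -/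
abbrev Kbar (Fq : Type) [Field Fq] := AlgebraicClosure (RatFunc Fq)

/-- `φ` is (encodes) the rank-`r` Drinfeld `𝔽_q[T]`-module over `𝔽_q(T)` given by
`φ_T = T + τ^{r-1} + T^{q-1} τ^r`: it is a ring homomorphism from `A = 𝔽_q[T]` to the
additive endomorphisms of `F̄` which is `𝔽_q`-linear (the condition on `C c`) and sends
`T` to `x ↦ T·x + x^{q^{r-1}} + T^{q-1}·x^{q^r}`. -/
def IsDrinfeldPhi (Fq : Type) [Field Fq] (q r : ℕ)
    (φ : Polynomial Fq →+* AddMonoid.End (Kbar Fq)) : Prop :=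
  (∀ (c : Fq) (x : Kbar Fq),
      φ (C c) x = algebraMap (RatFunc Fq) (Kbar Fq) (RatFunc.C c) * x) ∧
  (∀ x : Kbar Fq, φ X x =
      algebraMap (RatFunc Fq) (Kbar Fq) RatFunc.X * x + x ^ q ^ (r - 1) +
        algebraMap (RatFunc Fq) (Kbar Fq) RatFunc.X ^ (q - 1) * x ^ q ^ r)

/-- The `a`-torsion `φ[a] ⊆ F̄`. -/
def phiTorsion (Fq : Type) [Field Fq] (φ : Polynomial Fq →+* AddMonoid.End (Kbar Fq))
    (a : Polynomial Fq) : Set (Kbar Fq) := {x | φ a x = 0}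

/-- `g` is an `A/(a)`-module automorphism of `φ[a]`: a bijection of `φ[a]` with itself
which is additive and commutes with the `A`-action through `φ`. -/
def IsTorsionAut (Fq : Type) [Field Fq] (φ : Polynomial Fq →+* AddMonoid.End (Kbar Fq))
    (a : Polynomial Fq) (g : Kbar Fq → Kbar Fq) : Prop :=
  Set.BijOn g (phiTorsion Fq φ a) (phiTorsion Fq φ a) ∧
  (∀ x ∈ phiTorsion Fq φ a, ∀ y ∈ phiTorsion Fq φ a, g (x + y) = g x + g y) ∧
  (∀ b : Polynomial Fq, ∀ x ∈ phiTorsion Fq φ a, g (φ b x) = φ b (g x))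

/-- `g` is an `𝔽_q`-linear automorphism of the `T`-torsion `φ[T]`. -/
def IsFqLinearAut (Fq : Type) [Field Fq] (φ : Polynomial Fq →+* AddMonoid.End (Kbar Fq))
    (g : Kbar Fq → Kbar Fq) : Prop :=
  Set.BijOn g (phiTorsion Fq φ X) (phiTorsion Fq φ X) ∧
  (∀ x ∈ phiTorsion Fq φ X, ∀ y ∈ phiTorsion Fq φ X, g (x + y) = g x + g y) ∧
  (∀ c : Fq, ∀ x ∈ phiTorsion Fq φ X,
    g (algebraMap (RatFunc Fq) (Kbar Fq) (RatFunc.C c) * x) =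
      algebraMap (RatFunc Fq) (Kbar Fq) (RatFunc.C c) * g x)

section

open Module WithZero

section

variable {K V : Type*} [Field K] [AddCommGroup V] [Module K V]

theorem LinearEquiv.conj_transvection_eq (e : V ≃ₗ[K] V) {f : Dual K V} {v : V} (h : f v = 0)
    (h' : (f.comp (e⁻¹ : V ≃ₗ[K] V).toLinearMap) (e v) = 0) :
    e * LinearEquiv.transvection h * e⁻¹ = LinearEquiv.transvection h' := by
  ext x
  simp [LinearMap.transvection.apply]

instance transvections_closure_normal :
    (Subgroup.closure (LinearEquiv.transvections K V)).Normal := by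
  refine ⟨fun n hn g => ?_⟩
  induction hn using Subgroup.closure_induction with
  | mem x hx =>
    obtain ⟨f, v, h, rfl⟩ := hx
    have h' : (f.comp (g⁻¹ : V ≃ₗ[K] V).toLinearMap) (g v) = 0 := by simpa using h
    rw [LinearEquiv.conj_transvection_eq g h h']
    exact Subgroup.subset_closure (LinearEquiv.mem_transvections h')
  | one => simp
  | mul x y _ _ hx hy => simpa [mul_assoc] using mul_mem hx hy
  | inv x _ hx => simpa [mul_assoc] using inv_mem hx

/-- The diagonal automorphism with respect to a basis. -/
def diagAut {n : Type*} [Fintype n] [DecidableEq n] (b : Basis n K V) :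
    (n → Kˣ) →* (V ≃ₗ[K] V) where
  toFun d := b.equiv (b.unitsSMul d) (Equiv.refl n)
  map_one' := b.ext' fun i => by simp [Basis.unitsSMul_apply]
  map_mul' d d' := b.ext' fun i => by
    simp [Basis.unitsSMul_apply, Units.smul_def, mul_smul, smul_comm (d i : K)]

theorem diagAut_apply_basis {n : Type*} [Fintype n] [DecidableEq n] (b : Basis n K V)
    (d : n → Kˣ) (i : n) : diagAut b d (b i) = (d i : K) • b i := by
  simp [diagAut, Basis.unitsSMul_apply, Units.smul_def]

theorem diagAut_single_mul_single_inv_mem {n : Type*} [Fintype n] [DecidableEq n]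
    (b : Basis n K V) {i j : n} (hij : i ≠ j) (a : Kˣ) :
    diagAut b (Pi.mulSingle i a * (Pi.mulSingle j a)⁻¹) ∈
      Subgroup.closure (LinearEquiv.transvections K V) := by
  have hv (c : K) : (c • b.coord j) (b i) = 0 := by simp [hij]
  have hw (c : K) : (c • b.coord i) (b j) = 0 := by simp [hij.symm]
  have key : diagAut b (Pi.mulSingle i a * (Pi.mulSingle j a)⁻¹) =
      LinearEquiv.transvection (hv a) * LinearEquiv.transvection (hw (-a⁻¹ : K)) *
      LinearEquiv.transvection (hv a) * LinearEquiv.transvection (hv (-1)) *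
      LinearEquiv.transvection (hw 1) * LinearEquiv.transvection (hv (-1)) := by
    refine b.ext' fun k => ?_
    rw [diagAut_apply_basis]
    by_cases hki : k = i
    · subst hki
      simp [LinearMap.transvection.apply, hij, hij.symm]
    · by_cases hkj : k = j
      · subst hkj
        simp [LinearMap.transvection.apply, hij, hij.symm]
      · simp [LinearMap.transvection.apply, hki, hkj]
  rw [key]
  refine mul_mem (mul_mem (mul_mem (mul_mem (mul_mem ?_ ?_) ?_) ?_) ?_) ?_ <;>
    exact Subgroup.subset_closure (LinearEquiv.mem_transvections _)

theorem transvections_sup_diag {n : Type*} [Fintype n] [DecidableEq n]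
    (b : Basis n K V) (i₀ : n) :
    Subgroup.closure (LinearEquiv.transvections K V) ⊔
      ((diagAut b).comp (MonoidHom.mulSingle (fun _ => Kˣ) i₀)).range = ⊤ := by
  set H := Subgroup.closure (LinearEquiv.transvections K V) ⊔
      ((diagAut b).comp (MonoidHom.mulSingle (fun _ => Kˣ) i₀)).range with hH
  have hsingle (i : n) (a : Kˣ) : diagAut b (Pi.mulSingle i a) ∈ H := by
    have h0 : diagAut b (Pi.mulSingle i₀ a) ∈ H := by
      refine (le_sup_right : _ ≤ H) ⟨a, rfl⟩
    by_cases hi : i = i₀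
    · rw [hi]; exact h0
    · have := mul_mem ((le_sup_left : _ ≤ H) (diagAut_single_mul_single_inv_mem b hi a)) h0
      rwa [← map_mul, inv_mul_cancel_right] at this
  have hdiag (d : n → Kˣ) : diagAut b d ∈ H := by
    rw [← Finset.univ_prod_mulSingle d]
    exact Subgroup.prod_mem (H.comap (diagAut b)) fun i _ => hsingle i _
  rw [eq_top_iff]
  intro e _
  suffices ∀ M : Matrix n n K, M.det ≠ 0 → ∃ e ∈ H, LinearMap.toMatrix b b (e : V →ₗ[K] V) = M by
    obtain ⟨e', he', h⟩ := this (LinearMap.toMatrix b b (e : V →ₗ[K] V)) (by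
      rw [LinearMap.det_toMatrix]
      exact (LinearEquiv.isUnit_det' e).ne_zero)
    rw [EmbeddingLike.apply_eq_iff_eq, LinearEquiv.toLinearMap_inj] at h
    rwa [← h]
  intro M hM
  refine Matrix.diagonal_transvection_induction_of_det_ne_zero
    (fun M => ∃ e ∈ H, LinearMap.toMatrix b b (e : V →ₗ[K] V) = M) M hM ?_ ?_ ?_
  · intro D hD
    have hD' (i) : D i ≠ 0 := by
      rw [Matrix.det_diagonal, Finset.prod_ne_zero_iff] at hD
      exact hD i (Finset.mem_univ i)
    refine ⟨diagAut b (fun i => Units.mk0 (D i) (hD' i)), hdiag _, ?_⟩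
    ext i j
    simp [LinearMap.toMatrix_apply, diagAut_apply_basis, Matrix.diagonal_apply,
      Finsupp.single_apply]
    aesop
  · rintro ⟨i, j, hij, c⟩
    have hv : (c • b.coord j) (b i) = 0 := by simp [hij]
    refine ⟨LinearEquiv.transvection hv, (le_sup_left : _ ≤ H)
      (Subgroup.subset_closure (LinearEquiv.mem_transvections hv)), ?_⟩
    ext k l
    simp [LinearMap.toMatrix_apply, LinearMap.transvection.apply, Matrix.transvection,
      Matrix.one_apply, Finsupp.single_apply, Matrix.single_apply]
    aesop
  · rintro A B - - ⟨e, he, rfl⟩ ⟨e', he', rfl⟩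
    exact ⟨e * e', mul_mem he he', by rw [← LinearMap.toMatrix_mul]; rfl⟩

/-- The special linear group is generated by transvections. -/
theorem mem_closure_transvections_of_det_eq_one [Module.Finite K V] [Nontrivial V]
    (e : V ≃ₗ[K] V) (he : LinearEquiv.det e = 1) :
    e ∈ Subgroup.closure (LinearEquiv.transvections K V) := by
  classical
  let b := Module.finBasis K V
  let i₀ : Fin (finrank K V) := ⟨0, finrank_pos⟩
  have htop : e ∈ Subgroup.closure (LinearEquiv.transvections K V) ⊔
      ((diagAut b).comp (MonoidHom.mulSingle (fun _ => Kˣ) i₀)).range := by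
    rw [transvections_sup_diag]; trivial
  obtain ⟨t, ht, _, ⟨a, rfl⟩, rfl⟩ := Subgroup.mem_sup_of_normal_left.mp htop
  have hdt : LinearEquiv.det t = 1 := by
    have : Subgroup.closure (LinearEquiv.transvections K V) ≤ (LinearEquiv.det).ker := by
      rw [Subgroup.closure_le]
      rintro _ ⟨f, v, h, rfl⟩
      simp
    exact this ht
  have hda : LinearEquiv.det (diagAut b (Pi.mulSingle i₀ a)) = a := by
    ext
    rw [LinearEquiv.coe_det, ← LinearMap.det_toMatrix b]
    have : LinearMap.toMatrix b b (diagAut b (Pi.mulSingle i₀ a) : V →ₗ[K] V) =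
        Matrix.diagonal (fun i => ((Pi.mulSingle i₀ a : _ → Kˣ) i : K)) := by
      ext i j
      simp [LinearMap.toMatrix_apply, diagAut_apply_basis, Matrix.diagonal_apply,
        Finsupp.single_apply]
      aesop
    rw [this, Matrix.det_diagonal, ← Units.coe_prod, Finset.prod_pi_mulSingle']
    simp
  rw [map_mul, hdt, one_mul] at he
  have ha : a = 1 := hda.symm.trans he
  rw [ha, map_one, mul_one]
  exact ht

end

section

variable {K V : Type*} [Field K] [AddCommGroup V] [Module K V]

/-- The functionals all of whose transvections lie in a given subgroup. -/
def transvectionDual (G : Subgroup (V ≃ₗ[K] V)) : Submodule K (Dual K V) where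
  carrier := {μ | ∀ v (h : μ v = 0), LinearEquiv.transvection h ∈ G}
  zero_mem' v h := by
    convert G.one_mem
    ext x
    simp
  smul_mem' c μ hμ v h := by
    have h' : μ (c • v) = 0 := by simpa using h
    convert hμ _ h' using 1
    ext x
    simp [LinearMap.transvection.apply, smul_smul, mul_comm]
  add_mem' {μ ν} hμ hν v h := by
    by_cases hw : ∃ w, μ w = 0 ∧ ν w = 1
    · obtain ⟨w, hw, hw'⟩ := hw
      have hwn : μ (-w) = 0 := by simpa using hw
      set e := LinearEquiv.transvection hwn with he
      have hinv : e⁻¹ = LinearEquiv.transvection hw := by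
        rw [he, LinearEquiv.transvection.inv_eq hwn (by simpa using hw)]
        ext x
        simp
      have hcomp (x : V) : ν (e⁻¹ x) = (μ + ν) x := by
        rw [hinv]
        simp [LinearMap.transvection.apply, hw', add_comm]
      have hv' : ν (e⁻¹ v) = 0 := by rw [hcomp, h]
      have h' : (ν.comp (e⁻¹ : V ≃ₗ[K] V).toLinearMap) (e (e⁻¹ v)) = 0 := by
        simpa using hv'
      have hconj := LinearEquiv.conj_transvection_eq e hv' h'
      have : LinearEquiv.transvection h = LinearEquiv.transvection h' := by
        ext x
        have := hcomp x
        simp only [LinearEquiv.coe_inv] at this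
        simp [LinearMap.transvection.apply, this]
      rw [this, ← hconj]
      exact mul_mem (mul_mem (hμ _ hwn) (hν _ hv')) (inv_mem (hμ _ hwn))
    · push Not at hw
      have hker : ∀ x, μ x = 0 → ν x = 0 := by
        intro x hx
        by_contra hne
        exact hw ((ν x)⁻¹ • x) (by simp [hx]) (by simp [hne])
      by_cases h0 : ν v = 0
      · have h1 : μ v = 0 := by simpa [h0] using h
        have : LinearEquiv.transvection h =
            LinearEquiv.transvection h1 * LinearEquiv.transvection h0 := by
          ext x
          simp [LinearMap.transvection.apply, h1, add_smul]
          abel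
        rw [this]
        exact mul_mem (hμ _ h1) (hν _ h0)
      · have h1 : μ v ≠ 0 := fun h1 => h0 (hker v h1)
        have hzero : μ + ν = 0 := by
          ext x
          have := hker (x - (μ x / μ v) • v) (by simp [h1])
          have h2 : ν v = - μ v := by
            have : μ v + ν v = 0 := h
            linear_combination this
          simp only [map_sub, map_smul, smul_eq_mul, h2] at this
          field_simp at this
          simp only [LinearMap.add_apply, LinearMap.zero_apply]
          linear_combination this
        convert G.one_mem
        ext x
        simp [hzero]

/-- An irreducible linear group with full determinant that contains all transvections along one
hyperplane is the full general linear group. -/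
theorem subgroup_eq_top_of_transvections [Module.Finite K V] [Nontrivial V]
    (G : Subgroup (V ≃ₗ[K] V))
    (hirr : ∀ U : Submodule K V, (∀ g ∈ G, ∀ u ∈ U, g u ∈ U) → U = ⊥ ∨ U = ⊤)
    (f : Dual K V) (hf : f ≠ 0)
    (htr : ∀ v (h : f v = 0), LinearEquiv.transvection h ∈ G)
    (hdet : ∀ d : Kˣ, ∃ g ∈ G, LinearEquiv.det g = d) : G = ⊤ := by
  have hS : (transvectionDual G).dualCoannihilator = ⊥ := by
    refine (hirr _ ?_).resolve_right ?_
    · intro g hg u hu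
      rw [Submodule.mem_dualCoannihilator] at hu ⊢
      intro μ hμ
      refine hu (μ.comp g.toLinearMap) fun v h => ?_
      have h1 : μ (g v) = 0 := h
      have h' : (μ.comp (g⁻¹⁻¹ : V ≃ₗ[K] V).toLinearMap) (g⁻¹ (g v)) = 0 := by
        simpa using h1
      have := LinearEquiv.conj_transvection_eq g⁻¹ h1 h'
      have h3 : LinearEquiv.transvection h = LinearEquiv.transvection h' := by
        ext x
        simp [LinearMap.transvection.apply]
      rw [h3, ← this]
      exact mul_mem (mul_mem (inv_mem hg) (hμ _ h1)) (inv_mem (inv_mem hg))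
    · intro htop
      apply hf
      ext v
      have : v ∈ (transvectionDual G).dualCoannihilator := by rw [htop]; trivial
      rw [Submodule.mem_dualCoannihilator] at this
      exact this f htr
  have hS' : transvectionDual G = ⊤ := by
    rw [← Subspace.dualCoannihilator_dualAnnihilator_eq (W := transvectionDual G), hS]
    simp
  have hle : Subgroup.closure (LinearEquiv.transvections K V) ≤ G := by
    rw [Subgroup.closure_le]
    rintro _ ⟨μ, v, h, rfl⟩
    have : μ ∈ transvectionDual G := by rw [hS']; trivial
    exact this v h
  rw [eq_top_iff]
  intro e _
  obtain ⟨g, hg, hdg⟩ := hdet (LinearEquiv.det e)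
  have := hle (mem_closure_transvections_of_det_eq_one (e * g⁻¹) (by simp [hdg]))
  simpa using mul_mem this hg

end

section

variable (Fq : Type*) [Field Fq] [Fintype Fq] {L : Type*} [Field L] [Algebra Fq L]

/-- The `𝔽_q`-linear operator `x ↦ t x + x ^ q ^ m + t ^ (q - 1) x ^ q ^ (m + 1)`. -/
def torsionMap (m : ℕ) (t : L) : L →ₗ[Fq] L :=
  t • LinearMap.id + ((FiniteField.frobeniusAlgHom Fq L) ^ m).toLinearMap +
    t ^ (Fintype.card Fq - 1) • ((FiniteField.frobeniusAlgHom Fq L) ^ (m + 1)).toLinearMap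

theorem frobeniusAlgHom_pow_apply (n : ℕ) (x : L) :
    ((FiniteField.frobeniusAlgHom Fq L) ^ n) x = x ^ Fintype.card Fq ^ n := by
  rw [AlgHom.coe_pow, FiniteField.coe_frobeniusAlgHom, pow_iterate]

theorem torsionMap_apply (m : ℕ) (t x : L) :
    torsionMap Fq m t x = t * x + x ^ Fintype.card Fq ^ m +
      t ^ (Fintype.card Fq - 1) * x ^ Fintype.card Fq ^ (m + 1) := by
  simp [torsionMap, frobeniusAlgHom_pow_apply]

/-- The kernel of `torsionMap`. -/
def torsion (m : ℕ) (t : L) : Submodule Fq L := LinearMap.ker (torsionMap Fq m t)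

theorem mem_torsion {m : ℕ} {t x : L} : x ∈ torsion Fq m t ↔
    t * x + x ^ Fintype.card Fq ^ m +
      t ^ (Fintype.card Fq - 1) * x ^ Fintype.card Fq ^ (m + 1) = 0 := by
  rw [torsion, LinearMap.mem_ker, torsionMap_apply]

/-- The polynomial whose roots are the nonzero elements of `torsion`. -/
def torsionPoly (m : ℕ) (t : L) : L[X] :=
  C t + X ^ (Fintype.card Fq ^ m - 1) +
    C (t ^ (Fintype.card Fq - 1)) * X ^ (Fintype.card Fq ^ (m + 1) - 1)

theorem cast_card_eq_zero_of_algebra : ((Fintype.card Fq : ℕ) : L) = 0 := by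
  have := congrArg (algebraMap Fq L) (FiniteField.cast_card_eq_zero Fq)
  rwa [map_natCast, map_zero] at this

theorem mem_torsion_iff_isRoot {m : ℕ} {t x : L} (hx : x ≠ 0) :
    x ∈ torsion Fq m t ↔ (torsionPoly Fq m t).IsRoot x := by
  have hq (n : ℕ) : x ^ Fintype.card Fq ^ n = x * x ^ (Fintype.card Fq ^ n - 1) := by
    rw [mul_pow_sub_one (pow_ne_zero _ Fintype.card_ne_zero)]
  rw [mem_torsion, hq, hq, IsRoot.def, torsionPoly]
  simp only [eval_add, eval_C, eval_pow, eval_X, eval_mul]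
  constructor
  · intro h
    refine (mul_eq_zero.mp ?_).resolve_left hx
    linear_combination h
  · intro h
    linear_combination x * h

variable {t : L} {m : ℕ}

theorem natDegree_torsionPoly (ht : t ≠ 0) :
    (torsionPoly Fq m t).natDegree = Fintype.card Fq ^ (m + 1) - 1 := by
  have h1 : Fintype.card Fq ^ m < Fintype.card Fq ^ (m + 1) :=
    Nat.pow_lt_pow_right Fintype.one_lt_card (by omega)
  have h2 : 0 < Fintype.card Fq ^ m := pow_pos Fintype.card_pos _
  have h3 : (C (t ^ (Fintype.card Fq - 1)) * X ^ (Fintype.card Fq ^ (m + 1) - 1)).natDegree =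
      Fintype.card Fq ^ (m + 1) - 1 :=
    natDegree_C_mul_X_pow _ _ (pow_ne_zero _ ht)
  rw [torsionPoly, natDegree_add_eq_right_of_natDegree_lt, h3]
  rw [h3, add_comm, natDegree_add_C, natDegree_X_pow]
  omega

theorem leadingCoeff_torsionPoly (ht : t ≠ 0) :
    (torsionPoly Fq m t).leadingCoeff = t ^ (Fintype.card Fq - 1) := by
  have h1 : Fintype.card Fq ^ m < Fintype.card Fq ^ (m + 1) :=
    Nat.pow_lt_pow_right Fintype.one_lt_card (by omega)
  have h2 : 0 < Fintype.card Fq ^ m := pow_pos Fintype.card_pos _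
  rw [leadingCoeff, natDegree_torsionPoly Fq ht, torsionPoly]
  rw [coeff_add, coeff_add, coeff_C_mul_X_pow, coeff_C, coeff_X_pow, if_neg (by omega),
    if_neg (by omega), if_pos rfl, zero_add, zero_add]

theorem coeff_zero_torsionPoly (hm : m ≠ 0) : (torsionPoly Fq m t).coeff 0 = t := by
  have h1 : 1 < Fintype.card Fq ^ m := Nat.one_lt_pow hm Fintype.one_lt_card
  have h2 : 1 < Fintype.card Fq ^ (m + 1) := Nat.one_lt_pow (by omega) Fintype.one_lt_card
  simp only [torsionPoly, coeff_add, coeff_C_zero, coeff_X_pow, coeff_C_mul]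
  rw [if_neg (by omega), if_neg (by omega)]
  simp

theorem torsionPoly_ne_zero (ht : t ≠ 0) : torsionPoly Fq m t ≠ 0 := by
  intro h
  have := leadingCoeff_torsionPoly Fq (m := m) ht
  rw [h, leadingCoeff_zero] at this
  exact pow_ne_zero _ ht this.symm

theorem separable_torsionPoly (ht : t ≠ 0) (hm : m ≠ 0) : (torsionPoly Fq m t).Separable := by
  have hc (n : ℕ) (hn : n ≠ 0) : ((Fintype.card Fq ^ n - 1 : ℕ) : L) = -1 := by
    rw [Nat.cast_sub (Nat.one_le_pow _ _ Fintype.card_pos)]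
    simp [cast_card_eq_zero_of_algebra, hn]
  have hp (n : ℕ) (hn : n ≠ 0) : (X : L[X]) ^ (Fintype.card Fq ^ n - 1) =
      X * X ^ (Fintype.card Fq ^ n - 1 - 1) := by
    have := Nat.one_lt_pow hn (Fintype.one_lt_card (α := Fq))
    rw [mul_pow_sub_one (by omega)]
  have hCt : C t⁻¹ * C t = 1 := by rw [← C_mul, inv_mul_cancel₀ ht, C_1]
  refine ⟨C t⁻¹, C t⁻¹ * X, ?_⟩
  simp only [torsionPoly, derivative_add, derivative_C, derivative_X_pow, derivative_C_mul,
    hc m hm, hc (m + 1) (by omega), C_neg, C_1]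
  rw [hp m hm, hp (m + 1) (by omega)]
  linear_combination hCt

theorem torsion_finite (ht : t ≠ 0) : (torsion Fq m t : Set L).Finite := by
  refine (((torsionPoly Fq m t).rootSet L).toFinite.union (Set.finite_singleton 0)).subset ?_
  intro x hx
  by_cases h : x = 0
  · exact Or.inr h
  · left
    rw [mem_rootSet]
    refine ⟨torsionPoly_ne_zero Fq ht, ?_⟩
    simpa using (mem_torsion_iff_isRoot Fq h).mp hx

theorem torsionPoly_roots_toFinset [DecidableEq L] (ht : t ≠ 0) (hm : m ≠ 0) :
    (torsion_finite Fq (m := m) ht).toFinset.erase 0 = (torsionPoly Fq m t).roots.toFinset := by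
  ext x
  simp only [Finset.mem_erase, Set.Finite.mem_toFinset, SetLike.mem_coe, Multiset.mem_toFinset,
    mem_roots (torsionPoly_ne_zero Fq ht)]
  constructor
  · rintro ⟨hx, h⟩
    exact (mem_torsion_iff_isRoot Fq hx).mp h
  · intro h
    have hx : x ≠ 0 := by
      rintro rfl
      rw [IsRoot.def, ← coeff_zero_eq_eval_zero, coeff_zero_torsionPoly Fq hm] at h
      exact ht h
    exact ⟨hx, (mem_torsion_iff_isRoot Fq hx).mpr h⟩

variable [IsAlgClosed L]

theorem ncard_torsion (ht : t ≠ 0) (hm : m ≠ 0) :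
    Nat.card (torsion Fq m t) = Fintype.card Fq ^ (m + 1) := by
  classical
  have h := congrArg Finset.card (torsionPoly_roots_toFinset Fq ht hm)
  rw [Multiset.toFinset_card_of_nodup (nodup_roots (separable_torsionPoly Fq ht hm)),
    IsAlgClosed.card_roots_eq_natDegree, natDegree_torsionPoly Fq ht,
    Finset.card_erase_of_mem (by simp)] at h
  have h1 : Nat.card (torsion Fq m t) = (torsion_finite Fq (m := m) ht).toFinset.card :=
    Nat.card_eq_card_finite_toFinset _
  have h2 : 0 < Fintype.card Fq ^ (m + 1) := pow_pos Fintype.card_pos _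
  have h3 : 0 < (torsion_finite Fq (m := m) ht).toFinset.card :=
    Finset.card_pos.mpr ⟨0, by simp⟩
  omega

theorem prod_torsion [DecidableEq L] (ht : t ≠ 0) (hm : m ≠ 0) :
    t ^ (Fintype.card Fq - 1) * ∏ v ∈ (torsion_finite Fq (m := m) ht).toFinset.erase 0, v =
      (-1) ^ (Fintype.card Fq ^ (m + 1) - 1) * t := by
  have h := (IsAlgClosed.splits (torsionPoly Fq m t)).coeff_zero_eq_leadingCoeff_mul_prod_roots
  rw [coeff_zero_torsionPoly Fq hm, natDegree_torsionPoly Fq ht,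
    leadingCoeff_torsionPoly Fq ht] at h
  rw [torsionPoly_roots_toFinset Fq ht hm, Finset.prod, Multiset.toFinset_val,
    Multiset.dedup_eq_self.mpr (nodup_roots (separable_torsionPoly Fq ht hm)), Multiset.map_id']
  have h1 : ((-1 : L)) ^ (Fintype.card Fq ^ (m + 1) - 1) *
      (-1) ^ (Fintype.card Fq ^ (m + 1) - 1) = 1 := by
    rw [← mul_pow]; simp
  linear_combination (-(-1 : L) ^ (Fintype.card Fq ^ (m + 1) - 1)) * h -
    t ^ (Fintype.card Fq - 1) * (torsionPoly Fq m t).roots.prod * h1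

end

section

variable {F L : Type*} [Field F] [Field L] [Algebra F L]

/-- An element of a normal extension which is separable and fixed by all automorphisms lies in the
base field. -/
theorem mem_range_algebraMap_of_isSeparable_of_fixed [IsAlgClosure F L] {x : L}
    (hx : IsSeparable F x) (hfix : ∀ σ : L ≃ₐ[F] L, σ x = x) : x ∈ (algebraMap F L).range := by
  have := IsAlgClosure.isAlgClosed F (K := L)
  have : Algebra.IsAlgebraic F L := IsAlgClosure.isAlgebraic
  have : Normal F L := IsAlgClosure.normal F L
  let y : separableClosure F L := ⟨x, mem_separableClosure_iff.mpr hx⟩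
  have : IsGalois F (separableClosure F L) := inferInstance
  have hy : y ∈ Set.range (algebraMap F (separableClosure F L)) := by
    rw [InfiniteGalois.mem_range_algebraMap_iff_fixed]
    intro σ
    apply Subtype.ext
    have := AlgEquiv.liftNormal_commutes σ L y
    change algebraMap _ L (σ y) = x
    rw [← this]
    exact hfix _
  obtain ⟨a, ha⟩ := hy
  exact ⟨a, by rw [IsScalarTower.algebraMap_apply F (separableClosure F L) L, ha]; rfl⟩

theorem exists_algebraMap_eq_prod_aeval [IsAlgClosure F L] (S : Finset L)
    (hsep : ∀ u ∈ S, IsSeparable F u) (hS : ∀ σ : L ≃ₐ[F] L, ∀ u ∈ S, σ u ∈ S) (P : F[X]) :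
    ∃ a : F, algebraMap F L a = ∏ u ∈ S, aeval u P := by
  refine mem_range_algebraMap_of_isSeparable_of_fixed (x := ∏ u ∈ S, aeval u P) ?_ ?_
  · rw [← mem_separableClosure_iff]
    refine prod_mem fun u hu => ?_
    have hu' := mem_separableClosure_iff.mpr (hsep u hu)
    have : aeval u P = ((aeval (⟨u, hu'⟩ : separableClosure F L) P : separableClosure F L) : L) :=
      aeval_algebraMap_apply L (⟨u, hu'⟩ : separableClosure F L) P
    rw [this]
    exact SetLike.coe_mem _
  · intro σ
    rw [map_prod]
    refine Finset.prod_nbij' σ σ.symm (hS σ) (hS σ.symm) (by simp) (by simp) ?_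
    intro u _
    rw [← aeval_algHom_apply σ u P]

variable (Fq : Type*) [Field Fq] [Fintype Fq] [Algebra Fq F] [Algebra Fq L] [IsScalarTower Fq F L]

theorem algebraMap_torsionPoly (m : ℕ) (t : F) :
    (torsionPoly Fq m t).map (algebraMap F L) = torsionPoly Fq m (algebraMap F L t) := by
  simp [torsionPoly]

theorem isSeparable_of_mem_torsion {m : ℕ} {t : F} (ht : t ≠ 0) (hm : m ≠ 0) {u : L}
    (hu : u ∈ torsion Fq m (algebraMap F L t)) : IsSeparable F u := by
  by_cases h0 : u = 0
  · rw [h0, ← map_zero (algebraMap F L)]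
    exact isSeparable_algebraMap _
  refine (separable_torsionPoly Fq ht hm).of_dvd (minpoly.dvd F u ?_)
  rw [mem_torsion_iff_isRoot Fq h0, ← algebraMap_torsionPoly, IsRoot.def, eval_map_algebraMap] at hu
  exact hu

theorem algEquiv_mem_torsion {m : ℕ} {t : F} (σ : L ≃ₐ[F] L) {u : L}
    (hu : u ∈ torsion Fq m (algebraMap F L t)) : σ u ∈ torsion Fq m (algebraMap F L t) := by
  rw [mem_torsion] at hu ⊢
  simpa using congrArg σ hu

theorem exists_prod_one_add_mul_eq {B : Type*} [CommRing B] (τ : B) {ι : Type*} (S : Finset ι)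
    (w : ι → B) :
    ∃ e : B, ∏ u ∈ S, (1 + τ * w u) = 1 + τ * e := by
  classical
  induction S using Finset.induction_on with
  | empty => exact ⟨0, by simp⟩
  | insert a s ha ih =>
    obtain ⟨e, he⟩ := ih
    refine ⟨w a + e + τ * w a * e, ?_⟩
    rw [Finset.prod_insert ha, he]
    ring

theorem pow_eq_of_mem_torsion {m : ℕ} {t : L} (ht : t ≠ 0) {u : L} (h0 : u ≠ 0)
    (hu : u ∈ torsion Fq m t) : u ^ (Fintype.card Fq ^ (m + 1) - 1) =
      -(t⁻¹ ^ (Fintype.card Fq - 2)) * (1 + t⁻¹ * u ^ (Fintype.card Fq ^ m - 1)) := by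
  have h1 : 1 < Fintype.card Fq := Fintype.one_lt_card
  rw [mem_torsion_iff_isRoot Fq h0, IsRoot.def, torsionPoly] at hu
  simp only [eval_add, eval_C, eval_pow, eval_X, eval_mul] at hu
  obtain ⟨k, hk⟩ : ∃ k, Fintype.card Fq = k + 2 := ⟨_, (Nat.sub_add_cancel h1).symm⟩
  have e1 : Fintype.card Fq - 1 = k + 1 := by omega
  have e2 : Fintype.card Fq - 2 = k := by omega
  rw [e1] at hu
  rw [e2]
  have h2 : t⁻¹ * t = 1 := inv_mul_cancel₀ ht
  have h3 : t⁻¹ ^ (k + 1) * t ^ (k + 1) = 1 := by rw [← mul_pow, h2, one_pow]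
  linear_combination t⁻¹ ^ (k + 1) * hu - t⁻¹ ^ k * h2 -
    u ^ (Fintype.card Fq ^ (m + 1) - 1) * h3

theorem isIntegral_of_mem_torsion (v : Valuation F ℤᵐ⁰) {m : ℕ} {t : F} (ht : t ≠ 0)
    (hvt : v t⁻¹ ≤ 1) {u : L} (hu : u ∈ torsion Fq m (algebraMap F L t)) :
    IsIntegral v.valuationSubring u := by
  by_cases h0 : u = 0
  · rw [h0]
    exact isIntegral_zero
  have h1 : 1 < Fintype.card Fq := Fintype.one_lt_card
  have hQ : Fintype.card Fq ^ m < Fintype.card Fq ^ (m + 1) := Nat.pow_lt_pow_right h1 (by omega)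
  have hQ0 : 0 < Fintype.card Fq ^ m := pow_pos Fintype.card_pos _
  let τ : v.valuationSubring := ⟨t⁻¹, hvt⟩
  let P : v.valuationSubring[X] := X ^ (Fintype.card Fq ^ (m + 1) - 1) +
    (C (τ ^ (Fintype.card Fq - 1)) * X ^ (Fintype.card Fq ^ m - 1) + C (τ ^ (Fintype.card Fq - 2)))
  have hP : P.Monic := by
    refine monic_X_pow_add ?_
    refine (degree_add_le _ _).trans_lt (max_lt ?_ ?_)
    · exact (degree_C_mul_X_pow_le _ _).trans_lt (by exact_mod_cast (by omega))
    · exact degree_C_le.trans_lt (by exact_mod_cast (by omega))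
  refine ⟨P, hP, ?_⟩
  have hτ : algebraMap v.valuationSubring L τ = (algebraMap F L t)⁻¹ := by
    rw [IsScalarTower.algebraMap_apply v.valuationSubring F L, ← map_inv₀]
    rfl
  have ht' : algebraMap F L t ≠ 0 := by simpa using ht
  simp only [P, eval₂_add, eval₂_mul, eval₂_pow, eval₂_X, eval₂_C, map_pow, hτ]
  rw [pow_eq_of_mem_torsion Fq ht' h0 hu]
  obtain ⟨k, hk⟩ : ∃ k, Fintype.card Fq = k + 2 := ⟨_, (Nat.sub_add_cancel h1).symm⟩
  have e1 : Fintype.card Fq - 1 = k + 1 := by omega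
  have e2 : Fintype.card Fq - 2 = k := by omega
  rw [e1, e2]
  ring

/-- The torsion is an irreducible Galois module, by ramification at the place `v`. -/
theorem eq_bot_or_eq_torsion_of_stable [IsAlgClosure F L] (v : Valuation F ℤᵐ⁰) {m : ℕ} {t : F}
    (hvt : v t = exp 1) (hm : m ≠ 0) (hq : 3 ≤ Fintype.card Fq) (U : Submodule Fq L)
    (hU : U ≤ torsion Fq m (algebraMap F L t))
    (hst : ∀ σ : L ≃ₐ[F] L, ∀ u ∈ U, σ u ∈ U) :
    U = ⊥ ∨ U = torsion Fq m (algebraMap F L t) := by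
  classical
  by_contra! hne
  have := IsAlgClosure.isAlgClosed F (K := L)
  have ht : t ≠ 0 := by
    rintro rfl
    rw [map_zero] at hvt
    exact exp_ne_zero hvt.symm
  have ht' : algebraMap F L t ≠ 0 := by simpa using ht
  have hfin := (torsion_finite Fq (m := m) ht').subset hU
  have : Finite U := hfin
  have : Finite (torsion Fq m (algebraMap F L t)) := torsion_finite Fq ht'
  have hcU : Nat.card U = Fintype.card Fq ^ finrank Fq U := by
    rw [Module.natCard_eq_pow_finrank (K := Fq), Nat.card_eq_fintype_card]
  have hd0 : 0 < finrank Fq U := by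
    rw [Nat.pos_iff_ne_zero]
    intro h
    exact hne.1 (Submodule.finrank_eq_zero.mp h)
  have hd1 : Fintype.card Fq ^ finrank Fq U < Fintype.card Fq ^ (m + 1) := by
    rw [← ncard_torsion Fq ht' hm, ← hcU]
    exact Set.ncard_lt_ncard (SetLike.coe_ssubset_coe.mpr (lt_of_le_of_ne hU hne.2))
      (Set.toFinite _)
  have hd2 : 1 < Fintype.card Fq ^ finrank Fq U := Nat.one_lt_pow hd0.ne' (by omega)
  set S := hfin.toFinset.erase 0 with hS
  have hmemS (u : L) : u ∈ S ↔ u ≠ 0 ∧ u ∈ U := by simp [hS]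
  have hcS : S.card = Fintype.card Fq ^ finrank Fq U - 1 := by
    rw [hS, Finset.card_erase_of_mem (by simp), ← hcU]
    congr 1
    exact (Nat.card_eq_card_finite_toFinset hfin).symm
  have hSsep : ∀ u ∈ S, IsSeparable F u := fun u hu =>
    isSeparable_of_mem_torsion Fq ht hm (hU ((hmemS u).mp hu).2)
  have hSst : ∀ σ : L ≃ₐ[F] L, ∀ u ∈ S, σ u ∈ S := fun σ u hu => by
    rw [hmemS] at hu ⊢
    exact ⟨by simpa using hu.1, hst σ u hu.2⟩
  obtain ⟨c, hc⟩ := exists_algebraMap_eq_prod_aeval S hSsep hSst X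
  obtain ⟨D, hD⟩ := exists_algebraMap_eq_prod_aeval S hSsep hSst
    (1 + C t⁻¹ * X ^ (Fintype.card Fq ^ m - 1))
  simp only [aeval_X, map_add, map_one, map_mul, aeval_C, map_pow] at hc hD
  have hvτ : v t⁻¹ = exp (-1) := by rw [map_inv₀, hvt]; rfl
  have hvτ1 : v t⁻¹ < 1 := by rw [hvτ, ← exp_zero, exp_lt_exp]; decide
  have hvD : v D = 1 := by
    let B := integralClosure v.valuationSubring L
    obtain ⟨e, he⟩ := exists_prod_one_add_mul_eq
      (algebraMap v.valuationSubring B ⟨t⁻¹, hvτ1.le⟩) S.attach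
      (fun u => (⟨(u : L), isIntegral_of_mem_torsion Fq v ht hvτ1.le
        (hU ((hmemS u).mp u.2).2)⟩ : B) ^ (Fintype.card Fq ^ m - 1))
    have hτ : ((algebraMap v.valuationSubring B ⟨t⁻¹, hvτ1.le⟩ : B) : L) = algebraMap F L t⁻¹ := rfl
    have he' := congrArg (algebraMap B L) he
    simp only [map_prod, map_add, map_mul, map_one, map_pow] at he'
    have he2 : algebraMap F L D = 1 + algebraMap F L t⁻¹ * e := by
      rw [hD, ← Finset.prod_attach]
      exact he'
    have he3 : (e : L) = algebraMap F L (t * (D - 1)) := by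
      rw [map_mul, map_sub, he2, map_inv₀, map_one]
      field_simp
      ring
    have he4 : IsIntegral v.valuationSubring (t * (D - 1)) := by
      have := e.2
      rw [mem_integralClosure_iff, he3] at this
      exact (isIntegral_algebraMap_iff (algebraMap F L).injective).mp this
    obtain ⟨y, hy⟩ := IsIntegrallyClosed.isIntegral_iff.mp he4
    have hy2 : v (t * (D - 1)) ≤ 1 := by
      rw [← hy]
      exact y.2
    have hD1 : D = 1 + t⁻¹ * (t * (D - 1)) := by
      field_simp
      ring
    rw [hD1]
    refine v.map_one_add_of_lt ?_
    rw [map_mul]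
    exact (mul_le_mul_right hy2 _).trans_lt (by simpa using hvτ1)
  have hcD : c ^ (Fintype.card Fq ^ (m + 1) - 1) =
      (-(t⁻¹) ^ (Fintype.card Fq - 2)) ^ S.card * D := by
    apply (algebraMap F L).injective
    rw [map_pow, hc, map_mul, hD, map_pow, ← Finset.prod_const, ← Finset.prod_mul_distrib,
      ← Finset.prod_pow]
    refine Finset.prod_congr rfl fun u hu => ?_
    rw [hmemS] at hu
    rw [pow_eq_of_mem_torsion Fq ht' hu.1 (hU hu.2), map_neg, map_pow, map_inv₀]
  have hv := congrArg v hcD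
  rw [map_mul, hvD, map_pow, map_pow, Valuation.map_neg, map_pow, hvτ, mul_one, ← pow_mul,
    hcS] at hv
  have hc0 : v c ≠ 0 := by
    intro h
    rw [h, zero_pow (by omega)] at hv
    exact pow_ne_zero _ exp_ne_zero hv.symm
  obtain ⟨k, hk⟩ : ∃ k, v c = exp k := ⟨log (v c), (exp_log hc0).symm⟩
  rw [hk, ← exp_nsmul, ← exp_nsmul, exp_inj] at hv
  simp only [nsmul_eq_mul] at hv
  have hdvd : (Fintype.card Fq ^ (m + 1) - 1) ∣
      (Fintype.card Fq - 2) * (Fintype.card Fq ^ finrank Fq U - 1) := by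
    rw [← Int.natCast_dvd_natCast]
    exact ⟨-k, by linear_combination hv⟩
  have hpos : 0 < (Fintype.card Fq - 2) * (Fintype.card Fq ^ finrank Fq U - 1) :=
    Nat.mul_pos (by omega) (by omega)
  have hle := Nat.le_of_dvd hpos hdvd
  have hd3 : Fintype.card Fq ^ (finrank Fq U + 1) ≤ Fintype.card Fq ^ (m + 1) :=
    Nat.pow_le_pow_right (by omega) ((Nat.pow_lt_pow_iff_right (by omega)).mp hd1)
  rw [pow_succ] at hd3
  obtain ⟨k, hk⟩ : ∃ k, Fintype.card Fq = k + 3 := ⟨Fintype.card Fq - 3, by omega⟩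
  obtain ⟨a, ha⟩ : ∃ a, Fintype.card Fq ^ finrank Fq U = a + 2 := ⟨_, (Nat.sub_add_cancel hd2).symm⟩
  rw [ha] at hle hd3
  generalize Fintype.card Fq ^ (m + 1) = N at *
  rw [hk] at hle hd3
  have e1 : k + 3 - 2 = k + 1 := rfl
  have e2 : a + 2 - 1 = a + 1 := rfl
  rw [e1, e2] at hle
  have : N ≤ (k + 1) * (a + 1) + 1 := by omega
  nlinarith

end

theorem irreducible_map_of_isEisensteinAt {R K : Type*} [CommRing R] [IsDomain R]
    [IsIntegrallyClosed R] [Field K] [Algebra R K] [IsFractionRing R K] {P : Ideal R}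
    (hP : P.IsPrime) {f : R[X]} (hf : f.Monic) (hdeg : 0 < f.natDegree) (h : f.IsEisensteinAt P) :
    Irreducible (f.map (algebraMap R K)) :=
  (hf.irreducible_iff_irreducible_map_fraction_map (K := K)).mp
    (h.irreducible hP hf.isPrimitive hdeg)

theorem exists_algEquiv_of_irreducible {F L : Type*} [Field F] [Field L] [Algebra F L] [Normal F L]
    {f : F[X]} (hf : Irreducible f) {x y : L} (hx : aeval x f = 0) (hy : aeval y f = 0) :
    ∃ σ : L ≃ₐ[F] L, σ x = y := by
  have h : IsConjRoot F y x := by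
    rw [isConjRoot_def, ← minpoly.eq_of_irreducible hf hx, ← minpoly.eq_of_irreducible hf hy]
  obtain ⟨σ, hσ⟩ := isConjRoot_iff_exists_algEquiv.mp h
  exact ⟨σ, hσ⟩

section

variable (Fq : Type*) [Field Fq] [Fintype Fq] {L : Type*} [Field L] [Algebra Fq L]

/-- The Moore matrix of a family of elements. -/
def mooreMatrix {n : ℕ} (b : Fin n → L) : Matrix (Fin n) (Fin n) L :=
  Matrix.of fun i j => b i ^ Fintype.card Fq ^ (j : ℕ)

theorem det_mooreMatrix_ne_zero {m : ℕ} {V : Submodule Fq L}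
    (b : Basis (Fin (m + 1)) Fq V) : (mooreMatrix Fq fun i => (b i : L)).det ≠ 0 := by
  classical
  intro h
  obtain ⟨w, hw0, hw⟩ := Matrix.exists_mulVec_eq_zero_iff.mpr h
  have h1 : 1 < Fintype.card Fq := Fintype.one_lt_card
  let P : L[X] := ∑ j : Fin (m + 1), C (w j) * X ^ Fintype.card Fq ^ (j : ℕ)
  let Λ : L →ₗ[Fq] L :=
    ∑ j : Fin (m + 1), w j • ((FiniteField.frobeniusAlgHom Fq L) ^ (j : ℕ)).toLinearMap
  have hΛ (x : L) : Λ x = P.eval x := by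
    simp only [Λ, P, eval_finsetSum, LinearMap.sum_apply, LinearMap.smul_apply,
      AlgHom.toLinearMap_apply, frobeniusAlgHom_pow_apply, eval_mul, eval_C, eval_pow, eval_X,
      smul_eq_mul]
  have hΛ0 : Λ ∘ₗ V.subtype = 0 := by
    refine b.ext fun i => ?_
    have := congrFun hw i
    simp only [Matrix.mulVec, dotProduct, mooreMatrix, Matrix.of_apply, Pi.zero_apply] at this
    rw [LinearMap.comp_apply, Submodule.subtype_apply, hΛ, LinearMap.zero_apply, ← this]
    simp only [P, eval_finsetSum, eval_mul, eval_C, eval_pow, eval_X]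
    exact Finset.sum_congr rfl fun j _ => mul_comm _ _
  have hP0 : P ≠ 0 := by
    intro hP
    apply hw0
    ext j
    have := congrArg (fun p => coeff p (Fintype.card Fq ^ (j : ℕ))) hP
    simp only [P, finsetSum_coeff, coeff_C_mul_X_pow, coeff_zero] at this
    rw [Finset.sum_eq_single j] at this
    · simpa using this
    · intro k _ hk
      rw [if_neg]
      intro h
      exact hk (Fin.ext (Nat.pow_right_injective h1 h.symm))
    · simp
  have hdeg : P.natDegree ≤ Fintype.card Fq ^ m := by
    refine natDegree_sum_le_of_forall_le _ _ fun j _ => ?_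
    refine (natDegree_C_mul_X_pow_le _ _).trans ?_
    exact Nat.pow_le_pow_right (by omega) (by omega)
  have : Module.Finite Fq V := b.finiteDimensional_of_finite
  have : Finite V := Module.finite_of_finite Fq
  have hcard : Nat.card V = Fintype.card Fq ^ (m + 1) := by
    rw [Module.natCard_eq_pow_finrank (K := Fq), Nat.card_eq_fintype_card,
      finrank_eq_card_basis b, Fintype.card_fin]
  have hfin : (V : Set L).Finite := Set.toFinite _
  have hsub : hfin.toFinset.val ⊆ P.roots := by
    intro x hx
    rw [mem_roots hP0, IsRoot.def, ← hΛ]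
    have hx' : x ∈ V := by simpa using hx
    exact LinearMap.congr_fun hΛ0 ⟨x, hx'⟩
  have hle := (Polynomial.card_le_degree_of_subset_roots hsub).trans hdeg
  rw [← Nat.card_eq_card_finite_toFinset hfin] at hle
  have h2 : Fintype.card Fq ^ m < Fintype.card Fq ^ (m + 1) :=
    Nat.pow_lt_pow_right h1 (by omega)
  change Nat.card V ≤ _ at hle
  omega

theorem pow_det_mooreMatrix {m : ℕ} (hm : m ≠ 0) {t : L} (ht : t ≠ 0) (b : Fin (m + 1) → L)
    (hb : ∀ i, b i ∈ torsion Fq m t) :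
    t ^ (Fintype.card Fq - 1) * (mooreMatrix Fq b).det ^ Fintype.card Fq =
      (-1) ^ (m + 1) * t * (mooreMatrix Fq b).det := by
  obtain ⟨n, rfl⟩ : ∃ n, m = n + 1 := ⟨m - 1, by omega⟩
  set q := Fintype.card Fq with hq
  let N := (mooreMatrix Fq b).submatrix id (finRotate (n + 1 + 1))
  have hN : N.det = (-1) ^ (n + 1) * (mooreMatrix Fq b).det := by
    have := Matrix.det_permute' (finRotate (n + 1 + 1)) (mooreMatrix Fq b)
    rw [sign_finRotate] at this
    simpa using this
  have hMq : (mooreMatrix Fq b).map (FiniteField.frobeniusAlgHom Fq L) =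
      N.updateCol (Fin.last (n + 1)) ((-t * (t ^ (q - 1))⁻¹) • fun i => N i (Fin.last (n + 1)) +
        t⁻¹ • N i (Fin.castSucc (Fin.last n))) := by
    ext i j
    have hfr : (mooreMatrix Fq b).map (FiniteField.frobeniusAlgHom Fq L) i j =
        b i ^ q ^ ((j : ℕ) + 1) := by
      simp [mooreMatrix, FiniteField.coe_frobeniusAlgHom, ← pow_mul, pow_succ, hq]
    rw [hfr]
    induction j using Fin.lastCases with
    | last =>
      have h1 := (mem_torsion Fq).mp (hb i)
      simp only [Matrix.updateCol_self, Pi.smul_apply, N, Matrix.submatrix_apply, id_eq,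
        finRotate_last, smul_eq_mul, mooreMatrix, Matrix.of_apply, Fin.val_zero, pow_zero, pow_one,
        Fin.val_last]
      rw [finRotate_of_lt (by simp)]
      simp only [Fin.val_last, Fin.val_castSucc]
      have h2 : t ^ (q - 1) ≠ 0 := pow_ne_zero _ ht
      rw [← hq] at h1 ⊢
      field_simp
      linear_combination h1
    | cast j =>
      rw [Matrix.updateCol_ne (Fin.castSucc_lt_last j).ne]
      simp only [N, Matrix.submatrix_apply, id_eq, mooreMatrix, Matrix.of_apply]
      rw [finRotate_of_lt (by simpa using Nat.le_of_lt_succ j.2)]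
  have h1 := congrArg Matrix.det hMq
  have h2 : ((mooreMatrix Fq b).map (FiniteField.frobeniusAlgHom Fq L)).det =
      (mooreMatrix Fq b).det ^ q := by
    rw [← AlgHom.mapMatrix_apply, ← AlgHom.map_det, FiniteField.coe_frobeniusAlgHom]
  rw [h2, Matrix.det_updateCol_smul,
    Matrix.det_updateCol_add_smul_self _ (Fin.castSucc_lt_last _).ne', hN] at h1
  have h3 : t ^ (q - 1) ≠ 0 := pow_ne_zero _ ht
  rw [h1]
  field_simp
  ring

variable {F : Type*} [Field F] [Algebra F L] [Algebra Fq F] [IsScalarTower Fq F L]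

/-- The action of the automorphism group on the torsion. -/
def galTorsion (m : ℕ) (t : F) : (L ≃ₐ[F] L) →*
    (torsion Fq m (algebraMap F L t) ≃ₗ[Fq] torsion Fq m (algebraMap F L t)) where
  toFun σ :=
    { toFun x := ⟨σ x, algEquiv_mem_torsion Fq σ x.2⟩
      invFun x := ⟨σ.symm x, algEquiv_mem_torsion Fq σ.symm x.2⟩
      map_add' x y := Subtype.ext (by simp)
      map_smul' c x := Subtype.ext (by
        have := (σ.toLinearMap.restrictScalars Fq).map_smul c (x : L)
        exact this)
      left_inv x := Subtype.ext (by simp)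
      right_inv x := Subtype.ext (by simp) }
  map_one' := rfl
  map_mul' _ _ := rfl

theorem galTorsion_apply_coe {m : ℕ} {t : F} (σ : L ≃ₐ[F] L)
    (x : torsion Fq m (algebraMap F L t)) : (galTorsion Fq m t σ x : L) = σ x := rfl

theorem algEquiv_det_mooreMatrix {m n : ℕ} {t : F}
    (b : Basis (Fin n) Fq (torsion Fq m (algebraMap F L t))) (σ : L ≃ₐ[F] L) :
    σ (mooreMatrix Fq fun i => (b i : L)).det =
      algebraMap Fq L (LinearEquiv.det (galTorsion Fq m t σ) : Fq) *
        (mooreMatrix Fq fun i => (b i : L)).det := by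
  have h : (mooreMatrix Fq fun i => (b i : L)).map (σ : L ≃ₐ[F] L) =
      ((LinearMap.toMatrix b b (galTorsion Fq m t σ)).map (algebraMap Fq L)).transpose *
        (mooreMatrix Fq fun i => (b i : L)) := by
    ext i j
    have h1 : σ (b i) = ∑ k, LinearMap.toMatrix b b (galTorsion Fq m t σ) k i • (b k : L) := by
      rw [← galTorsion_apply_coe]
      have h0 := congrArg Subtype.val (b.sum_repr (galTorsion Fq m t σ (b i)))
      simp only [Submodule.coe_sum, Submodule.coe_smul] at h0
      simp only [← h0, LinearMap.toMatrix_apply, LinearEquiv.coe_coe]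
    have h2 := congrArg (fun x => ((FiniteField.frobeniusAlgHom Fq L) ^ (j : ℕ)) x) h1
    simp only [map_sum, map_smul, frobeniusAlgHom_pow_apply] at h2
    simp only [mooreMatrix, Matrix.map_apply, Matrix.of_apply, map_pow, h2, Matrix.mul_apply,
      Matrix.transpose_apply, Algebra.smul_def]
  have h1 : σ (mooreMatrix Fq fun i => (b i : L)).det =
      ((mooreMatrix Fq fun i => (b i : L)).map (σ : L ≃ₐ[F] L)).det :=
    AlgEquiv.map_det σ _
  rw [h1, h, Matrix.det_mul, Matrix.det_transpose, LinearEquiv.coe_det, ← LinearMap.det_toMatrix b,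
    RingHom.map_det]
  rfl

theorem finrank_torsion [IsAlgClosed L] {m : ℕ} {t : L} (ht : t ≠ 0) (hm : m ≠ 0) :
    finrank Fq (torsion Fq m t) = m + 1 := by
  have : Finite (torsion Fq m t) := torsion_finite Fq ht
  have h := ncard_torsion Fq ht hm
  rw [Module.natCard_eq_pow_finrank (K := Fq), Nat.card_eq_fintype_card] at h
  exact Nat.pow_right_injective Fintype.one_lt_card h

theorem exists_det_galTorsion_eq [IsAlgClosure F L] {m : ℕ} {t : F} (ht : t ≠ 0) (hm : m ≠ 0)
    (hirr : Irreducible (X ^ (Fintype.card Fq - 1) - C ((-1) ^ (m + 1) * t))) (d : Fqˣ) :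
    ∃ σ : L ≃ₐ[F] L, LinearEquiv.det (galTorsion Fq m t σ) = d := by
  have := IsAlgClosure.isAlgClosed F (K := L)
  have : Normal F L := IsAlgClosure.normal F L
  have ht' : algebraMap F L t ≠ 0 := by simpa using ht
  have : Finite (torsion Fq m (algebraMap F L t)) := torsion_finite Fq ht'
  let b := finBasisOfFinrankEq Fq _ (finrank_torsion Fq ht' hm)
  set δ := (mooreMatrix Fq fun i => (b i : L)).det with hδ
  have hδ0 : δ ≠ 0 := det_mooreMatrix_ne_zero Fq b
  have hδq : _ * δ ^ _ = _ * δ :=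
    pow_det_mooreMatrix Fq hm ht' (fun i => (b i : L)) (fun i => (b i).2)
  have hα : (algebraMap F L t * δ) ^ (Fintype.card Fq - 1) =
      (-1) ^ (m + 1) * algebraMap F L t := by
    apply mul_right_cancel₀ hδ0
    rw [← hδq, mul_pow, mul_assoc, pow_sub_one_mul Fintype.card_ne_zero]
  have hd : (algebraMap Fq L d) ^ (Fintype.card Fq - 1) = 1 := by
    rw [← map_pow, FiniteField.pow_card_sub_one_eq_one _ d.ne_zero, map_one]
  obtain ⟨σ, hσ⟩ := exists_algEquiv_of_irreducible (L := L) hirr (x := algebraMap F L t * δ)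
    (y := algebraMap Fq L d * (algebraMap F L t * δ)) (by simp [hα])
    (by rw [map_sub, map_pow, aeval_X, mul_pow, hd, hα]; simp)
  refine ⟨σ, Units.ext ((algebraMap Fq L).injective ?_)⟩
  have h := algEquiv_det_mooreMatrix Fq b σ
  rw [← hδ] at h
  rw [map_mul, AlgEquiv.commutes, h] at hσ
  have h2 : algebraMap F L t * δ ≠ 0 := mul_ne_zero ht' hδ0
  apply mul_right_cancel₀ h2
  linear_combination hσ

end

theorem PowerSeries.exists_isRoot_of_constantCoeff {k : Type*} [Field k] {f : (PowerSeries k)[X]}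
    (hf : f.Monic) {a : k} (ha : (f.map PowerSeries.constantCoeff).eval a = 0)
    (ha' : (f.map PowerSeries.constantCoeff).derivative.eval a ≠ 0) :
    ∃ x : PowerSeries k, f.IsRoot x ∧ PowerSeries.constantCoeff x = a := by
  have key (g : (PowerSeries k)[X]) : PowerSeries.constantCoeff (g.eval (PowerSeries.C a)) =
      (g.map PowerSeries.constantCoeff).eval a := by
    have := eval_map_apply (f := PowerSeries.constantCoeff) (p := g) (PowerSeries.C a)
    rwa [PowerSeries.constantCoeff_C, eq_comm] at this
  obtain ⟨x, hx, hxa⟩ := HenselianRing.is_henselian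
    (I := Ideal.span {(PowerSeries.X : PowerSeries k)})
    f hf (PowerSeries.C a)
    (by rw [Ideal.mem_span_singleton, PowerSeries.X_dvd_iff, key, ha])
    (IsUnit.map _ (by
      rw [PowerSeries.isUnit_iff_constantCoeff, key, ← derivative_map]
      exact ha'.isUnit))
  refine ⟨x, hx, ?_⟩
  rw [Ideal.mem_span_singleton, PowerSeries.X_dvd_iff, map_sub, PowerSeries.constantCoeff_C,
    sub_eq_zero] at hxa
  exact hxa

theorem FiniteField.exists_algebraMap_eq_of_pow_card {K : Type*} [Field K] [Fintype K]
    {L : Type*} [Field L] [Algebra K L] {x : L} (hx : x ^ Fintype.card K = x) :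
    ∃ c : K, algebraMap K L c = x := by
  have h : x ∈ ((X ^ Fintype.card K - X : K[X]).map (algebraMap K L)).roots := by
    rw [mem_roots]
    · simp [hx]
    · simpa using X_pow_card_sub_X_ne_zero L Fintype.one_lt_card
  have hs : (X ^ Fintype.card K - X : K[X]).Splits := by
    rw [splits_iff_card_roots, roots_X_pow_card_sub_X,
      X_pow_card_sub_X_natDegree_eq K Fintype.one_lt_card]
    rfl
  rw [hs.roots_map, roots_X_pow_card_sub_X] at h
  simpa using h

section

variable (Fq : Type*) [Field Fq] [Fintype Fq] {L : Type*} [Field L] [Algebra Fq L]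

theorem prod_erase_zero_eq_of_hyperplane [DecidableEq L] {V W : Submodule Fq L}
    (hV : (V : Set L).Finite) (hW : (W : Set L).Finite) (hWV : W ≤ V)
    (hcard : Nat.card V = Fintype.card Fq * Nat.card W) {x : L} (hx : x ∈ V) (hxW : x ∉ W) :
    ∃ c : Fq, c ≠ 0 ∧ ∏ v ∈ hV.toFinset.erase 0, v = (∏ w ∈ hW.toFinset.erase 0, w) *
      (algebraMap Fq L c * (∏ w ∈ hW.toFinset, (x - w)) ^ (Fintype.card Fq - 1)) := by
  classical
  refine ⟨(∏ c : Fqˣ, (c : Fq)) ^ Nat.card W,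
    pow_ne_zero _ (Finset.prod_ne_zero_iff.mpr fun c _ => c.ne_zero), ?_⟩
  have hcV : Nat.card V = hV.toFinset.card := Nat.card_eq_card_finite_toFinset hV
  have hcW : Nat.card W = hW.toFinset.card := Nat.card_eq_card_finite_toFinset hW
  have hsub : hW.toFinset ⊆ hV.toFinset := Set.Finite.toFinset_mono hWV
  rw [← Finset.prod_sdiff (Finset.erase_subset_erase 0 hsub), mul_comm]
  congr 1
  have hsd : hV.toFinset.erase 0 \ hW.toFinset.erase 0 = hV.toFinset \ hW.toFinset := by
    ext v
    simp only [Finset.mem_sdiff, Finset.mem_erase, Set.Finite.mem_toFinset, SetLike.mem_coe]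
    constructor
    · rintro ⟨⟨h0, h1⟩, h2⟩
      exact ⟨h1, fun h => h2 ⟨h0, h⟩⟩
    · rintro ⟨h1, h2⟩
      refine ⟨⟨?_, h1⟩, fun h => h2 h.2⟩
      rintro rfl
      exact h2 W.zero_mem
  have hmaps : Set.MapsTo (fun p : Fqˣ × L => p.1 • (x - p.2))
      (Finset.univ ×ˢ hW.toFinset : Finset (Fqˣ × L)) (hV.toFinset \ hW.toFinset : Finset L) := by
    rintro ⟨c, w⟩ hp
    simp only [Finset.coe_product, Finset.coe_univ, Set.Finite.coe_toFinset, Set.mem_prod,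
      Set.mem_univ, SetLike.mem_coe, true_and] at hp
    simp only [Finset.coe_sdiff, Set.Finite.coe_toFinset, Set.mem_sdiff, SetLike.mem_coe]
    refine ⟨V.smul_mem (c : Fq) (V.sub_mem hx (hWV hp)), fun h => hxW ?_⟩
    have := W.add_mem (W.smul_mem ((c⁻¹ : Fqˣ) : Fq) h) hp
    change c⁻¹ • c • (x - w) + w ∈ W at this
    simpa using this
  have hinj : Set.InjOn (fun p : Fqˣ × L => p.1 • (x - p.2))
      (Finset.univ ×ˢ hW.toFinset : Finset (Fqˣ × L)) := by
    rintro ⟨c, w⟩ hp ⟨c', w'⟩ hp' h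
    simp only [Finset.coe_product, Finset.coe_univ, Set.Finite.coe_toFinset, Set.mem_prod,
      Set.mem_univ, SetLike.mem_coe, true_and] at hp hp'
    change (c : Fq) • (x - w) = (c' : Fq) • (x - w') at h
    have hcc : (c : Fq) = c' := by
      by_contra hne
      apply hxW
      have h1 : ((c : Fq) - c') • x = (c : Fq) • w - (c' : Fq) • w' := by
        rw [smul_sub, smul_sub] at h
        rw [sub_smul]
        linear_combination h
      have h2 := W.smul_mem ((c : Fq) - c')⁻¹
        (W.sub_mem (W.smul_mem (c : Fq) hp) (W.smul_mem (c' : Fq) hp'))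
      rwa [← h1, inv_smul_smul₀ (sub_ne_zero.mpr hne)] at h2
    rw [hcc] at h
    have hw := smul_right_injective L c'.ne_zero h
    exact Prod.ext (Units.ext hcc) (sub_right_injective hw)
  have hle : (hV.toFinset \ hW.toFinset).card ≤
      (Finset.univ ×ˢ hW.toFinset : Finset (Fqˣ × L)).card := by
    rw [Finset.card_sdiff_of_subset hsub, Finset.card_product, Finset.card_univ,
      Fintype.card_units, ← hcV, ← hcW, hcard, Nat.sub_mul, one_mul]
  have hsurj := Finset.surjOn_of_injOn_of_card_le _ hmaps hinj hle
  rw [hsd, ← Finset.prod_nbij (fun p : Fqˣ × L => p.1 • (x - p.2)) hmaps hinj hsurj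
    (fun _ _ => rfl), Finset.prod_product]
  have (c : Fqˣ) : ∏ w ∈ hW.toFinset, c • (x - w) =
      algebraMap Fq L (c : Fq) ^ Nat.card W * ∏ w ∈ hW.toFinset, (x - w) := by
    rw [hcW, ← Finset.prod_const, ← Finset.prod_mul_distrib]
    exact Finset.prod_congr rfl fun w _ => Algebra.smul_def (c : Fq) _
  simp only [this]
  rw [Finset.prod_mul_distrib, Finset.prod_pow, Finset.prod_const, Finset.card_univ,
    Fintype.card_units, map_pow, map_prod]

end

section

variable (Fq : Type*) [Field Fq] [Fintype Fq] {k : Type*} [Field k] [Algebra Fq k]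

/-- The solutions of `z + z ^ q ^ m + X ^ M * z ^ q ^ (m + 1) = 0` in power series. -/
def powerSeriesTorsion (m M : ℕ) : Submodule Fq (PowerSeries k) :=
  LinearMap.ker (LinearMap.id + ((FiniteField.frobeniusAlgHom Fq (PowerSeries k)) ^ m).toLinearMap +
    LinearMap.mulLeft Fq ((PowerSeries.X : PowerSeries k) ^ M) ∘ₗ
      ((FiniteField.frobeniusAlgHom Fq (PowerSeries k)) ^ (m + 1)).toLinearMap)

theorem mem_powerSeriesTorsion {m M : ℕ} {z : PowerSeries k} :
    z ∈ powerSeriesTorsion Fq m M ↔ z + z ^ Fintype.card Fq ^ m +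
      (PowerSeries.X : PowerSeries k) ^ M * z ^ Fintype.card Fq ^ (m + 1) = 0 := by
  have h (n : ℕ) : ((FiniteField.frobeniusAlgHom Fq (PowerSeries k)) ^ n) z =
      z ^ Fintype.card Fq ^ n := by
    rw [AlgHom.coe_pow, FiniteField.coe_frobeniusAlgHom, pow_iterate]
  simp only [powerSeriesTorsion, LinearMap.mem_ker, LinearMap.add_apply, LinearMap.id_apply,
    AlgHom.toLinearMap_apply, LinearMap.comp_apply, LinearMap.mulLeft_apply, h]

theorem constantCoeff_injOn_powerSeriesTorsion {m M : ℕ} (hm : m ≠ 0) (hM : M ≠ 0) :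
    Set.InjOn PowerSeries.constantCoeff
      ((powerSeriesTorsion Fq m M : Submodule Fq (PowerSeries k)) : Set (PowerSeries k)) := by
  intro x hx y hy hxy
  have h : x - y ∈ powerSeriesTorsion Fq m M := sub_mem hx hy
  have h0 : PowerSeries.constantCoeff (x - y) = 0 := by rw [map_sub, hxy, sub_self]
  rw [← sub_eq_zero]
  generalize x - y = z at h h0
  have h1 : 1 < Fintype.card Fq ^ m := Nat.one_lt_pow hm Fintype.one_lt_card
  have h2 : 1 < Fintype.card Fq ^ (m + 1) := Nat.one_lt_pow (by omega) Fintype.one_lt_card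
  rw [mem_powerSeriesTorsion] at h
  have h3 : z * (1 + z ^ (Fintype.card Fq ^ m - 1) +
      PowerSeries.X ^ M * z ^ (Fintype.card Fq ^ (m + 1) - 1)) = 0 := by
    rw [← h, ← mul_pow_sub_one (by omega : Fintype.card Fq ^ m ≠ 0) z,
      ← mul_pow_sub_one (by omega : Fintype.card Fq ^ (m + 1) ≠ 0) z]
    ring
  refine (mul_eq_zero.mp h3).resolve_right fun h4 => ?_
  have h5 := congrArg PowerSeries.constantCoeff h4
  have e1 : Fintype.card Fq ^ m - 1 ≠ 0 := by omega
  simp [h0, e1, hM] at h5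

theorem exists_mem_powerSeriesTorsion {m M : ℕ} (hm : m ≠ 0) (hM : M ≠ 0) {a : k}
    (ha : a + a ^ Fintype.card Fq ^ m = 0) :
    ∃ z ∈ powerSeriesTorsion Fq m M, PowerSeries.constantCoeff z = a := by
  by_cases ha0 : a = 0
  · exact ⟨0, zero_mem _, by simp [ha0]⟩
  have h1 : 1 < Fintype.card Fq ^ m := Nat.one_lt_pow hm Fintype.one_lt_card
  have h2 : Fintype.card Fq ^ m < Fintype.card Fq ^ (m + 1) :=
    Nat.pow_lt_pow_right Fintype.one_lt_card (by omega)
  have hc : ((Fintype.card Fq : ℕ) : k) = 0 := cast_card_eq_zero_of_algebra Fq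
  have hcp (n : ℕ) (hn : n ≠ 0) : ((Fintype.card Fq ^ n : ℕ) : k) = 0 := by
    simp [hc, hn]
  generalize hQ : Fintype.card Fq ^ m = Q at *
  have hQ' := hcp m hm
  have hN' := hcp (m + 1) (by omega)
  rw [hQ] at hQ'
  generalize hN : Fintype.card Fq ^ (m + 1) = N at *
  let f : (PowerSeries k)[X] := X ^ (N - 1) + (X ^ (N - Q) + C (PowerSeries.X ^ M))
  have hf : f.Monic := by
    refine monic_X_pow_add ((degree_add_le _ _).trans_lt (max_lt ?_ ?_))
    · rw [degree_X_pow]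
      exact_mod_cast (by omega)
    · exact degree_C_le.trans_lt (by exact_mod_cast (by omega))
  have hfm : f.map PowerSeries.constantCoeff = X ^ (N - 1) + X ^ (N - Q) := by
    simp [f, hM]
  have ha1 : a ^ N * a⁻¹ ^ (N - 1) = a := by
    rw [← mul_pow_sub_one (by omega : N ≠ 0) a, mul_assoc, ← mul_pow, mul_inv_cancel₀ ha0, one_pow,
      mul_one]
  have ha2 : a ^ N * a⁻¹ ^ (N - Q) = a ^ Q := by
    obtain ⟨d, rfl⟩ := Nat.exists_eq_add_of_lt h2
    have : Q + d + 1 - Q = d + 1 := by omega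
    rw [this, add_assoc, pow_add, mul_assoc, ← mul_pow, mul_inv_cancel₀ ha0, one_pow, mul_one]
  obtain ⟨y, hy, hya⟩ := PowerSeries.exists_isRoot_of_constantCoeff hf (a := a⁻¹) (by
      rw [hfm]
      simp only [eval_add, eval_pow, eval_X]
      apply mul_left_cancel₀ (pow_ne_zero N ha0)
      rw [mul_add, ha1, ha2, ha, mul_zero]) (by
      rw [hfm]
      have e1 : ((N - 1 : ℕ) : k) = -1 := by
        rw [Nat.cast_sub (by omega), hN']
        simp
      have e2 : ((N - Q : ℕ) : k) = 0 := by
        rw [Nat.cast_sub (by omega), hN', hQ', sub_zero]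
      simp [derivative_X_pow, e1, e2, ha0])
  have hyu : IsUnit y := by
    rw [PowerSeries.isUnit_iff_constantCoeff, hya]
    exact (inv_ne_zero ha0).isUnit
  obtain ⟨z, hz⟩ := hyu.exists_right_inv
  refine ⟨z, ?_, ?_⟩
  · rw [mem_powerSeriesTorsion, hQ, hN]
    simp only [f, IsRoot.def, eval_add, eval_pow, eval_X, eval_C] at hy
    have hz1 : z ^ N * y ^ (N - 1) = z := by
      rw [← mul_pow_sub_one (by omega : N ≠ 0) z, mul_assoc, ← mul_pow, mul_comm z y, hz, one_pow,
        mul_one]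
    have hz2 : z ^ N * y ^ (N - Q) = z ^ Q := by
      obtain ⟨d, rfl⟩ := Nat.exists_eq_add_of_lt h2
      have : Q + d + 1 - Q = d + 1 := by omega
      rw [this, add_assoc, pow_add, mul_assoc, ← mul_pow, mul_comm z y, hz, one_pow, mul_one]
    linear_combination z ^ N * hy - hz1 - hz2
  · have := congrArg PowerSeries.constantCoeff hz
    rw [map_mul, hya, map_one] at this
    field_simp at this
    exact this

theorem ncard_powerSeriesTorsion [IsAlgClosed k] {m M : ℕ} (hm : m ≠ 0) (hM : M ≠ 0) :
    Nat.card (powerSeriesTorsion Fq m M : Submodule Fq (PowerSeries k)) =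
      Fintype.card Fq ^ m := by
  classical
  have h1 : 1 < Fintype.card Fq ^ m := Nat.one_lt_pow hm Fintype.one_lt_card
  have hc : ((Fintype.card Fq : ℕ) : k) = 0 := cast_card_eq_zero_of_algebra Fq
  let P : k[X] := X ^ Fintype.card Fq ^ m + X
  have hPd : P.natDegree = Fintype.card Fq ^ m := by
    rw [natDegree_add_eq_left_of_natDegree_lt, natDegree_X_pow]
    rwa [natDegree_X_pow, natDegree_X]
  have hP0 : P ≠ 0 := by
    intro h
    rw [h, natDegree_zero] at hPd
    omega
  have hP : P.Separable := by
    rw [separable_def]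
    have : derivative P = 1 := by simp [P, derivative_X_pow, hc, hm]
    rw [this]
    exact isCoprime_one_right
  have himg : PowerSeries.constantCoeff ''
      ((powerSeriesTorsion Fq m M : Submodule Fq (PowerSeries k)) : Set (PowerSeries k)) =
      P.rootSet k := by
    ext a
    rw [mem_rootSet]
    simp only [P, coe_aeval_eq_eval, eval_add, eval_pow, eval_X]
    constructor
    · rintro ⟨z, hz, rfl⟩
      rw [SetLike.mem_coe, mem_powerSeriesTorsion] at hz
      refine ⟨hP0, ?_⟩
      have := congrArg PowerSeries.constantCoeff hz
      simpa [hM, add_comm] using this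
    · rintro ⟨-, h⟩
      exact exists_mem_powerSeriesTorsion Fq hm hM (by rw [add_comm, h])
  have h2 := Set.InjOn.ncard_image
    (constantCoeff_injOn_powerSeriesTorsion (k := k) Fq hm hM)
  rw [himg] at h2
  change Set.ncard _ = _
  rw [← h2, ← hPd, ← card_rootSet_eq_natDegree (K := k) hP (IsAlgClosed.splits _),
    ← Nat.card_eq_fintype_card]
  rfl

end

section

variable (Fq : Type*) [Field Fq] [Fintype Fq] {k : Type*} [Field k] [IsAlgClosed k] [Algebra Fq k]

/-- Roots of order `q - 1` of units exist in power series. -/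
theorem exists_isUnit_algebraMap_eq_of_pow_eq {Ω : Type*} [Field Ω] [Algebra (PowerSeries k) Ω]
    [Algebra Fq Ω] [IsScalarTower Fq (PowerSeries k) Ω] (hq : 3 ≤ Fintype.card Fq)
    {u : PowerSeries k} (hu : IsUnit u) {Y : Ω}
    (hY : Y ^ (Fintype.card Fq - 1) = algebraMap (PowerSeries k) Ω u) :
    ∃ y : PowerSeries k, IsUnit y ∧ algebraMap (PowerSeries k) Ω y = Y := by
  have hc : ((Fintype.card Fq : ℕ) : k) = 0 := cast_card_eq_zero_of_algebra Fq
  have hu0 : PowerSeries.constantCoeff u ≠ 0 := (PowerSeries.isUnit_iff_constantCoeff.mp hu).ne_zero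
  obtain ⟨a, ha⟩ := IsAlgClosed.exists_pow_nat_eq (PowerSeries.constantCoeff u)
    (n := Fintype.card Fq - 1) (by omega)
  have ha0 : a ≠ 0 := by
    rintro rfl
    rw [zero_pow (by omega)] at ha
    exact hu0 ha.symm
  obtain ⟨y, hy, hya⟩ := PowerSeries.exists_isRoot_of_constantCoeff
    (f := X ^ (Fintype.card Fq - 1) - C u) (a := a) (monic_X_pow_sub_C _ (by omega))
    (by simp [ha]) (by
      have e1 : ((Fintype.card Fq - 1 : ℕ) : k) = -1 := by
        rw [Nat.cast_sub (by omega), hc]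
        simp
      simp [derivative_X_pow, e1, ha0])
  have hyu : IsUnit y := by
    rw [PowerSeries.isUnit_iff_constantCoeff, hya]
    exact ha0.isUnit
  simp only [IsRoot.def, eval_sub, eval_pow, eval_X, eval_C, sub_eq_zero] at hy
  have hy0 : algebraMap (PowerSeries k) Ω y ≠ 0 := (hyu.map _).ne_zero
  have hr : (Y / algebraMap (PowerSeries k) Ω y) ^ (Fintype.card Fq - 1) = 1 := by
    rw [div_pow, hY, ← map_pow, hy, div_self (hu.map _).ne_zero]
  obtain ⟨d, hd⟩ := FiniteField.exists_algebraMap_eq_of_pow_card (K := Fq)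
    (x := Y / algebraMap (PowerSeries k) Ω y) (by
      rw [← pow_sub_one_mul Fintype.card_ne_zero, hr, one_mul])
  have hd0 : d ≠ 0 := by
    rintro rfl
    rw [map_zero] at hd
    rw [← hd, zero_pow (by omega)] at hr
    exact zero_ne_one hr
  refine ⟨algebraMap Fq _ d * y, (hd0.isUnit.map _).mul hyu, ?_⟩
  rw [map_mul, ← IsScalarTower.algebraMap_apply, hd, div_mul_cancel₀ _ hy0]

variable {K Ω : Type*} [Field K] [Algebra (PowerSeries k) K] [IsFractionRing (PowerSeries k) K]
  [Field Ω] [Algebra K Ω] [Algebra (PowerSeries k) Ω] [IsScalarTower (PowerSeries k) K Ω]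
  [Algebra Fq Ω] [IsScalarTower Fq (PowerSeries k) Ω]

theorem isEisensteinAt_prod_X_sub_C_sub_C (Z : Finset (PowerSeries k))
    (h0 : (0 : PowerSeries k) ∈ Z) {y : PowerSeries k} (hy : IsUnit y) :
    (∏ z ∈ Z, (X - C (PowerSeries.X ^ 2 * z)) - C (PowerSeries.X * y)).Monic ∧
    (∏ z ∈ Z, (X - C (PowerSeries.X ^ 2 * z)) - C (PowerSeries.X * y)).natDegree = Z.card ∧
    (∏ z ∈ Z, (X - C (PowerSeries.X ^ 2 * z)) - C (PowerSeries.X * y)).IsEisensteinAt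
      (Ideal.span {(PowerSeries.X : PowerSeries k)}) := by
  have hcard : 0 < Z.card := Finset.card_pos.mpr ⟨0, h0⟩
  have hp : (∏ z ∈ Z, (X - C (PowerSeries.X ^ 2 * z))).Monic :=
    monic_prod_of_monic _ _ fun z _ => monic_X_sub_C _
  have hpd : (∏ z ∈ Z, (X - C (PowerSeries.X ^ 2 * z))).natDegree = Z.card := by
    rw [natDegree_prod_of_monic _ _ fun z _ => monic_X_sub_C _]
    simp only [natDegree_X_sub_C, Finset.sum_const, smul_eq_mul, mul_one]
  have hdeg : (C (PowerSeries.X * y)).degree <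
      (∏ z ∈ Z, (X - C (PowerSeries.X ^ 2 * z))).degree := by
    rw [degree_eq_natDegree hp.ne_zero, hpd]
    exact degree_C_le.trans_lt (by exact_mod_cast hcard)
  have hf := hp.sub_of_left hdeg
  have hfd : (∏ z ∈ Z, (X - C (PowerSeries.X ^ 2 * z)) -
      C (PowerSeries.X * y)).natDegree = Z.card := by
    rw [natDegree_sub_C, hpd]
  refine ⟨hf, hfd, ?_, ?_, ?_⟩
  · rw [hf.leadingCoeff, Ideal.mem_span_singleton]
    exact fun h => PowerSeries.X_prime.not_isUnit (isUnit_of_dvd_one h)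
  · intro n hn
    rw [hfd] at hn
    rw [← Ideal.Quotient.eq_zero_iff_mem, ← coeff_map, Polynomial.map_sub, Polynomial.map_prod]
    simp only [Polynomial.map_sub, map_X, map_mul, map_pow]
    simp [coeff_X_pow, hn.ne]
  · have hX0 : (PowerSeries.X : PowerSeries k) ≠ 0 := PowerSeries.X_prime.ne_zero
    rw [coeff_zero_eq_eval_zero, eval_sub, eval_prod, Finset.prod_eq_zero h0 (by simp), eval_C,
      zero_sub, neg_mem_iff, Ideal.span_singleton_pow, Ideal.mem_span_singleton, pow_two]
    intro h
    exact PowerSeries.X_prime.not_isUnit (isUnit_of_dvd_unit ((mul_dvd_mul_iff_left hX0).mp h) hy)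

theorem exists_inertia_transvections [IsAlgClosure K Ω] {m : ℕ} (hm : m ≠ 0)
    (hq : 3 ≤ Fintype.card Fq) {t : Ω}
    (ht : t = algebraMap (PowerSeries k) Ω PowerSeries.X ^ (Fintype.card Fq ^ m - 1)) :
    ∃ W : Submodule Fq Ω, W ≤ torsion Fq m t ∧ Nat.card W = Fintype.card Fq ^ m ∧
      ∀ x ∈ torsion Fq m t, x ∉ W → ∀ w ∈ W,
        ∃ τ : Ω ≃ₐ[K] Ω, τ x = x + w ∧ ∀ w' ∈ W, τ w' = w' := by
  classical
  have := IsAlgClosure.isAlgClosed K (K := Ω)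
  have : Normal K Ω := IsAlgClosure.normal K Ω
  set S := algebraMap (PowerSeries k) Ω PowerSeries.X with hS
  have hinj : Function.Injective (algebraMap (PowerSeries k) Ω) := by
    rw [IsScalarTower.algebraMap_eq (PowerSeries k) K Ω]
    exact (algebraMap K Ω).injective.comp (IsFractionRing.injective (PowerSeries k) K)
  have hS0 : S ≠ 0 := (map_ne_zero_iff _ hinj).mpr PowerSeries.X_prime.ne_zero
  have ht0 : t ≠ 0 := ht ▸ pow_ne_zero _ hS0
  have h1 : 1 < Fintype.card Fq ^ m := Nat.one_lt_pow hm Fintype.one_lt_card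
  have h2 : Fintype.card Fq ^ m < Fintype.card Fq ^ (m + 1) :=
    Nat.pow_lt_pow_right Fintype.one_lt_card (by omega)
  set Q := Fintype.card Fq ^ m with hQ
  set N := Fintype.card Fq ^ (m + 1) with hN
  let M := (Q - 1) * (Fintype.card Fq - 1) + (N - Q)
  have hM : M ≠ 0 := by omega
  let j : PowerSeries k →ₗ[Fq] Ω := LinearMap.mulLeft Fq S ∘ₗ
    (IsScalarTower.toAlgHom Fq (PowerSeries k) Ω).toLinearMap
  have hj (z : PowerSeries k) : j z = S * algebraMap (PowerSeries k) Ω z := rfl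
  have hjinj : Function.Injective j := fun a b h => hinj (mul_left_cancel₀ hS0 h)
  let Z : Submodule Fq (PowerSeries k) := powerSeriesTorsion Fq m M
  have hZcard : Nat.card Z = Q := ncard_powerSeriesTorsion Fq hm hM
  have hZ : (Z : Set (PowerSeries k)).Finite :=
    Nat.finite_of_card_ne_zero (by rw [SetLike.coe_sort_coe, hZcard]; omega)
  have hZc : hZ.toFinset.card = Q := by
    rw [← hZcard]
    exact (Nat.card_eq_card_finite_toFinset hZ).symm
  have hZ0 : (0 : PowerSeries k) ∈ hZ.toFinset := by simp
  have hW : ((Z.map j : Submodule Fq Ω) : Set Ω).Finite := by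
    rw [Submodule.map_coe]
    exact hZ.image _
  have hWfin : hW.toFinset = hZ.toFinset.map ⟨j, hjinj⟩ := by
    ext x
    simp
  have hWcard : Nat.card (Z.map j : Submodule Fq Ω) = Q := by
    rw [← hZc, ← Finset.card_map ⟨j, hjinj⟩, ← hWfin]
    exact Nat.card_eq_card_finite_toFinset hW
  have hWV : Z.map j ≤ torsion Fq m t := by
    rintro _ ⟨z, hz, rfl⟩
    have hz' := congrArg (algebraMap (PowerSeries k) Ω) ((mem_powerSeriesTorsion Fq).mp hz)
    simp only [map_add, map_mul, map_pow, map_zero, ← hS, M, ← hQ, ← hN] at hz'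
    rw [mem_torsion, hj, ht, ← hQ, ← hN]
    have e1 : S ^ (Q - 1) * S = S ^ Q := pow_sub_one_mul (by omega) S
    have e2 : S ^ N = S ^ Q * S ^ (N - Q) := by
      rw [← pow_add]
      congr 1
      omega
    rw [mul_pow, mul_pow, ← pow_mul, e2]
    rw [pow_add] at hz'
    linear_combination S ^ Q * hz' + algebraMap (PowerSeries k) Ω z * e1
  refine ⟨Z.map j, hWV, hWcard, fun x hx hxW w hw => ?_⟩
  have hV : (torsion Fq m t : Set Ω).Finite := torsion_finite Fq ht0
  obtain ⟨c, hc0, hc⟩ := prod_erase_zero_eq_of_hyperplane Fq hV hW hWV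
    (by rw [hWcard, ncard_torsion Fq ht0 hm, hQ, pow_succ, mul_comm]) hx hxW
  have hprod := prod_torsion Fq ht0 hm
  have hη : ∏ v ∈ hW.toFinset.erase 0, v =
      t * algebraMap (PowerSeries k) Ω (∏ z ∈ hZ.toFinset.erase 0, z) := by
    have : hW.toFinset.erase 0 = (hZ.toFinset.erase 0).map ⟨j, hjinj⟩ := by
      rw [hWfin, Finset.map_erase]
      simp
    rw [this, Finset.prod_map, map_prod, ht, ← hZc, ← Finset.card_erase_of_mem hZ0,
      ← Finset.prod_const, ← Finset.prod_mul_distrib]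
    rfl
  have hηu : IsUnit (∏ z ∈ hZ.toFinset.erase 0, z) := by
    refine Finset.prod_induction _ IsUnit (fun _ _ => IsUnit.mul) isUnit_one fun z hz => ?_
    rw [PowerSeries.isUnit_iff_constantCoeff, isUnit_iff_ne_zero]
    intro h
    rw [Finset.mem_erase, Set.Finite.mem_toFinset] at hz
    exact hz.1 (constantCoeff_injOn_powerSeriesTorsion Fq hm hM hz.2 Z.zero_mem (by simpa using h))
  have hcu : IsUnit (algebraMap Fq (PowerSeries k) c) := hc0.isUnit.map _
  obtain ⟨u, hu⟩ := (hηu.mul hcu).exists_right_inv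
  have huu : IsUnit u := IsUnit.of_mul_eq_one_right _ hu
  set y := ∏ v ∈ hW.toFinset, (x - v) with hy
  have hYpow : (t * y) ^ (Fintype.card Fq - 1) =
      algebraMap (PowerSeries k) Ω ((-1) ^ (N - 1) * u) := by
    rw [hc, hη] at hprod
    have hu' := congrArg (algebraMap (PowerSeries k) Ω) hu
    rw [map_mul, map_mul, map_one, ← IsScalarTower.algebraMap_apply] at hu'
    apply mul_left_cancel₀ ht0
    rw [mul_pow, map_mul, map_pow, map_neg, map_one]
    linear_combination algebraMap (PowerSeries k) Ω u * hprod -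
      t * t ^ (Fintype.card Fq - 1) * y ^ (Fintype.card Fq - 1) * hu'
  obtain ⟨Y, hYu, hY⟩ := exists_isUnit_algebraMap_eq_of_pow_eq Fq hq
    ((isUnit_one.neg.pow (N - 1)).mul huu) hYpow
  obtain ⟨hEm, hEd, hE⟩ := isEisensteinAt_prod_X_sub_C_sub_C hZ.toFinset hZ0 hYu
  have hEirr := irreducible_map_of_isEisensteinAt (K := K) PowerSeries.span_X_isPrime hEm
    (by omega) hE
  have hroot (x' : Ω) (hx' : ∏ v ∈ hW.toFinset, (x' - v) = y) :
      aeval (S * x') ((∏ z ∈ hZ.toFinset, (X - C (PowerSeries.X ^ 2 * z)) -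
        C (PowerSeries.X * Y)).map (algebraMap (PowerSeries k) K)) = 0 := by
    rw [aeval_map_algebraMap, map_sub, map_prod, aeval_C, map_mul, hY, ← hS]
    simp only [map_sub, aeval_X, aeval_C, map_mul, map_pow, ← hS]
    have : ∏ z ∈ hZ.toFinset, (S * x' - S ^ 2 * algebraMap (PowerSeries k) Ω z) = S ^ Q * y := by
      rw [← hx', hWfin, Finset.prod_map, ← hZc, ← Finset.prod_const, ← Finset.prod_mul_distrib]
      refine Finset.prod_congr rfl fun z _ => ?_
      rw [Function.Embedding.coeFn_mk, hj]
      ring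
    rw [this, ht, ← pow_sub_one_mul (by omega : Q ≠ 0) S]
    ring
  have hyw : ∏ v ∈ hW.toFinset, (x + w - v) = y := by
    rw [hy]
    refine Finset.prod_nbij' (fun v => v - w) (fun v => v + w) ?_ ?_ ?_ ?_ ?_
    · intro v hv
      rw [Set.Finite.mem_toFinset] at hv ⊢
      exact sub_mem hv hw
    · intro v hv
      rw [Set.Finite.mem_toFinset] at hv ⊢
      exact add_mem hv hw
    · intro v _
      exact sub_add_cancel v w
    · intro v _
      exact add_sub_cancel_right v w
    · intro v _
      ring
  obtain ⟨τ, hτ⟩ := exists_algEquiv_of_irreducible (L := Ω) hEirr (hroot x rfl) (hroot (x + w) hyw)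
  have hτR (z : PowerSeries k) : τ (algebraMap (PowerSeries k) Ω z) =
      algebraMap (PowerSeries k) Ω z := by
    rw [IsScalarTower.algebraMap_apply (PowerSeries k) K Ω, AlgEquiv.commutes]
  refine ⟨τ, ?_, ?_⟩
  · rw [map_mul, hτR] at hτ
    exact mul_left_cancel₀ hS0 hτ
  · rintro _ ⟨z, -, rfl⟩
    rw [hj, map_mul, hτR, hτR]

end

section

variable (Fq : Type*) [Field Fq] [Fintype Fq] {k : Type*} [Field k] [IsAlgClosed k] [Algebra Fq k]
  {K Ω : Type*} [Field K] [Algebra (PowerSeries k) K] [IsFractionRing (PowerSeries k) K]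
  [Field Ω] [Algebra K Ω] [Algebra (PowerSeries k) Ω] [IsScalarTower (PowerSeries k) K Ω]
  [Algebra Fq Ω] [IsScalarTower Fq (PowerSeries k) Ω]
  {F L : Type*} [Field F] [Field L] [Algebra F L] [Algebra Fq F] [Algebra Fq L]
  [IsScalarTower Fq F L] [Algebra F K] [Algebra F Ω] [IsScalarTower F K Ω] [IsScalarTower Fq F Ω]

/-- The transvections of `exists_inertia_transvections`, restricted along an embedding of `F` into
the fraction field of a power series ring. -/
theorem exists_transvections_of_embedding [IsAlgClosure K Ω] [IsAlgClosure F L] {m : ℕ}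
    (hm : m ≠ 0) (hq : 3 ≤ Fintype.card Fq) {t : F} (ht : algebraMap F Ω t =
      algebraMap (PowerSeries k) Ω PowerSeries.X ^ (Fintype.card Fq ^ m - 1)) (ht0 : t ≠ 0) :
    ∃ W : Submodule Fq L, W ≤ torsion Fq m (algebraMap F L t) ∧
      Nat.card W = Fintype.card Fq ^ m ∧
      ∀ x ∈ torsion Fq m (algebraMap F L t), x ∉ W → ∀ w ∈ W,
        ∃ σ : L ≃ₐ[F] L, σ x = x + w ∧ ∀ w' ∈ W, σ w' = w' := by
  have := IsAlgClosure.isAlgClosed K (K := Ω)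
  have := IsAlgClosure.isAlgClosed F (K := L)
  have : Algebra.IsAlgebraic F L := IsAlgClosure.isAlgebraic
  have : Normal F L := IsAlgClosure.normal F L
  obtain ⟨W, hWV, hWc, hW⟩ := exists_inertia_transvections Fq (K := K) hm hq ht
  let ι : L →ₐ[F] Ω := IsAlgClosed.lift
  let ιq : L →ₗ[Fq] Ω := (ι.restrictScalars Fq).toLinearMap
  have hι : Function.Injective ιq := ι.injective
  have htors (x : L) : ι x ∈ torsion Fq m (algebraMap F Ω t) ↔
      x ∈ torsion Fq m (algebraMap F L t) := by
    rw [mem_torsion, mem_torsion, ← map_eq_zero_iff ι ι.injective]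
    simp
  have hL0 : algebraMap F L t ≠ 0 := by simpa using ht0
  have hΩ0 : algebraMap F Ω t ≠ 0 := by simpa using ht0
  have hmap : (torsion Fq m (algebraMap F L t)).map ιq = torsion Fq m (algebraMap F Ω t) := by
    apply SetLike.coe_injective
    apply Set.eq_of_subset_of_ncard_le
    · rintro _ ⟨x, hx, rfl⟩
      exact (htors x).mpr hx
    · rw [Submodule.map_coe, Set.ncard_image_of_injective _ hι]
      refine le_of_eq ?_
      exact (ncard_torsion Fq hΩ0 hm).trans (ncard_torsion Fq hL0 hm).symm
    · exact torsion_finite Fq hΩ0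
  have hWmap : (W.comap ιq).map ιq = W := by
    refine Submodule.map_comap_eq_self fun w hw => ?_
    have := hWV hw
    rw [← hmap] at this
    obtain ⟨x, -, rfl⟩ := this
    exact ⟨x, rfl⟩
  refine ⟨W.comap ιq, fun w hw => (htors w).mp (hWV hw), ?_, fun x hx hxW w hw => ?_⟩
  · rw [← hWc, ← congrArg (fun U : Submodule Fq Ω => Nat.card U) hWmap]
    exact (Nat.card_image_of_injective hι _).symm
  · obtain ⟨τ, hτx, hτW⟩ := hW (ι x) ((htors x).mpr hx) hxW (ι w) hw
    let _ : Algebra L Ω := ι.toRingHom.toAlgebra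
    have : IsScalarTower F L Ω := IsScalarTower.of_algebraMap_eq fun a => (ι.commutes a).symm
    let σ : L ≃ₐ[F] L := (τ.restrictScalars F).restrictNormal L
    have hσ (z : L) : ι (σ z) = τ (ι z) := (τ.restrictScalars F).restrictNormal_commutes L z
    refine ⟨σ, hι (?_ : ι _ = ι _), fun w' hw' => hι (?_ : ι _ = ι _)⟩
    · rw [hσ, hτx, map_add]
    · rw [hσ]
      exact hτW _ hw'

end

section

variable (Fq : Type*) [Field Fq] {k : Type*} [Field k] [Algebra Fq k]

theorem injective_aeval_powerSeriesX_pow {n : ℕ} (hn : 0 < n) :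
    Function.Injective (Polynomial.aeval (R := Fq) ((PowerSeries.X : PowerSeries k) ^ n)) := by
  have h (p : Fq[X]) : Polynomial.aeval ((PowerSeries.X : PowerSeries k) ^ n) p =
      ((expand k n (p.map (algebraMap Fq k)) : k[X]) : PowerSeries k) := by
    induction p using Polynomial.induction_on' with
    | add p q hp hq => simp [hp, hq]
    | monomial i a =>
      rw [aeval_monomial, map_monomial, expand_monomial, Polynomial.coe_monomial,
        ← pow_mul, mul_comm n, PowerSeries.monomial_eq_C_mul_X_pow,
        PowerSeries.algebraMap_apply]
  intro a b hab
  rw [h, h] at hab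
  exact map_injective _ (algebraMap Fq k).injective
    (expand_injective hn (Polynomial.coe_injective k hab))

end

section

variable (Fq : Type*) [Field Fq] [Fintype Fq]

theorem exists_transvections_ratFunc {L : Type*} [Field L] [Algebra (RatFunc Fq) L] [Algebra Fq L]
    [IsScalarTower Fq (RatFunc Fq) L] [IsAlgClosure (RatFunc Fq) L] {m : ℕ}
    (hm : m ≠ 0) (hq : 3 ≤ Fintype.card Fq) :
    ∃ W : Submodule Fq L, W ≤ torsion Fq m (algebraMap (RatFunc Fq) L RatFunc.X) ∧
      Nat.card W = Fintype.card Fq ^ m ∧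
      ∀ x ∈ torsion Fq m (algebraMap (RatFunc Fq) L RatFunc.X), x ∉ W → ∀ w ∈ W,
        ∃ σ : L ≃ₐ[RatFunc Fq] L, σ x = x + w ∧ ∀ w' ∈ W, σ w' = w' := by
  let k := AlgebraicClosure Fq
  let K := FractionRing (PowerSeries k)
  let Ω := AlgebraicClosure K
  have h1 : 1 < Fintype.card Fq ^ m := Nat.one_lt_pow hm Fintype.one_lt_card
  let n := Fintype.card Fq ^ m - 1
  let j : Fq[X] →ₐ[Fq] K := (IsScalarTower.toAlgHom Fq (PowerSeries k) K).comp
    (aeval ((PowerSeries.X : PowerSeries k) ^ n))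
  have hj : Function.Injective j := (IsFractionRing.injective (PowerSeries k) K).comp
    (injective_aeval_powerSeriesX_pow Fq (by omega : 0 < n))
  let _ : Algebra (RatFunc Fq) K :=
    (IsFractionRing.lift (K := RatFunc Fq) (g := j.toRingHom) hj).toAlgebra
  have hlift (p : Fq[X]) : algebraMap (RatFunc Fq) K (algebraMap Fq[X] (RatFunc Fq) p) = j p :=
    IsFractionRing.lift_algebraMap (g := j.toRingHom) hj p
  have : IsScalarTower Fq (RatFunc Fq) K := IsScalarTower.of_algebraMap_eq fun c => by
    rw [IsScalarTower.algebraMap_apply Fq Fq[X] (RatFunc Fq), hlift]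
    exact (j.commutes c).symm
  have : IsScalarTower Fq (RatFunc Fq) Ω := IsScalarTower.of_algebraMap_eq fun c => by
    rw [IsScalarTower.algebraMap_apply Fq K Ω, IsScalarTower.algebraMap_apply (RatFunc Fq) K Ω,
      ← IsScalarTower.algebraMap_apply Fq (RatFunc Fq) K]
  refine exists_transvections_of_embedding Fq (k := k) (K := K) (Ω := Ω) hm hq ?_ RatFunc.X_ne_zero
  rw [IsScalarTower.algebraMap_apply (RatFunc Fq) K Ω, ← RatFunc.algebraMap_X, hlift, ← map_pow,
    IsScalarTower.algebraMap_apply (PowerSeries k) K Ω]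
  simp [j, n]

end

section

variable (Fq : Type*) [Field Fq] [Fintype Fq] {F L : Type*} [Field F] [Field L] [Algebra F L]
  [Algebra Fq F] [Algebra Fq L] [IsScalarTower Fq F L]

theorem exists_dual_transvection_mem_range_galTorsion [IsAlgClosed L] {m : ℕ} (hm : m ≠ 0)
    {t : F} (ht : t ≠ 0)
    {W : Submodule Fq L} (hWV : W ≤ torsion Fq m (algebraMap F L t))
    (hWc : Nat.card W = Fintype.card Fq ^ m)
    (hW : ∀ x ∈ torsion Fq m (algebraMap F L t), x ∉ W → ∀ w ∈ W,
        ∃ σ : L ≃ₐ[F] L, σ x = x + w ∧ ∀ w' ∈ W, σ w' = w') :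
    ∃ f : Dual Fq (torsion Fq m (algebraMap F L t)), f ≠ 0 ∧
      ∀ v (h : f v = 0), LinearEquiv.transvection h ∈ (galTorsion Fq m t (L := L)).range := by
  have ht' : algebraMap F L t ≠ 0 := by simpa using ht
  set V := torsion Fq m (algebraMap F L t) with hV
  have : Finite V := torsion_finite Fq ht'
  have hVr : finrank Fq V = m + 1 := finrank_torsion Fq ht' hm
  let W' := W.comap V.subtype
  have hW'r : finrank Fq W' = m := by
    have : Finite W := Finite.of_injective _ (Submodule.inclusion_injective hWV)
    rw [(Submodule.comapSubtypeEquivOfLe hWV).finrank_eq]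
    have h := Module.natCard_eq_pow_finrank (K := Fq) (V := W)
    rw [hWc, Nat.card_eq_fintype_card] at h
    exact (Nat.pow_right_injective Fintype.one_lt_card h).symm
  have hlt : W' < ⊤ := by
    refine lt_of_le_of_ne le_top fun h => ?_
    rw [h, finrank_top] at hW'r
    omega
  obtain ⟨f, hf, hfW⟩ := W'.exists_le_ker_of_lt_top hlt
  have hker : W' = LinearMap.ker f := by
    refine Submodule.eq_of_le_of_finrank_eq hfW ?_
    have := Module.Dual.finrank_ker_add_one_of_ne_zero hf
    omega
  refine ⟨f, hf, fun w hw => ?_⟩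
  obtain ⟨y, hy⟩ := DFunLike.ne_iff.mp hf
  rw [LinearMap.zero_apply] at hy
  let x := (f y)⁻¹ • y
  have hx : f x = 1 := by simp [x, hy]
  have hmem (v : V) : (v : L) ∈ W ↔ f v = 0 := by
    rw [← LinearMap.mem_ker, ← hker]
    rfl
  obtain ⟨σ, hσx, hσW⟩ := hW x x.2 (by rw [hmem, hx]; exact one_ne_zero) w ((hmem w).mpr hw)
  refine ⟨σ, LinearEquiv.ext fun v => ?_⟩
  have h1 : galTorsion Fq m t σ x = x + w := Subtype.ext hσx
  have h2 : galTorsion Fq m t σ (v - f v • x) = v - f v • x :=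
    Subtype.ext (hσW _ ((hmem _).mpr (by simp [hx])))
  rw [map_sub, map_smul, h1] at h2
  rw [LinearEquiv.transvection.apply]
  rw [sub_eq_iff_eq_add] at h2
  rw [h2, smul_add]
  abel

theorem eq_bot_or_eq_top_of_galTorsion_stable [IsAlgClosure F L]
    (v : Valuation F ℤᵐ⁰) {m : ℕ} {t : F} (hvt : v t = exp 1) (hm : m ≠ 0)
    (hq : 3 ≤ Fintype.card Fq) (U : Submodule Fq (torsion Fq m (algebraMap F L t)))
    (hU : ∀ g ∈ (galTorsion Fq m t (L := L)).range, ∀ u ∈ U, g u ∈ U) : U = ⊥ ∨ U = ⊤ := by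
  have hinj := (torsion Fq m (algebraMap F L t)).injective_subtype
  have := eq_bot_or_eq_torsion_of_stable Fq v hvt hm hq
    (U.map (torsion Fq m (algebraMap F L t)).subtype) (Submodule.map_subtype_le _ _) (by
      rintro σ _ ⟨u, hu, rfl⟩
      exact ⟨galTorsion Fq m t σ u, hU _ ⟨σ, rfl⟩ u hu, rfl⟩)
  refine this.imp (fun h => ?_) fun h => ?_
  · exact Submodule.map_injective_of_injective hinj (by rw [h, Submodule.map_bot])
  · refine Submodule.map_injective_of_injective hinj ?_
    rw [h, Submodule.map_top, Submodule.range_subtype]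

end

section

variable (Fq : Type*) [Field Fq] [Fintype Fq]

theorem irreducible_X_pow_sub_C_ratFuncX {n k : ℕ} (hn : 0 < n) :
    Irreducible (X ^ n - C ((-1) ^ k * RatFunc.X : RatFunc Fq)) := by
  have hX0 : (X : Fq[X]) ≠ 0 := X_ne_zero
  have hP : (Ideal.span {(X : Fq[X])}).IsPrime :=
    (Ideal.span_singleton_prime hX0).mpr prime_X
  have h := irreducible_map_of_isEisensteinAt (K := RatFunc Fq) hP
    (f := X ^ n - C ((-1) ^ k * X : Fq[X])) (monic_X_pow_sub_C _ hn.ne')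
    (by rwa [natDegree_X_pow_sub_C]) ?_
  · simpa using h
  refine ⟨?_, fun {i} hi => ?_, ?_⟩
  · rw [(monic_X_pow_sub_C _ hn.ne').leadingCoeff, ← Ideal.eq_top_iff_one]
    exact hP.ne_top
  · rw [natDegree_X_pow_sub_C] at hi
    rw [coeff_sub, coeff_X_pow, if_neg hi.ne, zero_sub, neg_mem_iff, coeff_C]
    split_ifs
    · exact Ideal.mul_mem_left _ _ (Ideal.mem_span_singleton_self _)
    · exact zero_mem _
  · rw [coeff_sub, coeff_X_pow, if_neg hn.ne, zero_sub, neg_mem_iff, coeff_C_zero,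
      Ideal.span_singleton_pow, Ideal.mem_span_singleton]
    intro h
    rw [((isUnit_one.neg.pow k).dvd_mul_left), pow_two] at h
    exact not_isUnit_X (isUnit_of_dvd_one ((mul_dvd_mul_iff_left hX0).mp (by simpa using h)))

/-- The Galois action on the torsion is surjective onto the general linear group. -/
theorem galTorsion_ratFuncX_surjective {L : Type*} [Field L] [Algebra (RatFunc Fq) L] [Algebra Fq L]
    [IsScalarTower Fq (RatFunc Fq) L] [IsAlgClosure (RatFunc Fq) L] {m : ℕ}
    (hm : m ≠ 0) (hq : 3 ≤ Fintype.card Fq) :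
    Function.Surjective (galTorsion Fq m (RatFunc.X : RatFunc Fq) (L := L)) := by
  classical
  have := IsAlgClosure.isAlgClosed (RatFunc Fq) (K := L)
  have ht' : algebraMap (RatFunc Fq) L RatFunc.X ≠ 0 := by simp [RatFunc.X_ne_zero]
  have : Finite (torsion Fq m (algebraMap (RatFunc Fq) L RatFunc.X)) := torsion_finite Fq ht'
  have : Nontrivial (torsion Fq m (algebraMap (RatFunc Fq) L RatFunc.X)) :=
    Module.nontrivial_of_finrank_pos (R := Fq) (by rw [finrank_torsion Fq ht' hm]; omega)
  obtain ⟨W, hWV, hWc, hW⟩ := exists_transvections_ratFunc Fq (L := L) hm hq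
  obtain ⟨f, hf, htr⟩ :=
    exists_dual_transvection_mem_range_galTorsion Fq hm RatFunc.X_ne_zero hWV hWc hW
  rw [← MonoidHom.range_eq_top]
  refine subgroup_eq_top_of_transvections _ (fun U hU => ?_) f hf htr fun d => ?_
  · exact eq_bot_or_eq_top_of_galTorsion_stable Fq (RatFunc.inftyValuation Fq)
      (RatFunc.inftyValuation.X Fq) hm hq U hU
  · obtain ⟨σ, hσ⟩ := exists_det_galTorsion_eq Fq (L := L) RatFunc.X_ne_zero hm
      (irreducible_X_pow_sub_C_ratFuncX Fq (by omega)) d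
    exact ⟨_, ⟨σ, rfl⟩, hσ⟩

end

end

/-- The mod `(T)` Galois representation of `φ` is surjective: `φ[T]` is an
`𝔽_q`-vector space of dimension `r` (i.e. it has `q^r` elements), and every
`𝔽_q`-linear automorphism of `φ[T]` is the restriction of some `σ ∈ Gal(F̄/F)`. -/
theorem mod_T_galois_representation_surjective
    (p e q r : ℕ) (hp : p.Prime) (hp5 : 5 ≤ p) (he : 0 < e) (hq : q = p ^ e)
    (hr : r.Prime) (hr3 : 3 ≤ r)
    (Fq : Type) [Field Fq] [Fintype Fq] (hFq : Fintype.card Fq = q)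
    (φ : Polynomial Fq →+* AddMonoid.End (Kbar Fq)) (hφ : IsDrinfeldPhi Fq q r φ) :
    Nat.card (phiTorsion Fq φ X) = q ^ r ∧
    ∀ g : Kbar Fq → Kbar Fq, IsFqLinearAut Fq φ g →
      ∃ σ : Kbar Fq ≃ₐ[RatFunc Fq] Kbar Fq, ∀ x ∈ phiTorsion Fq φ X, σ x = g x := by
  subst hFq
  obtain ⟨m, rfl⟩ : ∃ m, r = m + 1 := ⟨r - 1, by omega⟩
  have hm : m ≠ 0 := by omega
  have hq3 : 3 ≤ Fintype.card Fq := by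
    rw [hq]
    exact (by omega : 3 ≤ p).trans (Nat.le_self_pow he.ne' p)
  have hC (c : Fq) : algebraMap (RatFunc Fq) (Kbar Fq) (RatFunc.C c) =
      algebraMap Fq (Kbar Fq) c := by
    rw [IsScalarTower.algebraMap_apply Fq (RatFunc Fq) (Kbar Fq), RatFunc.algebraMap_eq_C]
  have hX : algebraMap (RatFunc Fq) (Kbar Fq) RatFunc.X ≠ 0 := by simp [RatFunc.X_ne_zero]
  have hT (x : Kbar Fq) : x ∈ phiTorsion Fq φ X ↔
      x ∈ torsion Fq m (algebraMap (RatFunc Fq) (Kbar Fq) RatFunc.X) := by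
    rw [mem_torsion, phiTorsion, Set.mem_ofPred_eq, hφ.2, Nat.add_sub_cancel]
  have hTs : phiTorsion Fq φ X =
      torsion Fq m (algebraMap (RatFunc Fq) (Kbar Fq) RatFunc.X) := Set.ext hT
  refine ⟨?_, fun g ⟨hg, hadd, hsmul⟩ => ?_⟩
  · rw [hTs]
    exact ncard_torsion Fq hX hm
  · rw [hTs] at hg hadd hsmul
    let G : torsion Fq m (algebraMap (RatFunc Fq) (Kbar Fq) RatFunc.X) →ₗ[Fq]
        torsion Fq m (algebraMap (RatFunc Fq) (Kbar Fq) RatFunc.X) :=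
      { toFun x := ⟨g x, hg.mapsTo x.2⟩
        map_add' x y := Subtype.ext (hadd x x.2 y y.2)
        map_smul' c x := Subtype.ext (by
          have := hsmul c x x.2
          rw [hC, ← Algebra.smul_def, ← Algebra.smul_def] at this
          exact this) }
    have hG : Function.Bijective G := hg.bijective
    obtain ⟨σ, hσ⟩ := galTorsion_ratFuncX_surjective Fq (L := Kbar Fq) hm hq3
      (LinearEquiv.ofBijective G hG)
    refine ⟨σ, fun x hx => ?_⟩
    exact congrArg Subtype.val (LinearEquiv.congr_fun hσ ⟨x, (hT x).mp hx⟩)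
end
end

section
/- There exists a constant c = c(r) ∈ ℕ depending only on r such that whenever p > c the following holds: for every nonzero prime ideal 𝔩 of A with 𝔩 ≠ (T), the Galois module φ[𝔩] is irreducible; that is, the only 𝔽_𝔩-subspaces X ⊆ φ[𝔩] satisfying σ(X) = X for all σ ∈ Gal(F̄/F) are X = 0 and X = φ[𝔩]. -/
open Polynomial

noncomputable section

/-- `V` is a Galois-stable `𝔽_𝔩`-subspace of `φ[𝔩]` (for `𝔩 = (l)`): a subset of the
`l`-torsion containing `0`, closed under addition and under the `A`-action through `φ`
(hence an `A/𝔩 = 𝔽_𝔩`-subspace), and stable under `Gal(F̄/F)`. -/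
def IsGaloisStableSubspace (Fq : Type) [Field Fq]
    (φ : Polynomial Fq →+* AddMonoid.End (Kbar Fq)) (l : Polynomial Fq)
    (V : Set (Kbar Fq)) : Prop :=
  V ⊆ phiTorsion Fq φ l ∧ (0 : Kbar Fq) ∈ V ∧
  (∀ x ∈ V, ∀ y ∈ V, x + y ∈ V) ∧
  (∀ b : Polynomial Fq, ∀ x ∈ V, φ b x ∈ V) ∧
  (∀ σ : Kbar Fq ≃ₐ[RatFunc Fq] Kbar Fq, ∀ x ∈ V, σ x ∈ V)

/-- A Drinfeld-type action of `𝔽_q[X]` on a field `L` in which `X` acts as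
`T + τ^s + T^(q-1) τ^(s+1)`. -/
structure IsDrinfeldAction {Fq L : Type*} [Field Fq] [Fintype Fq] [Field L] (ι : Fq →+* L)
    (T : L) (s : ℕ) (φ : Fq[X] →+* AddMonoid.End L) : Prop where
  C_apply : ∀ c x, φ (C c) x = ι c * x
  X_apply : ∀ x, φ X x = T * x + x ^ Fintype.card Fq ^ s +
    T ^ (Fintype.card Fq - 1) * x ^ Fintype.card Fq ^ (s + 1)

/-- `V` is a finite `𝔽_q[X]`-submodule of the `l`-torsion. -/
structure IsTorsionSubmodule {Fq L : Type*} [Field Fq] [Field L]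
    (φ : Fq[X] →+* AddMonoid.End L) (l : Fq[X]) (V : Finset L) : Prop where
  zero_mem : 0 ∈ V
  add_mem : ∀ x ∈ V, ∀ y ∈ V, x + y ∈ V
  apply_mem : ∀ a, ∀ x ∈ V, φ a x ∈ V
  torsion : ∀ x ∈ V, φ l x = 0

lemma AddMonoid.End.map_mul_apply {A M : Type*} [Semiring A] [AddCommMonoid M]
    (φ : A →+* AddMonoid.End M) (a b : A) (x : M) : φ (a * b) x = φ a (φ b x) := by
  rw [map_mul]; rfl

lemma AddMonoid.End.map_add_apply {A M : Type*} [Semiring A] [AddCommMonoid M]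
    (φ : A →+* AddMonoid.End M) (a b : A) (x : M) : φ (a + b) x = φ a x + φ b x := by
  rw [map_add]; rfl

lemma Finset.eq_empty_of_forall_lt {α β : Type*} [LinearOrder β] (U : Finset α) (f : α → α)
    (g : α → β) (h : ∀ x ∈ U, f x ∈ U ∧ g x < g (f x)) : U = ∅ := by
  by_contra hne
  obtain ⟨x, hx, hmax⟩ := U.exists_max_image g (Finset.nonempty_iff_ne_empty.2 hne)
  exact (h x hx).2.not_ge (hmax _ (h x hx).1)

namespace IsTorsionSubmodule

variable {Fq L : Type*} [Field Fq] [Field L] {φ : Fq[X] →+* AddMonoid.End L} {l : Fq[X]}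
  {V : Finset L}

lemma sub_mem (hV : IsTorsionSubmodule φ l V) {x y : L} (hx : x ∈ V) (hy : y ∈ V) :
    x - y ∈ V := by
  have h := hV.add_mem x hx _ (hV.apply_mem (-1) y hy)
  rw [map_neg, map_one] at h
  rw [sub_eq_add_neg]
  exact h

lemma eq_zero_of_isCoprime (hV : IsTorsionSubmodule φ l V) {a : Fq[X]} (ha : IsCoprime a l)
    {x : L} (hx : x ∈ V) (h : φ a x = 0) : x = 0 := by
  obtain ⟨u, w, huw⟩ := ha
  have h1 : φ (u * a + w * l) x = x := by rw [huw, map_one]; rfl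
  rw [AddMonoid.End.map_add_apply, AddMonoid.End.map_mul_apply, AddMonoid.End.map_mul_apply, h,
    hV.torsion x hx, map_zero, map_zero, add_zero] at h1
  exact h1.symm

end IsTorsionSubmodule

section Valuation

variable {Fq L Γ₀ : Type*} [Field Fq] [Fintype Fq] [Field L]
  [LinearOrderedCommGroupWithZero Γ₀] {ι : Fq →+* L} {T : L} {s : ℕ}
  {φ : Fq[X] →+* AddMonoid.End L} {l : Fq[X]} {V : Finset L}

lemma Valuation.map_const_eq_one (v : Valuation L Γ₀) (ι : Fq →+* L) {c : Fq} (hc : c ≠ 0) :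
    v (ι c) = 1 := by
  have h : v (ι c) ^ (Fintype.card Fq - 1) = 1 := by
    rw [← map_pow, ← map_pow, FiniteField.pow_card_sub_one_eq_one c hc, map_one, map_one]
  have := Fintype.one_lt_card (α := Fq)
  exact (pow_eq_one_iff_left (by omega)).mp h

lemma Valuation.map_const_le_one (v : Valuation L Γ₀) (ι : Fq →+* L) (c : Fq) :
    v (ι c) ≤ 1 := by
  by_cases hc : c = 0
  · simp [hc]
  · exact (v.map_const_eq_one ι hc).le

lemma Valuation.map_pow_mul_pow_pow_succ (v : Valuation L Γ₀) {q : ℕ} (hq : 1 ≤ q) (T x : L)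
    (s : ℕ) :
    v (T ^ (q - 1) * x ^ q ^ (s + 1)) = (v x ^ q ^ s * v T) ^ (q - 1) * v x ^ q ^ s := by
  obtain ⟨k, hk⟩ : ∃ k, q = k + 1 := ⟨q - 1, by omega⟩
  simp only [map_mul, map_pow, pow_succ q s, pow_mul (v x)]
  generalize v x ^ q ^ s = z
  rw [hk, Nat.add_sub_cancel, mul_pow, pow_succ]
  ac_rfl

namespace IsDrinfeldAction

lemma val_C_apply (hφ : IsDrinfeldAction ι T s φ) (v : Valuation L Γ₀) {c : Fq} (hc : c ≠ 0)
    (x : L) : v (φ (C c) x) = v x := by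
  rw [hφ.C_apply, map_mul, v.map_const_eq_one ι hc, one_mul]

lemma val_C_apply_le (hφ : IsDrinfeldAction ι T s φ) (v : Valuation L Γ₀) (c : Fq)
    (x : L) : v (φ (C c) x) ≤ v x := by
  rw [hφ.C_apply, map_mul]
  exact mul_le_of_le_one_left' (v.map_const_le_one ι c)

lemma val_X_apply_of_one_lt (hφ : IsDrinfeldAction ι T s φ) (hq : 3 ≤ Fintype.card Fq)
    (hs : 1 ≤ s) (v : Valuation L Γ₀) (hT : 1 ≤ v T) {x : L} (hx : 1 < v x ∨ 1 < v T ∧ 1 ≤ v x) :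
    v x < v (φ X x) := by
  have hx1 : 1 ≤ v x := hx.elim le_of_lt And.right
  have hT0 : 0 < v T := zero_lt_one.trans_le hT
  have hx0 : 0 < v x := zero_lt_one.trans_le hx1
  have hN : 1 < Fintype.card Fq ^ s := Nat.one_lt_pow (by omega) (by omega)
  have hM : Fintype.card Fq ^ s < Fintype.card Fq ^ (s + 1) :=
    Nat.pow_lt_pow_right (by omega) (by omega)
  set q := Fintype.card Fq
  have hA : v T ≤ v T ^ (q - 1) := le_self_pow₀ hT (by omega)
  have hB : v x ≤ v x ^ q ^ (s + 1) := le_self_pow₀ hx1 (by omega)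
  have h1 : v (T * x) < v (T ^ (q - 1) * x ^ q ^ (s + 1)) := by
    simp only [map_mul, map_pow]
    rcases hx with hx | ⟨hT, -⟩
    · have : v x < v x ^ q ^ (s + 1) := lt_self_pow₀ hx (by omega)
      exact (mul_lt_mul_of_pos_left this hT0).trans_le (mul_le_mul_left hA _)
    · have : v T < v T ^ (q - 1) := lt_self_pow₀ hT (by omega)
      exact (mul_lt_mul_of_pos_right this hx0).trans_le (mul_le_mul_right hB _)
  have h2 : v (x ^ q ^ s) < v (T ^ (q - 1) * x ^ q ^ (s + 1)) := by
    simp only [map_mul, map_pow]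
    rcases hx with hx | ⟨hT, -⟩
    · calc v x ^ q ^ s < v x ^ q ^ (s + 1) := pow_lt_pow_right₀ hx hM
        _ ≤ _ := le_mul_of_one_le_left' (one_le_pow₀ ‹_›)
    · have : 1 < v T ^ (q - 1) := one_lt_pow₀ hT (by omega)
      calc v x ^ q ^ s ≤ v x ^ q ^ (s + 1) := pow_le_pow_right₀ hx1 hM.le
        _ < _ := lt_mul_of_one_lt_left (pow_pos hx0 _) this
  have h3 : v x ≤ v (T * x) := by
    rw [map_mul]; exact le_mul_of_one_le_left' hT
  rw [hφ.X_apply, v.map_add_eq_of_lt_right (v.map_add_lt h1 h2)]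
  exact h3.trans_lt h1

lemma val_le_one (hφ : IsDrinfeldAction ι T s φ) (hV : IsTorsionSubmodule φ l V)
    (hq : 3 ≤ Fintype.card Fq) (hs : 1 ≤ s) (v : Valuation L Γ₀) (hT : 1 ≤ v T)
    {x : L} (hx : x ∈ V) : v x ≤ 1 := by
  by_contra! h
  have := (V.filter (1 < v ·)).eq_empty_of_forall_lt (φ X) v (fun y hy ↦ by
    rw [Finset.mem_filter] at hy ⊢
    have := hφ.val_X_apply_of_one_lt hq hs v hT (.inl hy.2)
    exact ⟨⟨hV.apply_mem _ _ hy.1, hy.2.trans this⟩, this⟩)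
  exact Finset.notMem_empty x (this ▸ Finset.mem_filter.2 ⟨hx, h⟩)

lemma val_lt_one (hφ : IsDrinfeldAction ι T s φ) (hV : IsTorsionSubmodule φ l V)
    (hq : 3 ≤ Fintype.card Fq) (hs : 1 ≤ s) (v : Valuation L Γ₀) (hT : 1 < v T)
    {x : L} (hx : x ∈ V) : v x < 1 := by
  by_contra! h
  have := (V.filter (1 ≤ v ·)).eq_empty_of_forall_lt (φ X) v (fun y hy ↦ by
    rw [Finset.mem_filter] at hy ⊢
    have := hφ.val_X_apply_of_one_lt hq hs v hT.le (.inr ⟨hT, hy.2⟩)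
    exact ⟨⟨hV.apply_mem _ _ hy.1, hy.2.trans this.le⟩, this⟩)
  exact Finset.notMem_empty x (this ▸ Finset.mem_filter.2 ⟨hx, h⟩)

lemma val_apply_le_one (hφ : IsDrinfeldAction ι T s φ) (v : Valuation L Γ₀) (hT : v T ≤ 1)
    (a : Fq[X]) {x : L} (hx : v x ≤ 1) : v (φ a x) ≤ 1 := by
  have hX : ∀ y, v y ≤ 1 → v (φ X y) ≤ 1 := fun y hy ↦ by
    rw [hφ.X_apply]
    refine v.map_add_le (v.map_add_le ?_ ?_) ?_ <;> simp only [map_mul, map_pow]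
    · exact mul_le_one' hT hy
    · exact pow_le_one' hy _
    · exact mul_le_one' (pow_le_one' hT _) (pow_le_one' hy _)
  induction a using Polynomial.induction_on' with
  | add p q hp hq => rw [AddMonoid.End.map_add_apply]; exact v.map_add_le hp hq
  | monomial n c =>
    rw [← C_mul_X_pow_eq_monomial, AddMonoid.End.map_mul_apply]
    refine (hφ.val_C_apply_le v c _).trans ?_
    induction n with
    | zero => simpa
    | succ n ih => rw [pow_succ', AddMonoid.End.map_mul_apply]; exact hX _ ih

lemma one_le_val (hφ : IsDrinfeldAction ι T s φ) (hV : IsTorsionSubmodule φ l V)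
    (hl : IsCoprime X l) (hq : 3 ≤ Fintype.card Fq) (hs : 1 ≤ s) (v : Valuation L Γ₀)
    (hT : v T < 1) {x : L} (hx : x ∈ V) (hx0 : x ≠ 0) : 1 ≤ v x := by
  classical
  by_contra! h
  have := (V.filter (fun y ↦ y ≠ 0 ∧ v y < 1)).eq_empty_of_forall_lt (φ X)
      (fun y ↦ OrderDual.toDual (v y)) (fun y hy ↦ by
    rw [Finset.mem_filter] at hy ⊢
    obtain ⟨hyV, hy0, hy1⟩ := hy
    have hvy : 0 < v y := by simpa [zero_lt_iff] using hy0
    have hN : 1 < Fintype.card Fq ^ s := Nat.one_lt_pow (by omega) (by omega)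
    have hM : 1 < Fintype.card Fq ^ (s + 1) := Nat.one_lt_pow (by omega) (by omega)
    have hlt : v (φ X y) < v y := by
      rw [hφ.X_apply]
      refine v.map_add_lt (v.map_add_lt ?_ ?_) ?_ <;> simp only [map_mul, map_pow]
      · exact mul_lt_of_lt_one_left hvy hT
      · exact pow_lt_self_of_lt_one₀ hvy hy1 hN
      · exact (mul_le_of_le_one_left' (pow_le_one' hT.le _)).trans_lt
          (pow_lt_self_of_lt_one₀ hvy hy1 hM)
    exact ⟨⟨hV.apply_mem _ _ hyV, fun h0 ↦ hy0 (hV.eq_zero_of_isCoprime hl hyV h0),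
      hlt.trans hy1⟩, hlt⟩)
  exact Finset.notMem_empty x (this ▸ Finset.mem_filter.2 ⟨hx, hx0, h⟩)

/-- Above the break `v x ^ q ^ s * v T = 1` the last term of `φ_X` dominates. -/
lemma val_pow_mul_le_one (hφ : IsDrinfeldAction ι T s φ) (hV : IsTorsionSubmodule φ l V)
    (hq : 3 ≤ Fintype.card Fq) (v : Valuation L Γ₀) (hT : v T < 1)
    {x : L} (hx : x ∈ V) : v x ^ Fintype.card Fq ^ s * v T ≤ 1 := by
  by_contra! h
  have := (V.filter (1 < v · ^ Fintype.card Fq ^ s * v T)).eq_empty_of_forall_lt (φ X) v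
      (fun y hy ↦ by
    rw [Finset.mem_filter] at hy ⊢
    obtain ⟨hyV, hy⟩ := hy
    have hy1 : 1 < v y := by
      by_contra! h1
      exact (mul_le_one' (pow_le_one' h1 _) hT.le).not_gt hy
    have hy0 : 0 < v y := zero_lt_one.trans hy1
    set q := Fintype.card Fq
    have hN : q ^ s ≠ 0 := (pow_pos (by omega) _).ne'
    have h3 : v (T ^ (q - 1) * y ^ q ^ (s + 1)) = (v y ^ q ^ s * v T) ^ (q - 1) * v y ^ q ^ s :=
      v.map_pow_mul_pow_pow_succ (by omega) T y s
    have hyN : v y ≤ v y ^ q ^ s := le_self_pow₀ hy1.le hN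
    have h2 : v y ^ q ^ s < v (T ^ (q - 1) * y ^ q ^ (s + 1)) := by
      rw [h3]
      exact lt_mul_of_one_lt_left (pow_pos hy0 _) (one_lt_pow₀ hy (by omega))
    have h1 : v (T * y) < v (T ^ (q - 1) * y ^ q ^ (s + 1)) := by
      rw [map_mul]
      exact ((mul_lt_of_lt_one_left hy0 hT).trans_le hyN).trans h2
    have hlt : v y < v (φ X y) := by
      rw [hφ.X_apply, v.map_add_eq_of_lt_right (v.map_add_lt h1 (by rwa [map_pow]))]
      exact hyN.trans_lt h2
    exact ⟨⟨hV.apply_mem _ _ hyV, hy.trans_le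
      (mul_le_mul_left (pow_le_pow_left₀ zero_le hlt.le _) _)⟩, hlt⟩)
  exact Finset.notMem_empty x (this ▸ Finset.mem_filter.2 ⟨hx, h⟩)

lemma val_X_apply_of_lt (hφ : IsDrinfeldAction ι T s φ)
    (hq : 3 ≤ Fintype.card Fq) (v : Valuation L Γ₀) (hT : v T < 1)
    {x : L} (hx : 1 < v x) (h : v x ^ Fintype.card Fq ^ s * v T < 1) :
    v (φ X x) = v x ^ Fintype.card Fq ^ s := by
  have hx0 : 0 < v x := zero_lt_one.trans hx
  rw [hφ.X_apply]
  set q := Fintype.card Fq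
  have hN : q ^ s ≠ 0 := (pow_pos (by omega) _).ne'
  have h1 : v (T * x) < v (x ^ q ^ s) := by
    rw [map_mul, map_pow]
    exact (mul_lt_of_lt_one_left hx0 hT).trans_le (le_self_pow₀ hx.le hN)
  have h3 : v (T ^ (q - 1) * x ^ q ^ (s + 1)) < v (x ^ q ^ s) := by
    have : v (T ^ (q - 1) * x ^ q ^ (s + 1)) = (v x ^ q ^ s * v T) ^ (q - 1) * v x ^ q ^ s :=
      v.map_pow_mul_pow_pow_succ (by omega) T x s
    rw [this, map_pow]
    exact mul_lt_of_lt_one_left (pow_pos hx0 _) (pow_lt_one₀ zero_le h (by omega))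
  rw [v.map_add_eq_of_lt_left, v.map_add_eq_of_lt_right h1, map_pow]
  rwa [v.map_add_eq_of_lt_right h1]

lemma exists_level (hφ : IsDrinfeldAction ι T s φ) (hV : IsTorsionSubmodule φ l V)
    (hq : 3 ≤ Fintype.card Fq) (hs : 1 ≤ s) (v : Valuation L Γ₀) (hT : v T < 1)
    {x : L} (hx : x ∈ V) (hx1 : 1 < v x) :
    ∃ k, v x ^ (Fintype.card Fq ^ s) ^ (k + 1) * v T = 1 := by
  classical
  by_contra! h
  have hN : 1 < Fintype.card Fq ^ s := Nat.one_lt_pow (by omega) (by omega)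
  have := (V.filter (fun x ↦ 1 < v x ∧
      ∀ k, v x ^ (Fintype.card Fq ^ s) ^ (k + 1) * v T ≠ 1)).eq_empty_of_forall_lt (φ X) v
      (fun y hy ↦ by
    rw [Finset.mem_filter] at hy ⊢
    obtain ⟨hyV, hy1, hy⟩ := hy
    have h0 := hφ.val_X_apply_of_lt hq v hT hy1
      (lt_of_le_of_ne (hφ.val_pow_mul_le_one hV hq v hT hyV) (by simpa using hy 0))
    rw [h0]
    have hlt : v y < v y ^ Fintype.card Fq ^ s := lt_self_pow₀ hy1 hN
    refine ⟨⟨hV.apply_mem _ _ hyV, hy1.trans hlt, fun k ↦ ?_⟩, hlt⟩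
    rw [← pow_mul, ← pow_succ']
    exact hy (k + 1))
  exact Finset.notMem_empty x (this ▸ Finset.mem_filter.2 ⟨hx, hx1, h⟩)

lemma sub_pow_card_pow (ι : Fq →+* L) (x y : L) (n : ℕ) :
    (x - y) ^ Fintype.card Fq ^ n = x ^ Fintype.card Fq ^ n - y ^ Fintype.card Fq ^ n := by
  obtain ⟨p, hp⟩ := CharP.exists Fq
  obtain ⟨m, hpp, hm⟩ := FiniteField.card Fq p
  have : CharP L p := charP_of_injective_ringHom ι.injective p
  have : Fact p.Prime := ⟨hpp⟩
  rw [hm, ← pow_mul]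
  exact sub_pow_expChar_pow x y _

lemma prod_sub_const (ι : Fq →+* L) (z : L) :
    ∏ c, (z - ι c) = z ^ Fintype.card Fq - z := by
  have hq : 1 < Fintype.card Fq := Fintype.one_lt_card
  have h := prod_multiset_X_sub_C_of_monic_of_roots_card_eq
    (p := (X ^ Fintype.card Fq - X : Fq[X]))
    (monic_X_pow_sub (by rw [degree_X]; exact_mod_cast hq))
    (by rw [FiniteField.roots_X_pow_card_sub_X, FiniteField.X_pow_card_sub_X_natDegree_eq _ hq]
        rfl)
  rw [FiniteField.roots_X_pow_card_sub_X] at h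
  have h2 := congrArg (eval₂ ι z) (show ∏ c : Fq, (X - C c) = _ from h)
  simpa [eval₂_finsetProd] using h2

lemma exists_val_sub_lt_of_val_pow_mul_eq_one (hφ : IsDrinfeldAction ι T s φ)
    (hV : IsTorsionSubmodule φ l V) (hq : 3 ≤ Fintype.card Fq) (hs : 1 ≤ s)
    (v : Valuation L Γ₀) (hT : v T < 1) {x y : L} (hx : x ∈ V) (hy : y ∈ V)
    (hx1 : v x ^ Fintype.card Fq ^ s * v T = 1) (hy1 : v y ^ Fintype.card Fq ^ s * v T = 1) :
    ∃ c, v (x - φ (C c) y) < v y := by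
  have hN : 1 < Fintype.card Fq ^ s := Nat.one_lt_pow (by omega) (by omega)
  have hT0 : v T ≠ 0 := fun h ↦ by simp [h] at hx1
  set q := Fintype.card Fq with hqdef
  have key : ∀ z ∈ V, v z ^ q ^ s * v T = 1 → v (1 + (T * z ^ q ^ s) ^ (q - 1)) < 1 := by
    intro z hz hz1
    have hzN : 1 < v z ^ q ^ s := by
      rw [← hz1]
      exact mul_lt_of_lt_one_right (zero_lt_iff.2 fun h ↦ by simp [h] at hz1) hT
    have hz2 : 1 < v z := by
      by_contra! h
      exact (pow_le_one' h _).not_gt hzN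
    have hlt : v z < v z ^ q ^ s := lt_self_pow₀ hz2 hN
    have h1 : v (φ X z) ≤ v z := by
      have := hφ.val_pow_mul_le_one hV hq v hT (hV.apply_mem X z hz)
      rw [← hqdef, ← hz1] at this
      exact (pow_le_pow_iff_left₀ zero_le zero_le (by omega)).1
        ((mul_le_mul_iff_left₀ (zero_lt_iff.2 hT0)).1 this)
    have h2 : v (T * z) < v z := by
      rw [map_mul]
      exact mul_lt_of_lt_one_left (zero_lt_one.trans hz2) hT
    have h3 : φ X z - T * z = z ^ q ^ s * (1 + (T * z ^ q ^ s) ^ (q - 1)) := by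
      obtain ⟨k, hk⟩ : ∃ k, q = k + 1 := ⟨q - 1, by omega⟩
      rw [hφ.X_apply, ← hqdef, pow_succ q s, pow_mul z]
      generalize z ^ q ^ s = u
      rw [hk, Nat.add_sub_cancel]
      ring
    have h4 : v (φ X z - T * z) < v z ^ q ^ s :=
      v.map_sub_lt (h1.trans_lt hlt) (h2.trans hlt)
    rw [h3, map_mul, map_pow] at h4
    by_contra! h5
    exact (le_mul_of_one_le_right' h5).not_gt h4
  have hy0 : y ≠ 0 := by
    rintro rfl
    rw [map_zero, zero_pow (by omega), zero_mul] at hy1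
    exact zero_ne_one hy1
  have hT0' : T ≠ 0 := by rintro rfl; simp at hT0
  set a := T * x ^ q ^ s with ha
  set b := T * y ^ q ^ s with hb
  have hva : v a = 1 := by rw [ha, map_mul, map_pow, mul_comm, hx1]
  have hvb : v b = 1 := by rw [hb, map_mul, map_pow, mul_comm, hy1]
  have hb0 : b ≠ 0 := mul_ne_zero hT0' (pow_ne_zero _ hy0)
  have hab : v (a ^ (q - 1) - b ^ (q - 1)) < 1 := by
    have := v.map_sub_lt (key x hx hx1) (key y hy hy1)
    rwa [add_sub_add_left_eq_sub] at this
  have hz : v ((a / b) ^ q - a / b) < 1 := by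
    have : (a / b) ^ q - a / b = a / b * ((a ^ (q - 1) - b ^ (q - 1)) / b ^ (q - 1)) := by
      obtain ⟨k, hk⟩ : ∃ k, q = k + 1 := ⟨q - 1, by omega⟩
      rw [hk, Nat.add_sub_cancel, sub_div, ← div_pow, div_self (pow_ne_zero _ hb0)]
      ring
    rw [this]
    simpa [hva, hvb] using hab
  rw [← prod_sub_const ι, map_prod] at hz
  obtain ⟨c, hc⟩ : ∃ c, v (a / b - ι c) < 1 := by
    by_contra! h
    exact (Finset.one_le_prod' fun c _ ↦ h c).not_gt hz
  refine ⟨c, ?_⟩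
  have hdiv : a / b - ι c = ((x - φ (C c) y) / y) ^ q ^ s := by
    rw [div_pow, hφ.C_apply, sub_pow_card_pow ι, mul_pow, ← map_pow, FiniteField.pow_card_pow,
      ha, hb, ← hqdef]
    field_simp
  rw [hdiv, map_pow, map_div₀] at hc
  have hlt : v (x - φ (C c) y) / v y < 1 := by
    by_contra! h
    exact (one_le_pow₀ h).not_gt hc
  rwa [div_lt_one₀ (zero_lt_iff.2 ((v.ne_zero_iff).2 hy0))] at hlt

lemma exists_val_sub_lt (hφ : IsDrinfeldAction ι T s φ)
    (hV : IsTorsionSubmodule φ l V) (hq : 3 ≤ Fintype.card Fq) (hs : 1 ≤ s)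
    (v : Valuation L Γ₀) (hT : v T < 1) (k : ℕ) {x y : L} (hx : x ∈ V) (hy : y ∈ V)
    (hx1 : v x ^ (Fintype.card Fq ^ s) ^ (k + 1) * v T = 1)
    (hy1 : v y ^ (Fintype.card Fq ^ s) ^ (k + 1) * v T = 1) :
    ∃ c, v (x - φ (C c) y) < v y := by
  induction k generalizing x y with
  | zero =>
    exact hφ.exists_val_sub_lt_of_val_pow_mul_eq_one hV hq hs v hT hx hy (by simpa using hx1)
      (by simpa using hy1)
  | succ k ih =>
    have hN : 1 < Fintype.card Fq ^ s := Nat.one_lt_pow (by omega) (by omega)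
    have hT0 : v T ≠ 0 := fun h ↦ by simp [h] at hx1
    set N := Fintype.card Fq ^ s with hNdef
    have hN1 : 1 < N ^ (k + 1) := Nat.one_lt_pow (by omega) hN
    have hvxy : v x = v y := by
      refine (pow_left_inj₀ zero_le zero_le (n := N ^ (k + 1 + 1)) (by positivity)).1 ?_
      exact mul_right_cancel₀ hT0 (hx1.trans hy1.symm)
    have hy2 : 1 < v y := by
      by_contra! h
      have h1 := mul_lt_mul_of_lt_of_le_of_nonneg_of_pos hT
        (pow_le_one' h (N ^ (k + 1 + 1))) zero_le zero_lt_one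
      rw [mul_comm, hy1, mul_one] at h1
      exact h1.false
    have hstep : ∀ z ∈ V, v z = v y → v (φ X z) = v y ^ N := fun z hz hzy ↦ by
      rw [hφ.val_X_apply_of_lt hq v hT (hzy ▸ hy2), hzy]
      rw [hzy, ← hy1]
      refine (mul_lt_mul_iff_left₀ (zero_lt_iff.2 hT0)).2 (pow_lt_pow_right₀ hy2 ?_)
      rw [pow_succ]
      exact lt_mul_of_one_lt_left (by omega) hN1
    have hXx := hstep x hx hvxy
    have hXy := hstep y hy rfl
    have hlev : (v y ^ N) ^ N ^ (k + 1) * v T = 1 := by rwa [← pow_mul, ← pow_succ']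
    obtain ⟨c, hc⟩ := ih (hV.apply_mem X x hx) (hV.apply_mem X y hy) (by rwa [hXx])
      (by rwa [hXy])
    refine ⟨c, lt_of_le_of_ne ?_ fun h ↦ ?_⟩
    · exact (v.map_sub _ _).trans (max_le hvxy.le (hφ.val_C_apply_le v c y))
    · have h1 := hstep _ (hV.sub_mem hx (hV.apply_mem (C c) y hy)) h
      rw [map_sub, ← AddMonoid.End.map_mul_apply, mul_comm, AddMonoid.End.map_mul_apply] at h1
      exact (hc.trans_eq hXy).ne h1

lemma val_X_pow_apply (hφ : IsDrinfeldAction ι T s φ)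
    (hq : 3 ≤ Fintype.card Fq) (hs : 1 ≤ s) (v : Valuation L Γ₀) (hT : v T < 1) {k : ℕ} {x : L}
    (hx : 1 < v x) (hk : v x ^ (Fintype.card Fq ^ s) ^ k * v T = 1) {j : ℕ} (hj : j < k) :
    v (φ (X ^ j) x) = v x ^ (Fintype.card Fq ^ s) ^ j := by
  have hN : 1 < Fintype.card Fq ^ s := Nat.one_lt_pow (by omega) (by omega)
  have hT0 : v T ≠ 0 := fun h ↦ by simp [h] at hk
  induction j with
  | zero => simp
  | succ j ih =>
    have h := ih (by omega)
    rw [pow_succ', AddMonoid.End.map_mul_apply, hφ.val_X_apply_of_lt hq v hT, h, ← pow_mul,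
      ← pow_succ]
    · rw [h]
      exact one_lt_pow₀ hx (by positivity)
    · rw [h, ← pow_mul, ← pow_succ, ← hk]
      exact (mul_lt_mul_iff_left₀ (zero_lt_iff.2 hT0)).2
        (pow_lt_pow_right₀ hx (Nat.pow_lt_pow_right hN hj))

lemma val_apply (hφ : IsDrinfeldAction ι T s φ)
    (hq : 3 ≤ Fintype.card Fq) (hs : 1 ≤ s) (v : Valuation L Γ₀) (hT : v T < 1) {k : ℕ} {x : L}
    (hx : 1 < v x) (hk : v x ^ (Fintype.card Fq ^ s) ^ k * v T = 1) {b : Fq[X]} (hb0 : b ≠ 0)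
    (hb : b.natDegree < k) :
    v (φ b x) = v x ^ (Fintype.card Fq ^ s) ^ b.natDegree := by
  have hN : 1 < Fintype.card Fq ^ s := Nat.one_lt_pow (by omega) (by omega)
  induction hn : b.natDegree using Nat.strong_induction_on generalizing b with
  | _ n ih =>
    subst hn
    have hlead : v (φ (C b.leadingCoeff * X ^ b.natDegree) x) =
        v x ^ (Fintype.card Fq ^ s) ^ b.natDegree := by
      rw [AddMonoid.End.map_mul_apply, hφ.val_C_apply v (by simpa using hb0),
        hφ.val_X_pow_apply hq hs v hT hx hk hb]
    have hlt : v (φ b.eraseLead x) < v x ^ (Fintype.card Fq ^ s) ^ b.natDegree := by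
      rcases b.eraseLead_natDegree_lt_or_eraseLead_eq_zero with h | h
      · by_cases h0 : b.eraseLead = 0
        · rw [h0, map_zero]
          simpa using pow_pos (zero_lt_one.trans hx) _
        · rw [ih _ h h0 (h.trans hb) rfl]
          exact pow_lt_pow_right₀ hx (Nat.pow_lt_pow_right hN h)
      · rw [h, map_zero]
        simpa using pow_pos (zero_lt_one.trans hx) _
    rw [← hlead] at hlt ⊢
    nth_rw 1 [← b.eraseLead_add_C_mul_X_pow]
    rw [AddMonoid.End.map_add_apply, v.map_add_eq_of_lt_right hlt]

lemma exists_val_sub_apply_le_one (hφ : IsDrinfeldAction ι T s φ)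
    (hV : IsTorsionSubmodule φ l V) (hq : 3 ≤ Fintype.card Fq) (hs : 1 ≤ s)
    (v : Valuation L Γ₀) (hT : v T < 1) {k : ℕ} {x : L} (hxV : x ∈ V)
    (hx : 1 < v x) (hk : v x ^ (Fintype.card Fq ^ s) ^ k * v T = 1)
    (hmin : ∀ y ∈ V, 1 < v y → v x ≤ v y) {j : ℕ} (hj : j ≤ k) {z : L} (hz : z ∈ V)
    (hzj : v z < v x ^ (Fintype.card Fq ^ s) ^ j) :
    ∃ b : Fq[X], b.degree < j ∧ v (z - φ b x) ≤ 1 := by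
  have hN : 1 < Fintype.card Fq ^ s := Nat.one_lt_pow (by omega) (by omega)
  have hT0 : v T ≠ 0 := fun h ↦ by simp [h] at hk
  by_cases hz1 : v z ≤ 1
  · exact ⟨0, by simp, by simpa using hz1⟩
  rw [not_le] at hz1
  induction j generalizing z with
  | zero => exact absurd (hmin z hz hz1) (by simpa using hzj)
  | succ j ih =>
    by_cases hzj' : v z < v x ^ (Fintype.card Fq ^ s) ^ j
    · obtain ⟨b, hb, h⟩ := ih (by omega) hz hzj' hz1
      exact ⟨b, hb.trans (by exact_mod_cast j.lt_succ_self), h⟩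
    obtain ⟨i, hi⟩ := hφ.exists_level hV hq hs v hT hz hz1
    have hpow : v z ^ (Fintype.card Fq ^ s) ^ (i + 1) = v x ^ (Fintype.card Fq ^ s) ^ k :=
      mul_right_cancel₀ hT0 (hi.trans hk.symm)
    set N := Fintype.card Fq ^ s
    have hik : i + 1 ≤ k := by
      by_contra! h
      have h1 : v x ^ N ^ k < v x ^ N ^ (i + 1) :=
        pow_lt_pow_right₀ hx (Nat.pow_lt_pow_right hN h)
      exact (h1.trans_le (pow_le_pow_left₀ zero_le (hmin z hz hz1) _)).ne hpow.symm
    have hvz : v z = v x ^ N ^ (k - (i + 1)) := by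
      refine (pow_left_inj₀ zero_le zero_le (n := N ^ (i + 1)) (by positivity)).1 ?_
      rw [hpow, ← pow_mul (v x), ← pow_add N, Nat.sub_add_cancel hik]
    have hlt : k - (i + 1) < j + 1 := by
      rw [hvz, pow_lt_pow_iff_right₀ hx, Nat.pow_lt_pow_iff_right hN] at hzj
      exact hzj
    have hge : j ≤ k - (i + 1) := by
      rw [hvz, pow_lt_pow_iff_right₀ hx, Nat.pow_lt_pow_iff_right hN] at hzj'
      omega
    have hji : k - (i + 1) = j := by omega
    have hXj : v (φ (X ^ j) x) = v z := by
      rw [hvz, hji]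
      exact hφ.val_X_pow_apply hq hs v hT hx hk hj
    have hXV := hV.apply_mem (X ^ j) x hxV
    obtain ⟨c, hc⟩ := hφ.exists_val_sub_lt hV hq hs v hT i hz hXV hi (by rwa [hXj])
    rw [hXj, hvz, hji, ← AddMonoid.End.map_mul_apply] at hc
    have hcd : (C c * X ^ j : Fq[X]).degree < ((j + 1 : ℕ) : WithBot ℕ) :=
      (degree_C_mul_X_pow_le j c).trans_lt (by exact_mod_cast j.lt_succ_self)
    by_cases hw : v (z - φ (C c * X ^ j) x) ≤ 1
    · exact ⟨_, hcd, hw⟩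
    · obtain ⟨b, hb, h⟩ := ih (by omega) (hV.sub_mem hz (hV.apply_mem _ x hxV)) hc
        (not_le.1 hw)
      refine ⟨C c * X ^ j + b, (degree_add_le _ _).trans_lt (max_lt hcd
        (hb.trans (by exact_mod_cast j.lt_succ_self))), ?_⟩
      rwa [AddMonoid.End.map_add_apply, ← sub_sub]

lemma exists_val_sub_apply_le_one_of_mem (hφ : IsDrinfeldAction ι T s φ)
    (hV : IsTorsionSubmodule φ l V) (hq : 3 ≤ Fintype.card Fq) (hs : 1 ≤ s)
    (v : Valuation L Γ₀) (hT : v T < 1) {k : ℕ} {x : L} (hxV : x ∈ V)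
    (hx : 1 < v x) (hk : v x ^ (Fintype.card Fq ^ s) ^ k * v T = 1)
    (hmin : ∀ y ∈ V, 1 < v y → v x ≤ v y) {z : L} (hz : z ∈ V) :
    ∃ b : Fq[X], b.degree < k ∧ v (z - φ b x) ≤ 1 := by
  by_cases hz1 : v z ≤ 1
  · exact ⟨0, by simp, by simpa using hz1⟩
  rw [not_le] at hz1
  have hN : 1 < Fintype.card Fq ^ s := Nat.one_lt_pow (by omega) (by omega)
  have hT0 : v T ≠ 0 := fun h ↦ by simp [h] at hk
  refine hφ.exists_val_sub_apply_le_one hV hq hs v hT hxV hx hk hmin le_rfl hz ?_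
  have h := hφ.val_pow_mul_le_one hV hq v hT hz
  rw [← hk] at h
  exact (lt_self_pow₀ hz1 hN).trans_le ((mul_le_mul_iff_left₀ (zero_lt_iff.2 hT0)).1 h)

lemma natDegree_le_level (hφ : IsDrinfeldAction ι T s φ)
    (hV : IsTorsionSubmodule φ l V) (hl : Irreducible l) (hq : 3 ≤ Fintype.card Fq) (hs : 1 ≤ s)
    (v : Valuation L Γ₀) (hT : v T < 1) {k : ℕ} {x : L} (hxV : x ∈ V)
    (hx : 1 < v x) (hk : v x ^ (Fintype.card Fq ^ s) ^ k * v T = 1)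
    (hmin : ∀ y ∈ V, 1 < v y → v x ≤ v y) : l.natDegree ≤ k := by
  by_contra! hlt
  obtain ⟨b, hb, h⟩ := hφ.exists_val_sub_apply_le_one_of_mem hV hq hs v hT hxV hx hk hmin
    (hV.apply_mem (X ^ k) x hxV)
  have hmonic : (X ^ k - b).Monic := monic_X_pow_sub hb
  have hdeg : (X ^ k - b).natDegree = k := by
    rw [natDegree_sub_eq_left_of_natDegree_lt, natDegree_X_pow]
    rw [natDegree_X_pow]
    by_cases hb0 : b = 0
    · subst hb0
      have : k ≠ 0 := by
        rintro rfl
        rw [pow_zero, pow_one] at hk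
        rw [pow_zero, map_one, map_zero] at h
        replace h : v (x - 0) ≤ 1 := h
        rw [sub_zero] at h
        exact h.not_gt hx
      simpa using Nat.pos_of_ne_zero this
    · exact (natDegree_lt_iff_degree_lt hb0).2 hb
  have hcop : IsCoprime l (X ^ k - b) := by
    rw [hl.coprime_iff_not_dvd]
    exact fun hd ↦ (natDegree_le_of_dvd hd hmonic.ne_zero).not_gt (by rwa [hdeg])
  obtain ⟨u, w, huw⟩ := hcop
  have h1 : φ (u * l + w * (X ^ k - b)) x = x := by rw [huw, map_one]; rfl
  have hsub : φ (X ^ k - b) x = φ (X ^ k) x - φ b x := by rw [map_sub]; rfl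
  rw [AddMonoid.End.map_add_apply, AddMonoid.End.map_mul_apply, AddMonoid.End.map_mul_apply,
    hV.torsion x hxV, map_zero, zero_add] at h1
  rw [← hsub] at h
  have h2 := hφ.val_apply_le_one v hT.le w h
  rw [h1] at h2
  exact h2.not_gt hx

/-- The polynomials of degree less than `k` over a finite field. -/
def _root_.Polynomial.finsetDegreeLT (Fq : Type*) [Field Fq] [Fintype Fq] (k : ℕ) :
    Finset Fq[X] :=
  letI : Fintype (degreeLT Fq k) := Fintype.ofEquiv _ (degreeLTEquiv Fq k).symm.toEquiv
  Finset.univ.map (Function.Embedding.subtype (· ∈ degreeLT Fq k))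

lemma _root_.Polynomial.mem_finsetDegreeLT {k : ℕ} {b : Fq[X]} :
    b ∈ finsetDegreeLT Fq k ↔ b.degree < k := by
  simp [finsetDegreeLT, mem_degreeLT]

lemma _root_.Polynomial.card_finsetDegreeLT (k : ℕ) :
    (finsetDegreeLT Fq k).card = Fintype.card Fq ^ k := by
  let : Fintype (degreeLT Fq k) := Fintype.ofEquiv _ (degreeLTEquiv Fq k).symm.toEquiv
  rw [finsetDegreeLT, Finset.card_map, Finset.card_univ,
    Fintype.card_congr (degreeLTEquiv Fq k).toEquiv]
  simp

lemma _root_.Polynomial.exists_sum_pow_natDegree {k N : ℕ} (hk : 1 ≤ k)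
    (hN : Fintype.card Fq ∣ N) [DecidableEq Fq[X]] :
    ∃ M, ∑ b ∈ finsetDegreeLT Fq k, (if b = 0 then 0 else N ^ b.natDegree) + 1 =
      Fintype.card Fq * M := by
  classical
  rw [← Finset.sum_filter_add_sum_filter_not _ (fun b : Fq[X] ↦ b.natDegree = 0)]
  obtain ⟨M, hM⟩ : Fintype.card Fq ∣ ∑ b ∈ (finsetDegreeLT Fq k).filter (¬ ·.natDegree = 0),
      (if b = 0 then 0 else N ^ b.natDegree) := by
    refine Finset.dvd_sum fun b hb ↦ ?_
    split_ifs
    · exact dvd_zero _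
    · exact hN.trans (dvd_pow_self N (Finset.mem_filter.1 hb).2)
  have hC : (finsetDegreeLT Fq k).filter (·.natDegree = 0) =
      Finset.univ.map ⟨(C : Fq → Fq[X]), C_injective⟩ := by
    ext b
    simp only [Finset.mem_filter, mem_finsetDegreeLT, Finset.mem_map, Finset.mem_univ, true_and,
      Function.Embedding.coeFn_mk]
    refine ⟨fun h ↦ ⟨_, (eq_C_of_natDegree_eq_zero h.2).symm⟩, ?_⟩
    rintro ⟨c, rfl⟩
    exact ⟨degree_C_le.trans_lt (by exact_mod_cast hk), natDegree_C c⟩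
  have hcard : ∑ c : Fq, (if c = 0 then 0 else 1) + 1 = Fintype.card Fq := by
    have h := Finset.card_filter (fun c : Fq ↦ c ≠ 0) Finset.univ
    have h2 := Finset.card_erase_of_mem (Finset.mem_univ (0 : Fq))
    have h3 : 0 < Fintype.card Fq := Fintype.card_pos
    rw [Finset.filter_ne', h2, Finset.card_univ] at h
    simp only [ne_eq, ite_not] at h
    omega
  refine ⟨M + 1, ?_⟩
  rw [hM, hC, Finset.sum_map]
  simp only [Function.Embedding.coeFn_mk, C_eq_zero, natDegree_C, pow_zero]
  rw [mul_add, mul_one]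
  omega

/-- If the torsion submodule `V` is not integral at a place above `T` and the product of its
nonzero elements has integral valuation there, then `V` has full size. -/
theorem card_ge (hφ : IsDrinfeldAction ι T s φ)
    (hV : IsTorsionSubmodule φ l V) (hl : Irreducible l) (hlX : IsCoprime X l)
    (hq : 3 ≤ Fintype.card Fq) (hs : 1 ≤ s) (v : Valuation L Γ₀) (hT : v T < 1)
    (hbig : ∃ x ∈ V, 1 < v x) [DecidableEq L] {n : ℤ}
    (hn : v (∏ z ∈ V.erase 0, z) = v T ^ n) :
    Fintype.card Fq ^ ((s + 1) * l.natDegree) ≤ V.card := by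
  classical
  obtain ⟨x, hx, hmin⟩ := (V.filter (1 < v ·)).exists_min_image v
    (by obtain ⟨x, hx⟩ := hbig; exact ⟨x, Finset.mem_filter.2 hx⟩)
  rw [Finset.mem_filter] at hx
  obtain ⟨hxV, hx⟩ := hx
  replace hmin : ∀ y ∈ V, 1 < v y → v x ≤ v y := fun y h1 h2 ↦
    hmin y (Finset.mem_filter.2 ⟨h1, h2⟩)
  obtain ⟨k', hk⟩ := hφ.exists_level hV hq hs v hT hxV hx
  obtain ⟨k, hkk⟩ : ∃ k, k = k' + 1 := ⟨_, rfl⟩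
  rw [← hkk] at hk
  have hk1 : 1 ≤ k := by omega
  have hN : 1 < Fintype.card Fq ^ s := Nat.one_lt_pow (by omega) (by omega)
  have hT0 : v T ≠ 0 := fun h ↦ by simp [h] at hk
  have hdeg := hφ.natDegree_le_level hV hl hq hs v hT hxV hx hk hmin
  set q := Fintype.card Fq with hqdef
  set N := q ^ s with hNdef
  set B := finsetDegreeLT Fq k
  set S := V.filter (v · ≤ 1) with hS
  let e : Fq[X] → ℕ := fun b ↦ if b = 0 then 0 else N ^ b.natDegree
  have hnd {b : Fq[X]} (hb0 : b ≠ 0) (hb : b.degree < k) : b.natDegree < k :=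
    (natDegree_lt_iff_degree_lt hb0).2 hb
  have hval : ∀ b : Fq[X], b ≠ 0 → b.degree < k → ∀ y, v y ≤ 1 →
      v (φ b x + y) = v x ^ N ^ b.natDegree ∧ 1 < v x ^ N ^ b.natDegree := by
    intro b hb0 hb y hy
    have h1 := hφ.val_apply hq hs v hT hx hk hb0 (hnd hb0 hb)
    have h2 : 1 < v x ^ N ^ b.natDegree := one_lt_pow₀ hx (by positivity)
    rw [v.map_add_eq_of_lt_left (by rw [h1]; exact hy.trans_lt h2), h1]
    exact ⟨rfl, h2⟩
  have himg : V = (B ×ˢ S).image fun p ↦ φ p.1 x + p.2 := by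
    ext z
    simp only [Finset.mem_image, Finset.mem_product, Prod.exists, B, mem_finsetDegreeLT, hS,
      Finset.mem_filter]
    constructor
    · intro hz
      obtain ⟨b, hb, h⟩ := hφ.exists_val_sub_apply_le_one_of_mem hV hq hs v hT hxV hx hk hmin hz
      exact ⟨b, _, ⟨hb, hV.sub_mem hz (hV.apply_mem b x hxV), h⟩, by ring⟩
    · rintro ⟨b, y, ⟨-, hy, -⟩, rfl⟩
      exact hV.add_mem _ (hV.apply_mem b x hxV) _ hy
  have hinj : Set.InjOn (fun p : Fq[X] × L ↦ φ p.1 x + p.2) (B ×ˢ S : Finset _) := by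
    rintro ⟨b, y⟩ hby ⟨b', y'⟩ hby' h
    simp only [Finset.coe_product, Set.mem_prod, Finset.mem_coe, B, mem_finsetDegreeLT, hS,
      Finset.mem_filter] at hby hby' h
    have hbb : b = b' := by
      by_contra hne
      have h0 := sub_ne_zero.2 hne
      have h1 : φ (b - b') x + 0 = y' - y := by
        rw [map_sub, add_zero, eq_sub_iff_add_eq]
        change φ b x - φ b' x + y = y'
        rw [sub_add_eq_add_sub, h, add_sub_cancel_left]
      have h2 := hval _ h0 ((degree_sub_le _ _).trans_lt (max_lt hby.1 hby'.1)) 0 (by simp)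
      rw [h1] at h2
      exact ((v.map_sub _ _).trans (max_le hby'.2.2 hby.2.2)).not_gt (h2.2.trans_eq h2.1.symm)
    subst hbb
    rw [add_right_inj] at h
    rw [h]
  have hcard : V.card = q ^ k * S.card := by
    rw [himg, Finset.card_image_of_injOn hinj, Finset.card_product, card_finsetDegreeLT]
  have hprod : v (∏ z ∈ V.erase 0, z) = v x ^ (S.card * ∑ b ∈ B, e b) := by
    rw [map_prod]
    have h1 : ∏ z ∈ V.erase 0, v z = ∏ z ∈ V, if z = 0 then 1 else v z := by
      rw [← Finset.mul_prod_erase V _ hV.zero_mem, if_pos rfl, one_mul]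
      exact Finset.prod_congr rfl fun z hz ↦ (if_neg (Finset.ne_of_mem_erase hz)).symm
    rw [h1, himg, Finset.prod_image hinj]
    have h2 : ∀ p ∈ B ×ˢ S, (if φ p.1 x + p.2 = 0 then 1 else v (φ p.1 x + p.2)) =
        v x ^ e p.1 := by
      rintro ⟨b, y⟩ hby
      simp only [Finset.mem_product, B, mem_finsetDegreeLT, hS, Finset.mem_filter] at hby
      by_cases hb0 : b = 0
      · subst hb0
        simp only [map_zero, e, if_true, pow_zero]
        split_ifs with hy
        · rfl
        · have hy' : y ≠ 0 := fun h ↦ hy (by rw [h, add_zero]; rfl)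
          change v (0 + y) = 1
          rw [zero_add]
          exact le_antisymm hby.2.2 (hφ.one_le_val hV hlX hq hs v hT hby.2.1 hy')
      · obtain ⟨h3, h4⟩ := hval b hb0 hby.1 y hby.2.2
        have h0 : φ b x + y ≠ 0 := fun h ↦ by
          rw [h, map_zero] at h3
          exact (zero_lt_one.trans h4).ne h3
        simp only [e, if_neg h0, if_neg hb0, h3]
    rw [Finset.prod_congr rfl h2, Finset.prod_product_right]
    simp only [Finset.prod_pow_eq_pow_sum, Finset.sum_const, smul_eq_mul]
  have hdvd : N ^ k ∣ S.card * ∑ b ∈ B, e b := by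
    have hTx : v T = v x ^ (-(N ^ k : ℕ) : ℤ) := by
      rw [zpow_neg, zpow_natCast]
      exact eq_inv_of_mul_eq_one_right hk
    rw [hprod, hTx, ← zpow_mul, ← zpow_natCast] at hn
    have := zpow_right_injective₀ (zero_lt_one.trans hx) hx.ne' hn
    rw [← Int.natCast_dvd_natCast, this]
    exact (Int.dvd_neg.2 dvd_rfl).mul_right n
  have hcop : Nat.Coprime (N ^ k) (∑ b ∈ B, e b) := by
    obtain ⟨M, hM⟩ := exists_sum_pow_natDegree (Fq := Fq) (N := N) hk1 (dvd_pow_self q (by omega))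
    refine Nat.Coprime.pow_left _ (Nat.Coprime.pow_left _ ?_)
    refine Nat.Coprime.of_dvd_left (Dvd.intro M hM.symm) ?_
    simp [e, B]
  have hSpos : 0 < S.card := Finset.card_pos.2
    ⟨0, Finset.mem_filter.2 ⟨hV.zero_mem, by simp⟩⟩
  have hle := Nat.le_of_dvd hSpos (hcop.dvd_of_dvd_mul_right hdvd)
  calc q ^ ((s + 1) * l.natDegree) ≤ q ^ ((s + 1) * k) :=
        Nat.pow_le_pow_right (by omega) (Nat.mul_le_mul_left _ hdeg)
    _ = q ^ k * N ^ k := by rw [hNdef, ← pow_mul, ← pow_add]; congr 1; ring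
    _ ≤ V.card := hcard ▸ Nat.mul_le_mul_left _ hle

end IsDrinfeldAction

end Valuation

lemma exists_valuationSubring_of_injective {A L : Type*} [CommRing A] [Field L] (ψ : A →+* L)
    (hψ : Function.Injective ψ) {g : A} (hg : ¬ IsUnit g) :
    ∃ B : ValuationSubring L, (∀ a, B.valuation (ψ a) ≤ 1) ∧ B.valuation (ψ g) < 1 := by
  let e : A ≃+* ψ.range := RingEquiv.ofBijective ψ.rangeRestrict
    ⟨fun a b h ↦ hψ (congrArg Subtype.val h), ψ.rangeRestrict_surjective⟩
  have hI : Ideal.span {e g} ≠ ⊤ := by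
    rw [Ne, Ideal.span_singleton_eq_top, MulEquiv.isUnit_map e]
    exact hg
  obtain ⟨B, hB, hI⟩ := Ideal.image_subset_nonunits_valuationSubring _ hI
  refine ⟨B, fun a ↦ (B.valuation_le_one_iff _).2 (hB ⟨a, rfl⟩), ?_⟩
  rw [← B.mem_nonunits_iff]
  exact hI ⟨e g, Ideal.subset_span rfl, rfl⟩

section RationalFunctions

variable {Fq L Γ₀ : Type*} [Field Fq] [Fintype Fq] [Field L]
  [LinearOrderedCommGroupWithZero Γ₀]

lemma Valuation.map_eval₂_le_one (v : Valuation L Γ₀) (ι : Fq →+* L) {T : L} (hT : v T ≤ 1)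
    (p : Fq[X]) : v (eval₂ ι T p) ≤ 1 := by
  induction p using Polynomial.induction_on' with
  | add p q hp hq => rw [eval₂_add]; exact v.map_add_le hp hq
  | monomial n c =>
    rw [eval₂_monomial, map_mul, map_pow]
    exact mul_le_one' (v.map_const_le_one ι c) (pow_le_one' hT n)

lemma Valuation.exists_map_eval₂_eq_pow (v : Valuation L Γ₀) (ι : Fq →+* L) {T : L}
    (hT : v T < 1) {p : Fq[X]} (hp : p ≠ 0) : ∃ n : ℕ, v (eval₂ ι T p) = v T ^ n := by
  obtain ⟨g, hg, hdvd⟩ := p.exists_eq_pow_rootMultiplicity_mul_and_not_dvd hp 0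
  rw [map_zero, sub_zero] at hg hdvd
  refine ⟨p.rootMultiplicity 0, ?_⟩
  rw [X_dvd_iff] at hdvd
  have h1 : v (eval₂ ι T g) = 1 := by
    rw [← g.X_mul_divX_add, eval₂_add, eval₂_mul, eval₂_X, eval₂_C,
      v.map_add_eq_of_lt_right, v.map_const_eq_one ι hdvd]
    rw [v.map_const_eq_one ι hdvd, map_mul]
    exact (mul_le_of_le_one_right' (v.map_eval₂_le_one ι hT.le _)).trans_lt hT
  nth_rw 1 [hg]
  rw [eval₂_mul, eval₂_pow, eval₂_X, map_mul, map_pow, h1, mul_one]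

lemma Valuation.map_eval₂_of_one_lt (v : Valuation L Γ₀) (ι : Fq →+* L) {T : L}
    (hT : 1 < v T) {p : Fq[X]} (hp : p ≠ 0) : v (eval₂ ι T p) = v T ^ p.natDegree := by
  induction hn : p.natDegree using Nat.strong_induction_on generalizing p with
  | _ n ih =>
    subst hn
    have hpos := pow_pos (zero_lt_one.trans hT) p.natDegree
    have hlead : v (eval₂ ι T (C p.leadingCoeff * X ^ p.natDegree)) = v T ^ p.natDegree := by
      rw [eval₂_mul, eval₂_C, eval₂_X_pow, map_mul, map_pow,
        v.map_const_eq_one ι (by simpa using hp), one_mul]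
    have hlt : v (eval₂ ι T p.eraseLead) < v T ^ p.natDegree := by
      by_cases h0 : p.eraseLead = 0
      · rwa [h0, eval₂_zero, map_zero]
      · have h := p.eraseLead_natDegree_lt_or_eraseLead_eq_zero.resolve_right h0
        rw [ih _ h h0 rfl]
        exact pow_lt_pow_right₀ hT h
    rw [← hlead] at hlt ⊢
    nth_rw 1 [← p.eraseLead_add_C_mul_X_pow]
    rw [eval₂_add, v.map_add_eq_of_lt_right hlt]

lemma Polynomial.eval₂_inv_injective {K : Type*} [Field K] (ι : K →+* L) {T : L} (hT : T ≠ 0)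
    (h : Function.Injective (eval₂RingHom ι T)) :
    Function.Injective (eval₂RingHom ι T⁻¹) := by
  rw [injective_iff_map_eq_zero] at h ⊢
  intro p hp
  let _ : Invertible T⁻¹ := ⟨T, mul_inv_cancel₀ hT, inv_mul_cancel₀ hT⟩
  have h1 : eval₂ ι T p.reverse = 0 := (eval₂_reverse_eq_zero_iff ι T⁻¹ p).2 hp
  exact reverse_eq_zero.1 (h _ h1)

/-- The action of `a` is given by a polynomial over `F` of the expected degree, whose derivative
is the constant `a`. -/
lemma IsDrinfeldAction.exists_polynomial {F : Type*} [Field F] [Algebra F L] {ι : Fq →+* F}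
    {T : F} {s : ℕ} {φ : Fq[X] →+* AddMonoid.End L} (hs : 1 ≤ s)
    (hφ : IsDrinfeldAction ((algebraMap F L).comp ι) (algebraMap F L T) s φ) (a : Fq[X]) :
    ∃ f : F[X], (∀ x, φ a x = aeval x f) ∧ derivative f = C (eval₂ ι T a) ∧
      f.natDegree ≤ Fintype.card Fq ^ ((s + 1) * a.natDegree) := by
  set q := Fintype.card Fq with hq
  have hq1 : 1 < q := Fintype.one_lt_card
  have hqF : (q : F) = 0 := by
    rw [← map_natCast ι, FiniteField.cast_card_eq_zero, map_zero]
  have hX : ∃ g : F[X], (∀ x, φ X x = aeval x g) ∧ derivative g = C T ∧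
      g.natDegree ≤ q ^ (s + 1) := by
    refine ⟨C T * X + X ^ q ^ s + C (T ^ (q - 1)) * X ^ q ^ (s + 1), fun x ↦ ?_, ?_, ?_⟩
    · simp [hφ.X_apply, hq]
    · simp only [derivative_add, derivative_C_mul, derivative_X, derivative_X_pow, Nat.cast_pow,
        hqF, zero_pow (show s ≠ 0 by omega), zero_pow s.succ_ne_zero, C_0, zero_mul, mul_zero,
        mul_one, add_zero]
    · have h1 : 1 ≤ q ^ (s + 1) := Nat.one_le_pow _ _ (by omega)
      have h2 : q ^ s ≤ q ^ (s + 1) := Nat.pow_le_pow_right (by omega) (by omega)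
      compute_degree!
  obtain ⟨g, hg, hg', hgd⟩ := hX
  have main := induction_with_natDegree_le (R := Fq) (fun b ↦ ∃ f : F[X],
    (∀ x, φ b x = aeval x f) ∧ derivative f = C (eval₂ ι T b) ∧
      f.natDegree ≤ q ^ ((s + 1) * a.natDegree)) a.natDegree ?_ ?_ ?_ a le_rfl
  · exact main
  · exact ⟨0, fun x ↦ by rw [map_zero, map_zero]; rfl, by simp, by simp⟩
  · intro n c _ hn
    suffices ∃ f : F[X], (∀ x, φ (C c * X ^ n) x = aeval x f) ∧
        derivative f = C (eval₂ ι T (C c * X ^ n)) ∧ f.natDegree ≤ q ^ ((s + 1) * n) by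
      obtain ⟨f, h1, h2, h3⟩ := this
      exact ⟨f, h1, h2, h3.trans (Nat.pow_le_pow_right (by omega) (Nat.mul_le_mul_left _ hn))⟩
    clear hn
    induction n with
    | zero =>
      refine ⟨C (ι c) * X, fun x ↦ ?_, by simp, by
        simpa using (natDegree_C_mul_le _ _).trans natDegree_X_le⟩
      rw [pow_zero, mul_one, hφ.C_apply]
      simp
    | succ n ih =>
      obtain ⟨f, h1, h2, h3⟩ := ih
      refine ⟨f.comp g, fun x ↦ ?_, ?_, ?_⟩
      · rw [pow_succ, ← mul_assoc, AddMonoid.End.map_mul_apply, hg, h1, aeval_comp]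
      · rw [derivative_comp, hg', h2, C_comp, ← C_mul, pow_succ, ← mul_assoc, eval₂_mul_X,
          mul_comm]
      · calc _ ≤ f.natDegree * g.natDegree := natDegree_comp_le
          _ ≤ q ^ ((s + 1) * n) * q ^ (s + 1) := Nat.mul_le_mul h3 hgd
          _ = _ := by rw [← pow_add]; congr 1
  · rintro b b' - - ⟨f, h1, h2, h3⟩ ⟨f', h1', h2', h3'⟩
    refine ⟨f + f', fun x ↦ ?_, ?_, (natDegree_add_le _ _).trans (max_le h3 h3')⟩
    · rw [AddMonoid.End.map_add_apply, map_add, h1, h1']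
    · rw [derivative_add, h2, h2', ← C_add, eval₂_add]

lemma prod_erase_zero_mem_range {F : Type*} [Field F] [Algebra F L] [Normal F L]
    [DecidableEq L] {V : Finset L} (hsep : ∀ x ∈ V, IsSeparable F x)
    (hV : ∀ σ : L ≃ₐ[F] L, ∀ x ∈ V, σ x ∈ V) :
    ∃ c : F, algebraMap F L c = ∏ x ∈ V.erase 0, x := by
  set c := ∏ x ∈ V.erase 0, x with hc
  have hcsep : c ∈ separableClosure F L :=
    prod_mem fun x hx ↦ mem_separableClosure_iff.2 (hsep x (Finset.mem_of_mem_erase hx))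
  have hfix : ∀ σ : L ≃ₐ[F] L, σ c = c := fun σ ↦ by
    have himg : (V.erase 0).image σ = V.erase 0 := by
      refine Finset.eq_of_subset_of_card_le ?_ (Finset.card_image_of_injective _ σ.injective).ge
      intro y hy
      obtain ⟨x, hx, rfl⟩ := Finset.mem_image.1 hy
      rw [Finset.mem_erase] at hx ⊢
      exact ⟨by simpa using hx.1, hV σ x hx.2⟩
    rw [hc, map_prod]
    conv_rhs => rw [← himg]
    rw [Finset.prod_image σ.injective.injOn]
  by_contra hnot
  have hbot : c ∉ (⊥ : Subalgebra F L) := fun h ↦ hnot (Algebra.mem_bot.1 h)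
  obtain ⟨y, hy, hconj⟩ := (notMem_iff_exists_ne_and_isConjRoot
    (mem_separableClosure_iff.1 hcsep) (Normal.splits ‹_› c)).1 hbot
  obtain ⟨σ, hσ⟩ := isConjRoot_iff_exists_algEquiv.1 hconj.symm
  exact hy ((hfix σ).symm.trans hσ)

/-- Galois-stable submodules of the `l`-torsion of `T + τ^s + T^(q-1) τ^(s+1)` are trivial. -/
theorem IsDrinfeldAction.eq_singleton_or_eq_torsion [Algebra (RatFunc Fq) L]
    [Normal (RatFunc Fq) L] {s : ℕ} (hs : 1 ≤ s) (hq : 3 ≤ Fintype.card Fq)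
    {φ : Fq[X] →+* AddMonoid.End L}
    (hφ : IsDrinfeldAction ((algebraMap (RatFunc Fq) L).comp RatFunc.C)
      (algebraMap (RatFunc Fq) L RatFunc.X) s φ)
    {l : Fq[X]} (hl : Irreducible l) (hlX : IsCoprime X l) {V : Set L}
    (hVl : V ⊆ {x | φ l x = 0}) (h0 : 0 ∈ V) (hadd : ∀ x ∈ V, ∀ y ∈ V, x + y ∈ V)
    (hsmul : ∀ a, ∀ x ∈ V, φ a x ∈ V) (hgal : ∀ σ : L ≃ₐ[RatFunc Fq] L, ∀ x ∈ V, σ x ∈ V) :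
    V = {0} ∨ V = {x | φ l x = 0} := by
  classical
  set ι : Fq →+* L := (algebraMap (RatFunc Fq) L).comp RatFunc.C with hι
  set T : L := algebraMap (RatFunc Fq) L RatFunc.X with hTdef
  have hev : ∀ a : Fq[X], eval₂ (RatFunc.C (K := Fq)) RatFunc.X a = algebraMap _ _ a := by
    intro a
    have : eval₂RingHom (RatFunc.C (K := Fq)) RatFunc.X = algebraMap Fq[X] (RatFunc Fq) :=
      Polynomial.ringHom_ext (by simp [RatFunc.algebraMap_C]) (by simp [RatFunc.algebraMap_X])
    exact congrArg (fun f ↦ f a) this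
  have hevL : ∀ a : Fq[X], algebraMap (RatFunc Fq) L (algebraMap _ _ a) = eval₂ ι T a := by
    intro a
    rw [← hev, hom_eval₂]
  have hinjL : Function.Injective (eval₂RingHom ι T) := by
    intro a b h
    change eval₂ ι T a = eval₂ ι T b at h
    rw [← hevL, ← hevL] at h
    exact RatFunc.algebraMap_injective Fq ((algebraMap (RatFunc Fq) L).injective h)
  have hT0 : T ≠ 0 := by simp [hTdef, RatFunc.X_ne_zero]
  have hXu : ¬ IsUnit (X : Fq[X]) := not_isUnit_X
  obtain ⟨f, hf, hf', hfd⟩ := hφ.exists_polynomial hs l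
  have hl0 : eval₂ (RatFunc.C (K := Fq)) RatFunc.X l ≠ 0 := by
    rw [hev]
    exact (map_ne_zero_iff _ (RatFunc.algebraMap_injective Fq)).2 hl.ne_zero
  have hf0 : f ≠ 0 := by
    rintro rfl
    rw [derivative_zero, eq_comm, C_eq_zero] at hf'
    exact hl0 hf'
  have hfsep : f.Separable := by
    rw [separable_def, hf']
    exact ⟨0, C (eval₂ RatFunc.C RatFunc.X l)⁻¹, by
      rw [zero_mul, zero_add, ← C_mul, inv_mul_cancel₀ hl0, C_1]⟩
  let W : Finset L := (f.aroots L).toFinset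
  have hW : ∀ x, x ∈ W ↔ φ l x = 0 := fun x ↦ by
    simp [W, hf, hf0, Multiset.mem_toFinset]
  have hWcard : W.card ≤ Fintype.card Fq ^ ((s + 1) * l.natDegree) :=
    (Multiset.toFinset_card_le _).trans ((card_roots' _).trans (natDegree_map_le.trans hfd))
  have hWset : {x | φ l x = 0} = (W : Set L) := by ext x; simp [hW]
  obtain ⟨V', rfl⟩ : ∃ V' : Finset L, V = V' :=
    (W.finite_toSet.subset (hWset ▸ hVl)).exists_finset_coe.imp fun _ h ↦ h.symm
  have hV : IsTorsionSubmodule φ l V' := ⟨h0, hadd, hsmul, hVl⟩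
  by_contra! hne
  obtain ⟨hne0, hneW⟩ := hne
  have hVW : V' ⊆ W := fun x hx ↦ (hW x).2 (hVl hx)
  have hlt : V'.card < Fintype.card Fq ^ ((s + 1) * l.natDegree) := by
    refine (Finset.card_lt_card (hVW.ssubset_of_ne fun h ↦ hneW ?_)).trans_le hWcard
    rw [hWset, h]
  have hsep : ∀ x ∈ V', IsSeparable (RatFunc Fq) x := fun x hx ↦
    hfsep.of_dvd (minpoly.dvd _ _ ((hf x).symm.trans (hVl hx)))
  obtain ⟨c, hc⟩ := prod_erase_zero_mem_range hsep hgal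
  have hc0 : algebraMap (RatFunc Fq) L c ≠ 0 := by
    rw [hc]
    exact Finset.prod_ne_zero_iff.2 fun x hx ↦ Finset.ne_of_mem_erase hx
  have hnum : c.num ≠ 0 := by
    refine RatFunc.num_ne_zero ?_
    rintro rfl
    simp at hc0
  have hcdiv : algebraMap (RatFunc Fq) L c = eval₂ ι T c.num / eval₂ ι T c.denom := by
    rw [← hevL, ← hevL, ← map_div₀, RatFunc.num_div_denom]
  have hnum_le : ∀ B : ValuationSubring L, B.valuation T ≤ 1 → B.valuation (eval₂ ι T c.num) ≤
      B.valuation (eval₂ ι T c.denom) := by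
    intro B hBT
    have hle : B.valuation (algebraMap (RatFunc Fq) L c) ≤ 1 := by
      rw [hc, map_prod]
      refine Finset.prod_le_one' fun x hx ↦ ?_
      rcases hBT.lt_or_eq with hBT | hBT
      · by_contra! hx1
        obtain ⟨m, hm⟩ := B.valuation.exists_map_eval₂_eq_pow ι hBT hnum
        obtain ⟨n, hn⟩ := B.valuation.exists_map_eval₂_eq_pow ι hBT c.denom_ne_zero
        refine (hφ.card_ge hV hl hlX hq hs B.valuation hBT
          ⟨x, Finset.mem_of_mem_erase hx, hx1⟩ (n := m - n) ?_).not_gt hlt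
        rw [← hc, hcdiv, map_div₀, hm, hn,
          zpow_sub₀ ((Valuation.ne_zero_iff _).2 hT0), zpow_natCast, zpow_natCast]
      · exact hφ.val_le_one hV hq hs B.valuation hBT.ge (Finset.mem_of_mem_erase hx)
    have hden : 0 < B.valuation (eval₂ ι T c.denom) := by
      rw [zero_lt_iff, Valuation.ne_zero_iff]
      exact (map_ne_zero_iff (eval₂RingHom ι T) hinjL).2 c.denom_ne_zero
    rwa [hcdiv, map_div₀, div_le_one₀ hden] at hle
  have hunit : IsUnit c.denom := by
    by_contra hnu
    obtain ⟨B, hB, hBd⟩ := exists_valuationSubring_of_injective _ hinjL hnu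
    have hBT : B.valuation T ≤ 1 := by simpa using hB X
    have hBn : B.valuation (eval₂ ι T c.num) < 1 := (hnum_le B hBT).trans_lt hBd
    obtain ⟨u, w, huw⟩ := RatFunc.isCoprime_num_denom c
    have h1 : B.valuation (eval₂ ι T (u * c.num + w * c.denom)) < 1 := by
      rw [eval₂_add, eval₂_mul, eval₂_mul]
      refine B.valuation.map_add_lt ?_ ?_ <;> rw [map_mul]
      · exact (mul_le_of_le_one_left' (hB u)).trans_lt hBn
      · exact (mul_le_of_le_one_left' (hB w)).trans_lt hBd
    rw [huw, eval₂_one, map_one] at h1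
    exact h1.false
  obtain ⟨B, -, hB⟩ := exists_valuationSubring_of_injective _
    (eval₂_inv_injective ι hT0 hinjL) hXu
  have hBT : 1 < B.valuation T := by
    have h : B.valuation T⁻¹ < 1 := by simpa using hB
    rwa [map_inv₀, inv_lt_one₀ (zero_lt_iff.2 ((Valuation.ne_zero_iff _).2 hT0))] at h
  have hge : 1 ≤ B.valuation (algebraMap (RatFunc Fq) L c) := by
    rw [hcdiv, map_div₀, B.valuation.map_eval₂_of_one_lt ι hBT hnum,
      B.valuation.map_eval₂_of_one_lt ι hBT c.denom_ne_zero, natDegree_eq_zero_of_isUnit hunit,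
      pow_zero, div_one]
    exact one_le_pow₀ hBT.le
  refine hge.not_gt ?_
  obtain ⟨x, hx, hx0⟩ : ∃ x ∈ V', x ≠ 0 := by
    by_contra! h
    exact hne0 (Set.eq_singleton_iff_unique_mem.2 ⟨h0, h⟩)
  have hxe : x ∈ V'.erase 0 := Finset.mem_erase.2 ⟨hx0, hx⟩
  rw [hc, map_prod, ← Finset.mul_prod_erase _ _ hxe]
  refine (mul_le_of_le_one_right' (Finset.prod_le_one' fun y hy ↦ ?_)).trans_lt
    (hφ.val_lt_one hV hq hs B.valuation hBT hx)
  exact (hφ.val_lt_one hV hq hs B.valuation hBT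
    (Finset.mem_of_mem_erase (Finset.mem_of_mem_erase hy))).le

end RationalFunctions

/-- There is `c = c(r)` such that for `p > c`: for every nonzero prime `𝔩 = (l) ≠ (T)`,
the Galois module `φ[𝔩]` is irreducible: the only Galois-stable `𝔽_𝔩`-subspaces of
`φ[𝔩]` are `0` and `φ[𝔩]`. -/
theorem mod_l_galois_module_irreducible (r : ℕ) (hr : r.Prime) (hr3 : 3 ≤ r) :
    ∃ c : ℕ, ∀ (p e q : ℕ), p.Prime → 5 ≤ p → c < p → 0 < e → q = p ^ e →
    ∀ (Fq : Type) [Field Fq] [Fintype Fq], Fintype.card Fq = q →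
    ∀ φ : Polynomial Fq →+* AddMonoid.End (Kbar Fq), IsDrinfeldPhi Fq q r φ →
    ∀ l : Polynomial Fq, l.Monic → Irreducible l → l ≠ X →
    ∀ V : Set (Kbar Fq), IsGaloisStableSubspace Fq φ l V →
    V = {0} ∨ V = phiTorsion Fq φ l := by
  refine ⟨0, ?_⟩
  intro p e q _ hp5 _ he hq Fq _ _ hcard φ hφ l hmon hl hlX V hV
  have hq3 : 3 ≤ Fintype.card Fq := by
    rw [hcard, hq]
    exact (show 3 ≤ p by omega).trans (Nat.le_self_pow he.ne' p)
  obtain ⟨s, rfl⟩ : ∃ s, r = s + 1 := ⟨r - 1, by omega⟩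
  have hact : IsDrinfeldAction ((algebraMap (RatFunc Fq) (Kbar Fq)).comp RatFunc.C)
      (algebraMap (RatFunc Fq) (Kbar Fq) RatFunc.X) s φ :=
    ⟨hφ.1, fun x ↦ by rw [hφ.2, hcard, Nat.add_sub_cancel]⟩
  have hcop : IsCoprime X l := irreducible_X.coprime_iff_not_dvd.2 fun h ↦
    hlX (eq_of_monic_of_associated hmon monic_X (irreducible_X.associated_of_dvd hl h).symm)
  exact hact.eq_singleton_or_eq_torsion (by omega) hq3 hl hcop hV.1 hV.2.1 hV.2.2.1 hV.2.2.2.1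
    hV.2.2.2.2
end
end

section
/- For every c ∈ 𝔽_q with c ≠ 0, the polynomial φ_{T−c}(x)/x = (T − c) + x^{q^{r−1}−1} + T^{q−1}·x^{q^r−1} is irreducible in F[x]. -/
open Polynomial

/-- The absolute value `p ↦ b ^ deg p` on `K[X]`, that is, the absolute value of the place at
infinity of `K(X)`. -/
noncomputable def degreeAbs (K : Type*) [Field K] (b : ℝ) (hb : 1 < b) :
    AbsoluteValue K[X] ℝ := by
  classical
  exact
  { toFun := fun p => if p = 0 then 0 else b ^ p.natDegree
    map_mul' := by
      intro x y
      by_cases hx : x = 0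
      · simp [hx]
      by_cases hy : y = 0
      · simp [hy]
      simp [hx, hy, natDegree_mul hx hy, pow_add]
    nonneg' := by
      intro x
      split_ifs <;> positivity
    eq_zero' := by
      intro x
      split_ifs with h
      · simp [h]
      · simp [h, (show b ≠ 0 by positivity)]
    add_le' := by
      intro x y
      by_cases hx : x = 0
      · simp [hx]
      by_cases hy : y = 0
      · simp [hy]
      by_cases hxy : x + y = 0
      · simp only [hxy, if_true, hx, hy, if_false]
        positivity
      simp only [hxy, hx, hy, if_false]
      have hxpos : 0 < b ^ x.natDegree := by positivity
      have hypos : 0 < b ^ y.natDegree := by positivity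
      rcases le_max_iff.1 (natDegree_add_le x y) with h | h
      · linarith [pow_le_pow_right₀ hb.le h]
      · linarith [pow_le_pow_right₀ hb.le h] }

lemma degreeAbs_of_ne_zero {K : Type*} [Field K] {b : ℝ} (hb : 1 < b) {x : K[X]} (hx : x ≠ 0) :
    degreeAbs K b hb x = b ^ x.natDegree := by
  simp [degreeAbs, hx]

lemma isNonarchimedean_degreeAbs (K : Type*) [Field K] {b : ℝ} (hb : 1 < b) :
    IsNonarchimedean (degreeAbs K b hb) := by
  intro x y
  by_cases hx : x = 0
  · simp [hx]
  by_cases hy : y = 0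
  · simp [hy]
  by_cases hxy : x + y = 0
  · simp only [hxy, map_zero]
    exact le_max_of_le_left ((degreeAbs K b hb).nonneg x)
  rw [degreeAbs_of_ne_zero hb hx, degreeAbs_of_ne_zero hb hy, degreeAbs_of_ne_zero hb hxy]
  rcases le_max_iff.1 (natDegree_add_le x y) with h | h
  · exact le_max_of_le_left (pow_le_pow_right₀ hb.le h)
  · exact le_max_of_le_right (pow_le_pow_right₀ hb.le h)

/-- If the Newton polygon of `g * h` is a single segment of slope given by `c`, so is that
of `g`. -/
lemma abv_coeff_zero_eq_of_gaussNorm_mul_le {R : Type*} [CommRing R] [IsDomain R]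
    {v : AbsoluteValue R ℝ} (hv : IsNonarchimedean v) {c : ℝ} (hc : 0 < c) {g h : R[X]}
    (hg : g ≠ 0) (hh : h ≠ 0)
    (h0 : (g * h).gaussNorm v c ≤ v ((g * h).coeff 0))
    (h1 : (g * h).gaussNorm v c ≤ v (g * h).leadingCoeff * c ^ (g * h).natDegree) :
    v (g.coeff 0) = v g.leadingCoeff * c ^ g.natDegree := by
  rw [gaussNorm_mul hv hc] at h0 h1
  rw [mul_coeff_zero, map_mul] at h0
  rw [leadingCoeff_mul, natDegree_mul hg hh, map_mul, pow_add] at h1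
  have pos : ∀ {p : R[X]}, p ≠ 0 → 0 < v p.leadingCoeff * c ^ p.natDegree := fun hp =>
    mul_pos (v.pos (leadingCoeff_ne_zero.2 hp)) (pow_pos hc _)
  have le0 : ∀ p : R[X], v (p.coeff 0) ≤ p.gaussNorm v c := fun p => by
    simpa using p.le_gaussNorm v hc.le 0
  have le1 : ∀ p : R[X], v p.leadingCoeff * c ^ p.natDegree ≤ p.gaussNorm v c := fun p =>
    p.le_gaussNorm v hc.le _
  have posh : 0 < h.gaussNorm v c := (pos hh).trans_le (le1 h)
  have posg : 0 < g.gaussNorm v c := (pos hg).trans_le (le1 g)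
  have e0 : v (g.coeff 0) = g.gaussNorm v c := by
    refine le_antisymm (le0 g) (le_of_mul_le_mul_right (h0.trans ?_) posh)
    exact mul_le_mul_of_nonneg_left (le0 h) (v.nonneg _)
  have e1 : v g.leadingCoeff * c ^ g.natDegree = g.gaussNorm v c := by
    refine le_antisymm (le1 g) (le_of_mul_le_mul_right (h1.trans ?_) posh)
    calc _ = (v g.leadingCoeff * c ^ g.natDegree) * (v h.leadingCoeff * c ^ h.natDegree) := by
          ring
      _ ≤ _ := mul_le_mul_of_nonneg_left (le1 h) (pos hg).le
  rw [e0, e1]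

/-- The polynomial `(T - c) + x ^ m + T ^ s * x ^ N` in `K[T][x]`. -/
noncomputable def phiTrinomial {K : Type*} [CommRing K] (c : K) (m s N : ℕ) : K[X][X] :=
  C (X - C c) + X ^ m + C (X ^ s) * X ^ N

section

variable {K : Type*} [Field K] (c : K) {m s N : ℕ}

lemma phiTrinomial_coeff (hm : 0 < m) (hmN : m < N) (i : ℕ) :
    (phiTrinomial c m s N).coeff i =
      if i = 0 then X - C c else if i = m then 1 else if i = N then X ^ s else 0 := by
  have hN : N ≠ 0 := by omega
  simp only [phiTrinomial, coeff_add, coeff_C, coeff_X_pow, coeff_C_mul]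
  split_ifs <;> first | omega | simp

lemma phiTrinomial_natDegree (hm : 0 < m) (hmN : m < N) :
    (phiTrinomial c m s N).natDegree = N := by
  refine natDegree_eq_of_le_of_coeff_ne_zero ?_ ?_
  · rw [natDegree_le_iff_coeff_eq_zero]
    intro i hi
    rw [phiTrinomial_coeff c hm hmN, if_neg (by omega), if_neg (by omega), if_neg (by omega)]
  · rw [phiTrinomial_coeff c hm hmN, if_neg (by omega), if_neg (by omega), if_pos rfl]
    exact pow_ne_zero _ X_ne_zero

lemma phiTrinomial_leadingCoeff (hm : 0 < m) (hmN : m < N) :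
    (phiTrinomial c m s N).leadingCoeff = X ^ s := by
  rw [leadingCoeff, phiTrinomial_natDegree c hm hmN, phiTrinomial_coeff c hm hmN,
    if_neg (by omega), if_neg (by omega), if_pos rfl]

lemma phiTrinomial_ne_zero (hm : 0 < m) (hmN : m < N) : phiTrinomial c m s N ≠ 0 := by
  intro h
  have := phiTrinomial_natDegree c (s := s) hm hmN
  simp [h] at this
  omega

/-- Ramification at infinity: the degree of a factor of the trinomial is constrained by the slope
of the Newton polygon at the place `T = ∞`. -/
lemma dvd_mul_natDegree_of_mul_eq_phiTrinomial (hm : 0 < m) (hmN : m < N) {g h : K[X][X]}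
    (hgh : g * h = phiTrinomial c m (s + 1) N) : N ∣ s * g.natDegree := by
  have hf := phiTrinomial_ne_zero c (s := s + 1) hm hmN
  have hg : g ≠ 0 := by rintro rfl; simp [← hgh] at hf
  have hh : h ≠ 0 := by rintro rfl; simp [← hgh] at hf
  have hN : N ≠ 0 := by omega
  have hb : (1 : ℝ) < 2 ^ N := one_lt_pow₀ one_lt_two hN
  have hc : (0 : ℝ) < (2 ^ s)⁻¹ := by positivity
  have hc1 : ((2 : ℝ) ^ s)⁻¹ ≤ 1 := inv_le_one_of_one_le₀ (one_le_pow₀ one_le_two)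
  set v := degreeAbs K (2 ^ N) hb with hvdef
  have hX : v (X : K[X]) = 2 ^ N := by simp [hvdef, degreeAbs_of_ne_zero hb X_ne_zero]
  have hXc : v (X - C c) = 2 ^ N := by
    simp [hvdef, degreeAbs_of_ne_zero hb (X_sub_C_ne_zero c)]
  have htop : ((2 : ℝ) ^ N) ^ (s + 1) * ((2 ^ s)⁻¹) ^ N = 2 ^ N := by
    rw [inv_pow, ← pow_mul, ← pow_mul, mul_inv_eq_iff_eq_mul₀ (by positivity), ← pow_add]
    congr 1
    ring
  have hnorm : (g * h).gaussNorm v (2 ^ s)⁻¹ ≤ 2 ^ N := by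
    obtain ⟨i, hi⟩ := (g * h).exists_eq_gaussNorm v (2 ^ s)⁻¹
    rw [hi, hgh, phiTrinomial_coeff c hm hmN]
    split_ifs with h0 h1 h2
    · simp [h0, hXc]
    · rw [map_one, one_mul]
      exact (pow_le_one₀ hc.le hc1).trans hb.le
    · rw [map_pow, hX, h2, htop]
    · simp
  have key := abv_coeff_zero_eq_of_gaussNorm_mul_le (isNonarchimedean_degreeAbs K hb) hc hg hh
    (by
      refine hnorm.trans_eq ?_
      rw [hgh, phiTrinomial_coeff c hm hmN, if_pos rfl, ← hvdef, hXc])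
    (by
      refine hnorm.trans_eq ?_
      rw [hgh, phiTrinomial_leadingCoeff c hm hmN, phiTrinomial_natDegree c hm hmN, ← hvdef, map_pow,
        hX, htop])
  have hg0 : g.coeff 0 ≠ 0 := by
    intro h0
    have := congrArg (coeff · 0) hgh
    simp only [mul_coeff_zero, h0, zero_mul, phiTrinomial_coeff c hm hmN, if_true] at this
    exact X_sub_C_ne_zero c this.symm
  rw [degreeAbs_of_ne_zero hb hg0, degreeAbs_of_ne_zero hb (leadingCoeff_ne_zero.2 hg), inv_pow,
    eq_mul_inv_iff_mul_eq₀ (by positivity), ← pow_mul, ← pow_mul, ← pow_mul, ← pow_add] at key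
  have key' := Nat.pow_right_injective le_rfl (by exact_mod_cast key :
    (2 : ℕ) ^ (N * (g.coeff 0).natDegree + s * g.natDegree) = 2 ^ (N * g.leadingCoeff.natDegree))
  exact (Nat.dvd_add_right (dvd_mul_right N _)).1 (key' ▸ dvd_mul_right N _)

end

/-- The Eisenstein-type obstruction: the derivative of `x * (g * h)` being `T - c`, the factors
`g` and `h` cannot both be very singular at a point of the fibre over `T = c`. -/
lemma false_of_isRoot_of_derivative_eq {K : Type*} [Field K] {c : K} {g h : K[X][X]}
    (hd : derivative (X * (g * h)) = C (X - C c)) (u : K)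
    (hg : (g.map (evalRingHom c)).IsRoot u) (hh : (h.map (evalRingHom c)).IsRoot u)
    (hg' : u * (derivative (g.map (evalRingHom c))).eval u = 0)
    (hh' : u * (derivative (h.map (evalRingHom c))).eval u = 0) : False := by
  have aux : ∀ p : K[X][X], (p.map (evalRingHom c)).eval u = (p.eval (C u)).eval c := by
    intro p
    have : u = evalRingHom c (C u) := by simp
    conv_lhs => rw [this]
    rw [eval_map_apply]
    rfl
  rw [IsRoot, aux] at hg hh
  rw [derivative_map, aux] at hg' hh'
  obtain ⟨G, hG⟩ := dvd_iff_isRoot.2 hg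
  obtain ⟨H, hH⟩ := dvd_iff_isRoot.2 hh
  obtain ⟨G', hG'⟩ : X - C c ∣ C u * (derivative g).eval (C u) := by
    rw [dvd_iff_isRoot]; simpa using hg'
  obtain ⟨H', hH'⟩ : X - C c ∣ C u * (derivative h).eval (C u) := by
    rw [dvd_iff_isRoot]; simpa using hh'
  have := congrArg (eval (C u)) hd
  simp only [derivative_mul, derivative_X, eval_add, eval_mul, eval_X, eval_C, one_mul,
    mul_add] at this
  have h2 : (X - C c) * ((X - C c) * (G * H + G' * H + G * H')) = (X - C c) * 1 := by
    rw [mul_one]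
    linear_combination this - (X - C c) * H * hG' - (X - C c) * G * hH' -
      eval (C u) h * hG - (X - C c) * G * hH - C u * eval (C u) (derivative g) * hH -
      C u * eval (C u) (derivative h) * hG
  exact not_isUnit_X_sub_C c (IsUnit.of_mul_eq_one _ (mul_left_cancel₀ (X_sub_C_ne_zero c) h2))

lemma derivative_X_mul_phiTrinomial {K : Type*} [Field K] (c : K) {m s N : ℕ}
    (hm : ((m + 1 : ℕ) : K) = 0) (hN : ((N + 1 : ℕ) : K) = 0) :
    derivative (X * phiTrinomial c m s N) = C (X - C c) := by
  have cast : ∀ n : ℕ, (n : K) = 0 → (n : K[X][X]) = 0 := fun n hn => by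
    rw [← C_eq_natCast, ← C_eq_natCast, hn, C_0, C_0]
  have : X * phiTrinomial c m s N = C (X - C c) * X + X ^ (m + 1) + C (X ^ s) * X ^ (N + 1) := by
    rw [phiTrinomial]; ring
  rw [this]
  simp only [derivative_add, derivative_C_mul, derivative_X, derivative_X_pow, C_eq_natCast,
    cast _ hm, cast _ hN]
  simp

/-- Over the place `T = c`, the trinomial reduces to `x ^ m * (x ^ s + 1) ^ (p ^ k)`. -/
lemma map_evalRingHom_phiTrinomial {K : Type*} [Field K] {p : ℕ} [ExpChar K p] {c : K}
    {s k m N : ℕ}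
    (hc : c ^ s = 1) (hN : N = s * p ^ k + m) :
    (phiTrinomial c m s N).map (evalRingHom c) = X ^ m * (X ^ s - C (-1)) ^ p ^ k := by
  have : (X ^ s - C (-1) : K[X]) = X ^ s + 1 := by simp
  rw [this, add_pow_expChar_pow, hN]
  have hc' : (C c : K[X]) ^ s = 1 := by rw [← C_pow, hc, C_1]
  simp [phiTrinomial, hc']
  ring

/-- The degree of a factor of the trinomial, computed on the fibre over `T = c`. -/
lemma exists_natDegree_eq_of_mul_eq_phiTrinomial {K : Type*} [Field K] [IsAlgClosed K] {p : ℕ}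
    [ExpChar K p] {c : K} {s k m N : ℕ} (hc : c ^ s = 1) (hs : (s : K) ≠ 0) (hm : 0 < m)
    (hQ : p ^ k = m + 1) (hN : N = s * p ^ k + m)
    (hmK : ((m + 1 : ℕ) : K) = 0) (hNK : ((N + 1 : ℕ) : K) = 0)
    {g h : K[X][X]} (hgh : g * h = phiTrinomial c m s N) :
    ∃ a b : ℕ, b ≤ s ∧ g.natDegree = a * m + b := by
  classical
  have hs0 : s ≠ 0 := by rintro rfl; simp at hs
  have hc0 : c ≠ 0 := by rintro rfl; simp [hs0] at hc
  have hmN : m < N := by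
    have : 0 < s * p ^ k := Nat.mul_pos (by omega) (by omega)
    omega
  have hd : derivative (X * (g * h)) = C (X - C c) := by
    rw [hgh, derivative_X_mul_phiTrinomial c hmK hNK]
  set g' := g.map (evalRingHom c) with hg'
  set h' := h.map (evalRingHom c) with hh'
  have hprod : g' * h' = X ^ m * (X ^ s - C (-1)) ^ p ^ k := by
    rw [hg', hh', ← Polynomial.map_mul, hgh, map_evalRingHom_phiTrinomial hc hN]
  have hsep : (X ^ s - C (-1) : K[X]).Separable := separable_X_pow_sub_C _ hs (by simp)
  have hsepne : (X ^ s - C (-1) : K[X]) ≠ 0 := hsep.ne_zero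
  have hne : g' * h' ≠ 0 := by
    rw [hprod]
    exact mul_ne_zero (pow_ne_zero _ X_ne_zero) (pow_ne_zero _ hsepne)
  have hgne : g' ≠ 0 := left_ne_zero_of_mul hne
  have hhne : h' ≠ 0 := right_ne_zero_of_mul hne
  have hdeg : g'.natDegree = g.natDegree := by
    refine natDegree_map_of_leadingCoeff_ne_zero _ fun h0 => ?_
    have := congrArg (fun f => evalRingHom c f.leadingCoeff) hgh
    simp only [leadingCoeff_mul, map_mul, h0, zero_mul, phiTrinomial_leadingCoeff c hm hmN,
      map_pow] at this
    simp [hc] at this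
  have hcount : ∀ u : K, g'.roots.count u + h'.roots.count u =
      (if u = 0 then m else 0) + (m + 1) * (X ^ s - C (-1) : K[X]).roots.count u := by
    intro u
    rw [← Multiset.count_add, ← roots_mul hne, hprod, roots_mul (hprod ▸ hne), roots_pow,
      roots_pow, roots_X, Multiset.count_add, Multiset.count_nsmul, Multiset.count_nsmul, hQ,
      Multiset.count_singleton]
    simp
  set S := (X ^ s - C (-1) : K[X]).roots.toFinset with hS
  have hScard : S.card ≤ s :=
    (Multiset.toFinset_card_le _).trans ((card_roots' _).trans_eq (natDegree_X_pow_sub_C))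
  have hloc : ∀ u : K, ∃ a b : ℕ, b ≤ (if u ∈ S then 1 else 0) ∧
      g'.roots.count u = a * m + b := by
    intro u
    have hcu := hcount u
    by_cases hu : u = 0
    · have hnr : (X ^ s - C (-1) : K[X]).roots.count u = 0 := by
        rw [Multiset.count_eq_zero, mem_roots hsepne, hu]
        simp [hs0]
      rw [hnr, if_pos hu] at hcu
      have : g'.roots.count u = 0 ∨ h'.roots.count u = 0 := by
        by_contra! hcon
        rw [Multiset.count_ne_zero, Multiset.count_ne_zero, mem_roots hgne, mem_roots hhne] at hcon
        exact false_of_isRoot_of_derivative_eq hd u hcon.1 hcon.2 (by simp [hu]) (by simp [hu])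
      rcases this with h0 | h0
      · exact ⟨0, 0, by simp, by simp [h0]⟩
      · exact ⟨1, 0, by simp, by omega⟩
    · rw [if_neg hu, zero_add] at hcu
      by_cases huS : u ∈ S
      · have hone : (X ^ s - C (-1) : K[X]).roots.count u = 1 :=
          Multiset.count_eq_one_of_mem (nodup_roots hsep) (Multiset.mem_toFinset.1 huS)
        rw [hone, mul_one] at hcu
        have : g'.roots.count u ≤ 1 ∨ h'.roots.count u ≤ 1 := by
          by_contra! hcon
          rw [count_roots, count_roots, one_lt_rootMultiplicity_iff_isRoot hgne,
            one_lt_rootMultiplicity_iff_isRoot hhne] at hcon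
          exact false_of_isRoot_of_derivative_eq hd u hcon.1.1 hcon.2.1
            (by rw [hcon.1.2.eq_zero, mul_zero]) (by rw [hcon.2.2.eq_zero, mul_zero])
        rw [if_pos huS]
        rcases this with h1 | h1
        · exact ⟨0, _, h1, by simp⟩
        · exact ⟨1, 1 - h'.roots.count u, by omega, by omega⟩
      · have hnr : (X ^ s - C (-1) : K[X]).roots.count u = 0 := by
          rw [Multiset.count_eq_zero]
          exact fun hmem => huS (Multiset.mem_toFinset.2 hmem)
        rw [hnr, mul_zero] at hcu
        exact ⟨0, 0, by simp, by omega⟩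
  choose a b hb hab using hloc
  refine ⟨∑ u ∈ g'.roots.toFinset, a u, ∑ u ∈ g'.roots.toFinset, b u, ?_, ?_⟩
  · calc ∑ u ∈ g'.roots.toFinset, b u ≤ ∑ u ∈ g'.roots.toFinset, (if u ∈ S then 1 else 0) :=
          Finset.sum_le_sum fun u _ => hb u
      _ = (g'.roots.toFinset ∩ S).card := by
          rw [← Finset.sum_filter, Finset.sum_const, smul_eq_mul, mul_one,
            Finset.filter_mem_eq_inter]
      _ ≤ S.card := Finset.card_le_card Finset.inter_subset_right
      _ ≤ s := hScard
  · rw [← hdeg, ← IsAlgClosed.card_roots_eq_natDegree, ← Multiset.toFinset_sum_count_eq,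
      Finset.sum_mul, ← Finset.sum_add_distrib]
    exact Finset.sum_congr rfl fun u _ => hab u

lemma eq_zero_or_eq_of_dvd_mul {s m N n a b : ℕ} (hs : 0 < s) (hm : s * (s + 1) < m)
    (hN : N = (s + 2) * m + (s + 1)) (hn : n = a * m + b) (hb : b ≤ s + 1) (hnN : n ≤ N)
    (hdvd : N ∣ s * n) : n = 0 ∨ n = N := by
  obtain ⟨j, hj⟩ := hdvd
  have hNpos : 0 < N := by omega
  have hjs : j ≤ s := by
    refine le_of_mul_le_mul_left ?_ hNpos
    rw [← hj, mul_comm N]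
    exact Nat.mul_le_mul_left s hnN
  have hmod : s * b ≡ j * (s + 1) [MOD m] := by
    have h1 : s * b + m * (s * a) = j * (s + 1) + m * (j * (s + 2)) := by
      calc _ = s * n := by rw [hn]; ring
        _ = _ := by rw [hj, hN]; ring
    have h2 := congrArg (· % m) h1
    simpa only [Nat.add_mul_mod_self_left, Nat.ModEq] using h2
  have heq : s * b = j * (s + 1) := hmod.eq_of_lt_of_lt
    ((Nat.mul_le_mul_left s hb).trans_lt hm) ((Nat.mul_le_mul_right _ hjs).trans_lt hm)
  have hsj : s ∣ j :=
    (Nat.coprime_self_add_right.2 (Nat.coprime_one_right s)).dvd_of_dvd_mul_right ⟨b, heq.symm⟩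
  rcases Nat.eq_zero_or_pos j with h0 | hpos
  · left
    rw [h0, mul_zero] at hj
    exact (Nat.mul_eq_zero.1 hj).resolve_left hs.ne'
  · right
    obtain rfl : j = s := le_antisymm hjs (Nat.le_of_dvd hpos hsj)
    exact Nat.eq_of_mul_eq_mul_left hs (hj.trans (mul_comm _ _))

/-- Over an algebraically closed field of constants, the trinomial has no factor of intermediate
degree. -/
lemma natDegree_eq_zero_or_eq_of_mul_eq_phiTrinomial {K : Type*} [Field K] [IsAlgClosed K] {p : ℕ}
    [ExpChar K p] {c : K} {s k m N : ℕ} (hc : c ^ (s + 1) = 1) (hs : 0 < s)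
    (hsK : ((s + 2 : ℕ) : K) = 0) (hm : s * (s + 1) < m) (hQ : p ^ k = m + 1)
    (hmK : ((m + 1 : ℕ) : K) = 0) (hN : N + 1 = (s + 2) * (m + 1)) {g h : K[X][X]}
    (hgh : g * h = phiTrinomial c m (s + 1) N) : g.natDegree = 0 ∨ g.natDegree = N := by
  have hm0 : 0 < m := by omega
  have hN' : N = (s + 2) * m + (s + 1) := by
    have : (s + 2) * (m + 1) = (s + 2) * m + (s + 1) + 1 := by ring
    omega
  have hmN : m < N := by nlinarith
  have hs1 : ((s + 1 : ℕ) : K) ≠ 0 := by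
    intro h1
    rw [show s + 2 = s + 1 + 1 from rfl, Nat.cast_add, h1] at hsK
    simp at hsK
  obtain ⟨a, b, hb, hab⟩ := exists_natDegree_eq_of_mul_eq_phiTrinomial hc hs1 hm0 hQ
    (by rw [hQ, hN']; ring) hmK (by rw [hN, Nat.cast_mul, hmK, mul_zero]) hgh
  refine eq_zero_or_eq_of_dvd_mul hs hm hN' hab hb ?_
    (dvd_mul_natDegree_of_mul_eq_phiTrinomial c hm0 hmN hgh)
  have hf := phiTrinomial_ne_zero c (s := s + 1) hm0 hmN
  rw [← phiTrinomial_natDegree c (s := s + 1) hm0 hmN, ← hgh]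
  rw [← hgh] at hf
  rw [natDegree_mul (left_ne_zero_of_mul hf) (right_ne_zero_of_mul hf)]
  exact Nat.le_add_right _ _

lemma isPrimitive_phiTrinomial {K : Type*} [Field K] (c : K) {m s N : ℕ} (hm : 0 < m)
    (hmN : m < N) : (phiTrinomial c m s N).IsPrimitive := by
  intro a ha
  have := (C_dvd_iff_dvd_coeff _ _).1 ha m
  rw [phiTrinomial_coeff c hm hmN, if_neg hm.ne', if_pos rfl] at this
  exact isUnit_of_dvd_one this

lemma irreducible_phiTrinomial {K : Type*} [Field K] {p : ℕ} [ExpChar K p] {c : K} {s k m N : ℕ}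
    (hc : c ^ (s + 1) = 1) (hs : 0 < s) (hsK : ((s + 2 : ℕ) : K) = 0) (hm : s * (s + 1) < m)
    (hQ : p ^ k = m + 1) (hmK : ((m + 1 : ℕ) : K) = 0) (hN : N + 1 = (s + 2) * (m + 1)) :
    Irreducible (phiTrinomial c m (s + 1) N) := by
  have hm0 : 0 < m := by omega
  have hmN : m < N := by nlinarith
  have hprim := isPrimitive_phiTrinomial c (s := s + 1) hm0 hmN
  have unit_of_degree : ∀ g h : K[X][X], g * h = phiTrinomial c m (s + 1) N → g.natDegree = 0 →
      IsUnit g := by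
    intro g h hgh h0
    rw [eq_C_of_natDegree_eq_zero h0] at hgh ⊢
    exact (hprim _ (hgh ▸ dvd_mul_right _ _)).map C
  refine ⟨fun hu => ?_, fun {g h} hgh => ?_⟩
  · have := natDegree_eq_zero_of_isUnit hu
    rw [phiTrinomial_natDegree c hm0 hmN] at this
    omega
  set i := algebraMap K (AlgebraicClosure K)
  have hinj : Function.Injective (mapRingHom i) := map_injective i i.injective
  have : ExpChar (AlgebraicClosure K) p := expChar_of_injective_ringHom i.injective p
  have hgh' : g.map (mapRingHom i) * h.map (mapRingHom i) = phiTrinomial (i c) m (s + 1) N := by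
    rw [← Polynomial.map_mul, ← hgh]
    simp [phiTrinomial]
  have key := natDegree_eq_zero_or_eq_of_mul_eq_phiTrinomial (p := p) (k := k)
    (by rw [← map_pow, hc, map_one]) hs
    (by rw [← map_natCast i, hsK, map_zero]) hm hQ (by rw [← map_natCast i, hmK, map_zero]) hN hgh'
  rw [natDegree_map_eq_of_injective hinj] at key
  rcases key with h0 | h0
  · exact Or.inl (unit_of_degree g h hgh.symm h0)
  · refine Or.inr (unit_of_degree h g (by rw [mul_comm, hgh]) ?_)
    have hd := phiTrinomial_natDegree c (s := s + 1) hm0 hmN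
    have hf := phiTrinomial_ne_zero c (s := s + 1) hm0 hmN
    rw [hgh] at hd hf
    rw [natDegree_mul (left_ne_zero_of_mul hf) (right_ne_zero_of_mul hf)] at hd
    omega

/-- For every `0 ≠ c ∈ 𝔽_q`, the polynomial
`φ_{T−c}(x)/x = (T − c) + x^{q^{r−1}−1} + T^{q−1}·x^{q^r−1}` is irreducible over
`F = 𝔽_q(T)`. -/
theorem phi_T_sub_c_div_x_irreducible
    (p e q r : ℕ) (hp : p.Prime) (hp5 : 5 ≤ p) (he : 0 < e) (hq : q = p ^ e)
    (hr : r.Prime) (hr3 : 3 ≤ r)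
    (Fq : Type) [Field Fq] [Fintype Fq] (hFq : Fintype.card Fq = q)
    (c : Fq) (hc : c ≠ 0) :
    Irreducible
      (Polynomial.C (RatFunc.X - RatFunc.C c) + X ^ (q ^ (r - 1) - 1) +
        Polynomial.C ((RatFunc.X : RatFunc Fq) ^ (q - 1)) * X ^ (q ^ r - 1)) := by
  have hpf : Fact p.Prime := ⟨hp⟩
  have hchar : CharP Fq p := by
    obtain ⟨p', hp'⟩ := CharP.exists Fq
    obtain ⟨n, hp'prime, hn⟩ := FiniteField.card Fq p'
    have : p ∣ p' ^ (n : ℕ) := by rw [← hn, hFq, hq]; exact dvd_pow_self p he.ne'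
    rwa [(Nat.prime_dvd_prime_iff_eq hp hp'prime).1 (hp.dvd_of_dvd_pow this)]
  have hexp : ExpChar Fq p := ExpChar.prime hp
  have hq5 : 5 ≤ q := hq ▸ hp5.trans (Nat.le_self_pow he.ne' p)
  have hqK : (q : Fq) = 0 := by rw [← hFq, Nat.cast_card_eq_zero]
  obtain ⟨s, rfl⟩ : ∃ s, q = s + 2 := ⟨q - 2, by omega⟩
  obtain ⟨t, rfl⟩ : ∃ t, r = t + 1 := ⟨r - 1, by omega⟩
  have ht : t ≠ 0 := by omega
  have hpos : 0 < (s + 2) ^ t := by positivity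
  have hsq : (s + 2) ^ 2 ≤ (s + 2) ^ t := Nat.pow_le_pow_right (by omega) (by omega)
  have hm1 : (s + 2) ^ t - 1 + 1 = (s + 2) ^ t := Nat.sub_add_cancel hpos
  have hN1 : (s + 2) ^ (t + 1) - 1 + 1 = (s + 2) ^ (t + 1) :=
    Nat.sub_add_cancel (Nat.pow_pos (by omega))
  have hc1 : c ^ (s + 1) = 1 := by
    have := FiniteField.pow_card_sub_one_eq_one c hc
    rwa [hFq] at this
  have hsm : s * (s + 1) < (s + 2) ^ t - 1 := by
    have : s * (s + 1) + 1 < (s + 2) ^ 2 := by nlinarith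
    omega
  have hirr := irreducible_phiTrinomial (p := p) (k := e * t) (m := (s + 2) ^ t - 1)
    (N := (s + 2) ^ (t + 1) - 1) hc1 (by omega) hqK hsm
    (by rw [hm1, hq, pow_mul]) (by rw [hm1, Nat.cast_pow, hqK, zero_pow ht])
    (by rw [hN1, hm1, pow_succ'])
  have hprim := isPrimitive_phiTrinomial c (m := (s + 2) ^ t - 1) (s := s + 1)
    (N := (s + 2) ^ (t + 1) - 1) (by omega) (by
      have : (s + 2) ^ t < (s + 2) ^ (t + 1) := Nat.pow_lt_pow_right (by omega) (by omega)
      omega)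
  rw [hprim.irreducible_iff_irreducible_map_fraction_map (K := RatFunc Fq)] at hirr
  simpa [phiTrinomial, RatFunc.algebraMap_X, RatFunc.algebraMap_C] using hirr
end
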